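/- arXiv:2605.01213 — 9 statements merged into one kernel-verified Lean document; each statement's English description precedes it below -/
import Mathlib

section
/- Let w ≥ 3 be an integer and let C ≤ F₂ⁿ be a linear code spanned by vectors of Hamming weight at most w such that the union of the supports of the codewords of C equals {1,…,n}. Then for every real λ with 0 ≤ λ ≤ 1, Q_C(λ) ≤ ((1+λ)^w / (1+λ^w))^(n/w). -/
/-- The weight of a coset `A ∈ F₂^ι / C`: the minimum Hamming weight of a vector in `A`. -/
noncomputable def cosetWeight {ι : Type} [Fintype ι]
    (C : Submodule (ZMod 2) (ι → ZMod 2)) (A : (ι → ZMod 2) ⧸ C) : ℕ :=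
  sInf {k | ∃ x : ι → ZMod 2, Submodule.Quotient.mk x = A ∧ hammingNorm x = k}

/-- The coset-weight generating function `Q_C(λ) = Σ_{A ∈ F₂^ι/C} λ^{w_H(A)}`. -/
noncomputable def cosetGF {ι : Type} [Fintype ι]
    (C : Submodule (ZMod 2) (ι → ZMod 2)) (lam : ℝ) : ℝ :=
  ∑ᶠ A : (ι → ZMod 2) ⧸ C, lam ^ cosetWeight C A

open Finset

theorem exists_hammingNorm_eq_cosetWeight {ι : Type} [Fintype ι]
    (C : Submodule (ZMod 2) (ι → ZMod 2)) (A : (ι → ZMod 2) ⧸ C) :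
    ∃ x : ι → ZMod 2, Submodule.Quotient.mk x = A ∧ hammingNorm x = cosetWeight C A := by
  obtain ⟨y, hy⟩ := Submodule.Quotient.mk_surjective C A
  exact Nat.sInf_mem (s := {k | ∃ x : ι → ZMod 2,
    Submodule.Quotient.mk x = A ∧ hammingNorm x = k}) ⟨_, y, hy, rfl⟩

theorem sum_pow_hammingNorm {ι : Type} [Fintype ι] [DecidableEq ι] (lam : ℝ) :
    ∑ x : ι → ZMod 2, lam ^ hammingNorm x = (1 + lam) ^ Fintype.card ι := by
  have h (x : ι → ZMod 2) : lam ^ hammingNorm x = ∏ i, if x i ≠ 0 then lam else 1 := by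
    rw [Finset.prod_ite, prod_const, prod_const_one, mul_one, hammingNorm]
  have h2 : ∑ a : ZMod 2, (if a ≠ 0 then lam else 1) = 1 + lam := by
    rw [show (univ : Finset (ZMod 2)) = {0, 1} from rfl]
    simp
  simp_rw [h]
  rw [← Fintype.piFinset_univ,
    Finset.sum_prod_piFinset univ fun (_ : ι) (a : ZMod 2) => if a ≠ 0 then lam else 1]
  simp_rw [h2]
  simp

theorem hammingNorm_add_le {ι : Type} [Fintype ι] (x y : ι → ZMod 2) :
    hammingNorm (x + y) ≤ hammingNorm x + hammingNorm y := by
  have h := hammingDist_triangle x 0 y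
  rwa [hammingDist_zero_right, hammingDist_zero_left, hammingDist_eq_hammingNorm,
    show -x = x from funext fun i => CharTwo.neg_eq (x i)] at h

theorem hammingNorm_sum_le {ι : Type} [Fintype ι] {w : ℕ} (T : Finset (ι → ZMod 2))
    (hT : ∀ x ∈ T, hammingNorm x ≤ w) : hammingNorm (∑ x ∈ T, x) ≤ w * #T := by
  calc hammingNorm (∑ x ∈ T, x) ≤ ∑ x ∈ T, hammingNorm x :=
        Finset.le_sum_of_subadditive _ hammingNorm_zero.le hammingNorm_add_le _ _
    _ ≤ w * #T := by simpa [mul_comm] using Finset.sum_le_card_nsmul T _ w hT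

/-- Distinct subsets of a linearly independent set over `F₂` have distinct sums. -/
theorem LinearIndepOn.injOn_sum_zmod_two {V : Type*} [AddCommGroup V] [Module (ZMod 2) V]
    {B : Finset V} (hB : LinearIndepOn (ZMod 2) id (B : Set V)) :
    Set.InjOn (fun T : Finset V => ∑ x ∈ T, x) B.powerset := by
  classical
  intro T hT U hU h
  rw [mem_coe, mem_powerset] at hT hU
  have hsum (T : Finset V) (hT : T ⊆ B) :
      ∑ x ∈ B, (if x ∈ T then (1 : ZMod 2) else 0) • x = ∑ x ∈ T, x := by
    simp_rw [ite_smul, one_smul, zero_smul]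
    rw [← Finset.sum_filter, Finset.filter_mem_eq_inter, Finset.inter_eq_right.mpr hT]
  have h0 : ∑ x ∈ B, ((if x ∈ T then (1 : ZMod 2) else 0) - if x ∈ U then 1 else 0) • id x = 0 := by
    simp_rw [sub_smul, id, Finset.sum_sub_distrib]
    rw [hsum T hT, hsum U hU]
    exact sub_eq_zero.mpr h
  have hz := linearIndepOn_finset_iff.mp hB _ h0
  ext x
  by_cases hx : x ∈ B
  · have := hz x hx
    by_cases h1 : x ∈ T <;> by_cases h2 : x ∈ U <;> simp_all
  · exact ⟨fun h => absurd (hT h) hx, fun h => absurd (hU h) hx⟩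

/-- If `C` contains `k` linearly independent vectors of weight at most `w`, then
`Q_C(λ) (1+λ^w)^k ≤ (1+λ)^n` for `0 ≤ λ ≤ 1`. -/
theorem cosetGF_mul_le {ι : Type} [Fintype ι] (C : Submodule (ZMod 2) (ι → ZMod 2)) {w : ℕ}
    {B : Finset (ι → ZMod 2)} (hB : LinearIndepOn (ZMod 2) id (B : Set (ι → ZMod 2)))
    (hBC : ∀ x ∈ B, x ∈ C) (hBw : ∀ x ∈ B, hammingNorm x ≤ w)
    {lam : ℝ} (h0 : 0 ≤ lam) (h1 : lam ≤ 1) :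
    cosetGF C lam * (1 + lam ^ w) ^ #B ≤ (1 + lam) ^ Fintype.card ι := by
  classical
  have : Fintype ((ι → ZMod 2) ⧸ C) := Fintype.ofFinite _
  choose r hr hrw using exists_hammingNorm_eq_cosetWeight C
  have hpow : (1 + lam ^ w) ^ #B = ∑ T ∈ B.powerset, lam ^ (w * #T) := by
    rw [add_comm, ← Finset.sum_pow_mul_eq_add_pow]
    simp [pow_mul]
  rw [cosetGF, finsum_eq_sum_of_fintype, hpow, Finset.sum_mul_sum, ← Finset.sum_product',
    ← sum_pow_hammingNorm]
  let f : ((ι → ZMod 2) ⧸ C) × Finset (ι → ZMod 2) → ι → ZMod 2 := fun p => r p.1 + ∑ x ∈ p.2, x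
  have hmk (p) (hp : p ∈ (univ : Finset ((ι → ZMod 2) ⧸ C)) ×ˢ B.powerset) :
      Submodule.Quotient.mk (f p) = p.1 := by
    have hT : p.2 ⊆ B := mem_powerset.mp (mem_product.mp hp).2
    rw [Submodule.Quotient.mk_add, hr,
      (Submodule.Quotient.mk_eq_zero C).mpr (C.sum_mem fun x hx => hBC x (hT hx)), add_zero]
  have hinj : Set.InjOn f ((univ : Finset ((ι → ZMod 2) ⧸ C)) ×ˢ B.powerset : Finset _) := by
    intro p hp q hq hpq
    have h : p.1 = q.1 := by rw [← hmk p hp, ← hmk q hq, hpq]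
    refine Prod.ext h (hB.injOn_sum_zmod_two (mem_product.mp hp).2 (mem_product.mp hq).2 ?_)
    simpa [f, h] using hpq
  calc _ ≤ ∑ p ∈ univ ×ˢ B.powerset, lam ^ hammingNorm (f p) := by
        refine Finset.sum_le_sum fun p hp => ?_
        have hT : p.2 ⊆ B := mem_powerset.mp (mem_product.mp hp).2
        rw [← pow_add, ← hrw]
        exact pow_le_pow_of_le_one h0 h1 ((hammingNorm_add_le _ _).trans
          (Nat.add_le_add_left (hammingNorm_sum_le _ fun x hx => hBw x (hT hx)) _))
    _ = ∑ x ∈ (univ ×ˢ B.powerset).image f, lam ^ hammingNorm x :=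
        (Finset.sum_image (f := fun x => lam ^ hammingNorm x) hinj).symm
    _ ≤ _ := Finset.sum_le_univ_sum_of_nonneg fun x => pow_nonneg h0 _

/-- if `w ≥ 3` and `C ≤ F₂ⁿ` is spanned by vectors of Hamming weight at most `w`,
and the union of the supports of the codewords of `C` is `{1,…,n}`, then for `0 ≤ λ ≤ 1`,
`Q_C(λ) ≤ ((1+λ)^w / (1+λ^w))^(n/w)`. -/
theorem coset_gf_le_of_spanned_by_low_weight (n w : ℕ) (hw : 3 ≤ w)
    (C : Submodule (ZMod 2) (Fin n → ZMod 2))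
    (hspan : ∃ S : Set (Fin n → ZMod 2),
      (∀ x ∈ S, hammingNorm x ≤ w) ∧ Submodule.span (ZMod 2) S = C)
    (hcover : (⋃ c ∈ (C : Set (Fin n → ZMod 2)), Function.support c) = Set.univ)
    (lam : ℝ) (hlam0 : 0 ≤ lam) (hlam1 : lam ≤ 1) :
    cosetGF C lam ≤ ((1 + lam) ^ w / (1 + lam ^ w)) ^ ((n : ℝ) / (w : ℝ)) := by
  classical
  obtain ⟨S, hS, hSC⟩ := hspan
  obtain ⟨b, hbS, hbspan, hb⟩ := exists_linearIndependent (ZMod 2) S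
  obtain ⟨B, rfl⟩ := (Set.toFinite b).exists_finset_coe
  have hBw (x) (hx : x ∈ B) : hammingNorm x ≤ w := hS x (hbS hx)
  have hBC : Submodule.span (ZMod 2) (B : Set (Fin n → ZMod 2)) = C := hbspan.trans hSC
  have hcov : (univ : Finset (Fin n)) ⊆ B.biUnion fun x => {i | x i ≠ 0} := by
    intro i _
    by_contra hi
    have hzero (x) (hx : x ∈ B) : x i = 0 := by
      by_contra h
      exact hi (mem_biUnion.mpr ⟨x, hx, by simpa using h⟩)
    have hle : C ≤ LinearMap.ker (LinearMap.proj i : (Fin n → ZMod 2) →ₗ[ZMod 2] ZMod 2) := by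
      rw [← hBC, Submodule.span_le]
      exact hzero
    obtain ⟨c, hc, hci⟩ := Set.mem_iUnion₂.mp (hcover.symm ▸ Set.mem_univ i)
    exact hci (hle hc)
  have hn : n ≤ w * #B := by
    calc n = #(univ : Finset (Fin n)) := by simp
      _ ≤ ∑ x ∈ B, hammingNorm x := (card_le_card hcov).trans card_biUnion_le
      _ ≤ w * #B := by simpa [mul_comm] using Finset.sum_le_card_nsmul B _ w hBw
  have key := cosetGF_mul_le C hb (fun x hx => hBC ▸ Submodule.subset_span hx) hBw hlam0 hlam1
  rw [Fintype.card_fin] at key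
  have hw0 : (0 : ℝ) < w := by exact_mod_cast (by omega : 0 < w)
  have h1 : 1 ≤ 1 + lam ^ w := le_add_of_nonneg_right (pow_nonneg hlam0 w)
  have hle : (1 + lam ^ w) ^ ((n : ℝ) / w) ≤ (1 + lam ^ w) ^ #B := by
    refine (Real.rpow_le_rpow_of_exponent_le h1 ?_).trans_eq (Real.rpow_natCast _ _)
    rw [div_le_iff₀ hw0, mul_comm]
    exact_mod_cast hn
  have hnum : ((1 + lam) ^ w) ^ ((n : ℝ) / w) = (1 + lam) ^ n := by
    rw [← Real.rpow_natCast, ← Real.rpow_mul (by positivity), mul_div_cancel₀ _ hw0.ne',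
      Real.rpow_natCast]
  rw [Real.div_rpow (by positivity) (by positivity), hnum, le_div_iff₀ (by positivity)]
  refine (mul_le_mul_of_nonneg_left hle ?_).trans key
  exact finsum_nonneg fun A => pow_nonneg hlam0 _
end

section
/- Let C ≤ F₂ⁿ be a linear code spanned by vectors of Hamming weight at most 3 such that the union of the supports of the codewords of C equals {1,…,n}. Then for every real λ with 0 ≤ λ ≤ 1, Q_C(λ) ≤ (1+3λ)^(n/3). -/
open Finset

/-- A nonnegative function `f` on the target of a linear map `π` out of `F₂ⁿ` that loses at most a
factor `lam` along each generator `π eᵢ`, where the relations between the generators with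
index in `T` all lie in `C` and the other generators vanish. -/
structure IsCosetMajorant {n : ℕ} (C : Submodule (ZMod 2) (Fin n → ZMod 2)) (lam : ℝ)
    (T : Finset (Fin n)) {V : Type} [AddCommGroup V] [Module (ZMod 2) V]
    (π : (Fin n → ZMod 2) →ₗ[ZMod 2] V) (f : V → ℝ) : Prop where
  nonneg : ∀ x, 0 ≤ f x
  one_le : 1 ≤ f 0
  step : ∀ i x, lam * f x ≤ f (x + π (Pi.single i 1))
  map_single : ∀ i ∉ T, π (Pi.single i 1) = 0
  mem_of_map_eq_zero : ∀ x : Fin n → ZMod 2, (∀ i ∉ T, x i = 0) → π x = 0 → x ∈ C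

/-- There is a majorant for the coordinates in `T` with total mass at most
`(1 + 3 * lam) ^ (#T / 3)`. -/
def HasCosetMajorant {n : ℕ} (C : Submodule (ZMod 2) (Fin n → ZMod 2)) (lam : ℝ)
    (T : Finset (Fin n)) : Prop :=
  ∃ (V : Type) (_ : AddCommGroup V) (_ : Module (ZMod 2) V) (_ : Fintype V)
    (π : (Fin n → ZMod 2) →ₗ[ZMod 2] V) (f : V → ℝ),
    IsCosetMajorant C lam T π f ∧ ∑ x, f x ≤ (1 + 3 * lam) ^ ((#T : ℝ) / 3)

lemma zmod_two_eq_one_of_ne_zero {a : ZMod 2} (h : a ≠ 0) : a = 1 := by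
  revert a; decide

section

variable {n : ℕ} {C : Submodule (ZMod 2) (Fin n → ZMod 2)} {lam : ℝ} {T : Finset (Fin n)}
  {V : Type} [AddCommGroup V] [Module (ZMod 2) V] {π : (Fin n → ZMod 2) →ₗ[ZMod 2] V}
  {f : V → ℝ}

lemma IsCosetMajorant.pow_card_mul_le_sum (h : IsCosetMajorant C lam T π f) (hlam0 : 0 ≤ lam)
    (hlam1 : lam ≤ 1) (y : Fin n → ZMod 2) (A : Finset (Fin n)) (x : V) :
    lam ^ #A * f x ≤ f (x + ∑ i ∈ A, y i • π (Pi.single i 1)) := by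
  induction A using Finset.induction_on with
  | empty => simp
  | insert i A hi ih =>
    rw [card_insert_of_notMem hi, sum_insert hi, pow_succ', mul_assoc]
    refine (mul_le_mul_of_nonneg_left ih hlam0).trans ?_
    by_cases hy : y i = 0
    · rw [hy, zero_smul, zero_add]
      exact mul_le_of_le_one_left (h.nonneg _) hlam1
    · rw [zmod_two_eq_one_of_ne_zero hy, one_smul, add_comm (π _), ← add_assoc]
      exact h.step _ _

lemma IsCosetMajorant.pow_card_mul_le (h : IsCosetMajorant C lam T π f) (hlam0 : 0 ≤ lam)
    (hlam1 : lam ≤ 1) (y : Fin n → ZMod 2) (x : V) :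
    lam ^ #{i ∈ T | y i ≠ 0} * f x ≤ f (x + π y) := by
  have key : π y = ∑ i ∈ T with y i ≠ 0, y i • π (Pi.single i 1) := by
    conv_lhs => rw [LinearMap.pi_apply_eq_sum_univ π y]
    symm
    refine (sum_subset (subset_univ _) fun i _ hi => ?_).trans
      (sum_congr rfl fun i _ => ?_)
    · by_cases hT : i ∈ T
      · have : y i = 0 := by simpa [hT] using hi
        rw [this, zero_smul]
      · rw [h.map_single i hT, smul_zero]
    · congr 2
      ext k
      simp [Pi.single_apply, eq_comm]
  rw [key]
  exact h.pow_card_mul_le_sum hlam0 hlam1 _ _ _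

end

lemma le_rpow_div_three {K b : ℝ} (hb : 0 ≤ b) {t : ℕ} (h : K ^ 3 ≤ b ^ t) :
    K ≤ b ^ ((t : ℝ) / 3) := by
  have h3 : (b ^ ((t : ℝ) / 3)) ^ 3 = b ^ t := by
    rw [← Real.rpow_natCast, ← Real.rpow_mul hb, ← Real.rpow_natCast]
    congr 1
    push_cast
    ring
  rw [← h3] at h
  exact le_of_pow_le_pow_left₀ (by norm_num) (by positivity) h

lemma mul_le_rpow_of_card_eq {K Q lam : ℝ} {a b t : ℕ} (hK : 0 ≤ K) (hlam0 : 0 ≤ lam)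
    (hab : b = a + t) (hQ : Q ≤ (1 + 3 * lam) ^ ((a : ℝ) / 3)) (h : K ^ 3 ≤ (1 + 3 * lam) ^ t) :
    K * Q ≤ (1 + 3 * lam) ^ ((b : ℝ) / 3) := by
  have hpos : 0 < 1 + 3 * lam := by positivity
  have : ((b : ℝ) / 3) = (t : ℝ) / 3 + (a : ℝ) / 3 := by rw [hab]; push_cast; ring
  rw [this, Real.rpow_add hpos]
  exact (mul_le_mul_of_nonneg_left hQ hK).trans
    (mul_le_mul_of_nonneg_right (le_rpow_div_three hpos.le h) (by positivity))

lemma two_mul_sum_eq_sum_add_translate {V : Type} [AddCommGroup V] [Fintype V] (g : V → ℝ)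
    (s : V) : 2 * ∑ x, g x = ∑ x, (g x + g (x + s)) := by
  have h : ∑ x, g (x + s) = ∑ x, g x := Fintype.sum_equiv (Equiv.addRight s) _ _ fun _ => rfl
  rw [sum_add_distrib, h, two_mul]

lemma max_add_max_le {lam p q : ℝ} (hlam0 : 0 ≤ lam) (hlam1 : lam ≤ 1)
    (hpq : lam ^ 2 * p ≤ q) (hqp : lam ^ 2 * q ≤ p) :
    max p (lam * q) + max q (lam * p) ≤ (1 + lam) / (1 + lam ^ 2) * (p + q) := by
  rw [div_mul_eq_mul_div, le_div_iff₀ (by positivity)]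
  have h2 : lam ^ 2 ≤ lam := by nlinarith
  rcases le_total (lam * q) p with h | h <;> rcases le_total (lam * p) q with h' | h'
  · rw [max_eq_left h, max_eq_left h']
    nlinarith
  · rw [max_eq_left h, max_eq_right h']
    nlinarith
  · rw [max_eq_right h, max_eq_left h']
    nlinarith
  · rw [max_eq_right h, max_eq_right h']
    nlinarith

lemma two_mul_max_le {lam p q : ℝ} (hlam0 : 0 ≤ lam)
    (hpq : lam * p ≤ q) (hqp : lam * q ≤ p) :
    2 * max p q ≤ 2 / (1 + lam) * (p + q) := by
  rw [div_mul_eq_mul_div, le_div_iff₀ (by positivity)]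
  rcases le_total p q with h | h
  · rw [max_eq_right h]; nlinarith
  · rw [max_eq_left h]; nlinarith

lemma card_filter_add_card_filter {n : ℕ} (T : Finset (Fin n)) (c : Fin n → ZMod 2) :
    #{i ∈ T | c i ≠ 0} + #{i ∈ Tᶜ | c i ≠ 0} = hammingNorm c := by
  rw [hammingNorm, ← card_union_of_disjoint, ← filter_union, union_compl]
  exact disjoint_filter_filter disjoint_compl_right

section

variable {n : ℕ} {C : Submodule (ZMod 2) (Fin n → ZMod 2)} {lam : ℝ} {T : Finset (Fin n)}

lemma HasCosetMajorant.insert_one (hlam0 : 0 ≤ lam) (hlam1 : lam ≤ 1)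
    (h : HasCosetMajorant C lam T) {c : Fin n → ZMod 2} (hc : c ∈ C) {j : Fin n}
    (hN : ({i ∈ Tᶜ | c i ≠ 0} : Finset (Fin n)) = {j}) (hcT : #{i ∈ T | c i ≠ 0} ≤ 2) :
    HasCosetMajorant C lam (T ∪ {j}) := by
  obtain ⟨V, _, _, _, π, f, hf, hsum⟩ := h
  have hmem (i : Fin n) : (i ∉ T ∧ c i ≠ 0) ↔ i = j := by
    have := congrArg (i ∈ ·) hN
    simpa using this
  obtain ⟨hjT, hcj⟩ := (hmem j).2 rfl
  have hcj := zmod_two_eq_one_of_ne_zero hcj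
  set s := π c
  have hss (x : V) : x + s + s = x := by rw [add_assoc, ZModModule.add_self, add_zero]
  have hle (x : V) : lam ^ 2 * f x ≤ f (x + s) :=
    (mul_le_mul_of_nonneg_right (pow_le_pow_of_le_one hlam0 hlam1 hcT) (hf.nonneg x)).trans
      (hf.pow_card_mul_le hlam0 hlam1 c x)
  refine ⟨V, inferInstance, inferInstance, inferInstance,
    π + (LinearMap.proj j).smulRight s, fun x => max (f x) (lam * f (x + s)), ?_, ?_⟩
  · refine ⟨fun x => le_max_of_le_left (hf.nonneg x), le_max_of_le_left hf.one_le, ?_, ?_, ?_⟩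
    · intro i x
      by_cases hij : i = j
      · subst hij
        simp only [LinearMap.add_apply, LinearMap.smulRight_apply, LinearMap.proj_apply,
          Pi.single_eq_same, one_smul, hf.map_single i hjT, zero_add, hss]
        rw [max_comm, mul_max_of_nonneg _ _ hlam0]
        refine max_le_max ?_ le_rfl
        have := hf.nonneg (x + s)
        nlinarith [mul_nonneg hlam0 this]
      · simp only [LinearMap.add_apply, LinearMap.smulRight_apply, LinearMap.proj_apply,
          Pi.single_eq_of_ne (Ne.symm hij), zero_smul, add_zero]
        rw [mul_max_of_nonneg _ _ hlam0]
        refine max_le_max (hf.step _ _) (mul_le_mul_of_nonneg_left ?_ hlam0)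
        rw [add_right_comm]
        exact hf.step _ _
    · intro i hi
      simp only [mem_union, mem_singleton, not_or] at hi
      simp [hf.map_single i hi.1, Pi.single_eq_of_ne (Ne.symm hi.2)]
    · intro x hx hx0
      simp only [LinearMap.add_apply, LinearMap.smulRight_apply, LinearMap.proj_apply] at hx0
      have : x + x j • c ∈ C := by
        refine hf.mem_of_map_eq_zero _ (fun i hi => ?_) (by simpa using hx0)
        by_cases hij : i = j
        · subst hij; simp [hcj, CharTwo.add_self_eq_zero]
        · have hci : c i = 0 := by
            by_contra h0
            exact hij ((hmem i).1 ⟨hi, h0⟩)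
          simp [hci, hx i (by simp [hi, hij])]
      exact (C.add_mem_iff_left (C.smul_mem _ hc)).1 this
  · refine le_trans ?_ (mul_le_rpow_of_card_eq (K := (1 + lam) / (1 + lam ^ 2)) (t := 1)
      (by positivity) hlam0 (card_union_of_disjoint (by simpa using hjT)) hsum ?_)
    · have key := two_mul_sum_eq_sum_add_translate (fun x => max (f x) (lam * f (x + s))) s
      have key' := two_mul_sum_eq_sum_add_translate f s
      simp only [hss] at key
      have : ∑ x, (max (f x) (lam * f (x + s)) + max (f (x + s)) (lam * f x)) ≤
          ∑ x, (1 + lam) / (1 + lam ^ 2) * (f x + f (x + s)) :=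
        sum_le_sum fun x _ => max_add_max_le hlam0 hlam1 (hle x)
          (by simpa only [hss] using hle (x + s))
      rw [← mul_sum, ← key', ← key] at this
      linarith
    · rw [div_pow, div_le_iff₀ (by positivity)]
      have : 0 ≤ lam ^ 3 := by positivity
      have : 0 ≤ lam ^ 4 := by positivity
      have : 0 ≤ lam ^ 5 := by positivity
      have : 0 ≤ lam ^ 6 := by positivity
      have : 0 ≤ lam ^ 7 := by positivity
      nlinarith

lemma HasCosetMajorant.insert_two (hlam0 : 0 ≤ lam) (hlam1 : lam ≤ 1)
    (h : HasCosetMajorant C lam T) {c : Fin n → ZMod 2} (hc : c ∈ C) {j k : Fin n} (hjk : j ≠ k)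
    (hN : ({i ∈ Tᶜ | c i ≠ 0} : Finset (Fin n)) = {j, k}) (hcT : #{i ∈ T | c i ≠ 0} ≤ 1) :
    HasCosetMajorant C lam (T ∪ {j, k}) := by
  obtain ⟨V, _, _, _, π, f, hf, hsum⟩ := h
  have hmem (i : Fin n) : (i ∉ T ∧ c i ≠ 0) ↔ i = j ∨ i = k := by
    have := congrArg (i ∈ ·) hN
    simpa using this
  obtain ⟨hjT, hcj⟩ := (hmem j).2 (Or.inl rfl)
  obtain ⟨hkT, hck⟩ := (hmem k).2 (Or.inr rfl)
  have hcj := zmod_two_eq_one_of_ne_zero hcj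
  have hck := zmod_two_eq_one_of_ne_zero hck
  set s := π c
  have hss (x : V) : x + s + s = x := by rw [add_assoc, ZModModule.add_self, add_zero]
  have hle (x : V) : lam * f x ≤ f (x + s) := by
    have := (mul_le_mul_of_nonneg_right (pow_le_pow_of_le_one hlam0 hlam1 hcT)
      (hf.nonneg x)).trans (hf.pow_card_mul_le hlam0 hlam1 c x)
    simpa using this
  have hle' (x : V) : lam * f (x + s) ≤ f x := by simpa only [hss] using hle (x + s)
  have hmax (x : V) : lam * (lam * max (f x) (f (x + s))) ≤ min (f x) (f (x + s)) := by
    have h1 : lam * max (f x) (f (x + s)) ≤ min (f x) (f (x + s)) := by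
      rw [mul_max_of_nonneg _ _ hlam0]
      exact max_le (le_min (mul_le_of_le_one_left (hf.nonneg x) hlam1) (hle x))
        (le_min (hle' x) (mul_le_of_le_one_left (hf.nonneg (x + s)) hlam1))
    refine le_trans (mul_le_of_le_one_left ?_ hlam1) h1
    exact mul_nonneg hlam0 (le_max_of_le_left (hf.nonneg x))
  refine ⟨V × ZMod 2, inferInstance, inferInstance, inferInstance,
    LinearMap.prod (π + (LinearMap.proj k).smulRight s)
      (LinearMap.proj (R := ZMod 2) (φ := fun _ => ZMod 2) j +
        LinearMap.proj (R := ZMod 2) (φ := fun _ => ZMod 2) k),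
    fun x => if x.2 = 0 then f x.1 else lam * max (f x.1) (f (x.1 + s)), ?_, ?_⟩
  · refine ⟨?_, by simpa using hf.one_le, ?_, ?_, ?_⟩
    · intro x
      split_ifs
      · exact hf.nonneg _
      · exact mul_nonneg hlam0 (le_max_of_le_left (hf.nonneg _))
    · rintro i ⟨x, e⟩
      by_cases hij : i = j
      · subst hij
        by_cases he : e = 0
        · subst he
          simpa [Pi.single_eq_of_ne hjk, Pi.single_eq_of_ne hjk.symm, hf.map_single i hjT] using
            mul_le_mul_of_nonneg_left (le_max_left (f x) (f (x + s))) hlam0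
        · obtain rfl := zmod_two_eq_one_of_ne_zero he
          simpa [Pi.single_eq_of_ne hjk, Pi.single_eq_of_ne hjk.symm, hf.map_single i hjT,
            CharTwo.add_self_eq_zero] using (hmax x).trans (min_le_left _ _)
      · by_cases hik : i = k
        · subst hik
          by_cases he : e = 0
          · subst he
            simpa [Pi.single_eq_of_ne hjk, Pi.single_eq_of_ne hjk.symm, hf.map_single i hkT, hss]
              using mul_le_mul_of_nonneg_left (le_max_right (f (x + s)) (f x)) hlam0
          · obtain rfl := zmod_two_eq_one_of_ne_zero he
            simpa [Pi.single_eq_of_ne hjk, Pi.single_eq_of_ne hjk.symm, hf.map_single i hkT,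
              CharTwo.add_self_eq_zero] using (hmax x).trans (min_le_right _ _)
        · by_cases he : e = 0
          · subst he
            simpa [Pi.single_eq_of_ne (Ne.symm hij), Pi.single_eq_of_ne (Ne.symm hik)] using
              hf.step i x
          · simp only [he, if_false, LinearMap.prod_apply, Function.prod, LinearMap.add_apply,
              LinearMap.smulRight_apply, LinearMap.proj_apply, Pi.single_eq_of_ne (Ne.symm hij),
              Pi.single_eq_of_ne (Ne.symm hik), zero_smul, add_zero, Prod.mk_add_mk]
            refine mul_le_mul_of_nonneg_left ?_ hlam0
            rw [mul_max_of_nonneg _ _ hlam0]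
            refine max_le_max (hf.step _ _) ?_
            rw [add_right_comm]
            exact hf.step _ _
    · intro i hi
      simp only [mem_union, mem_insert, mem_singleton, not_or] at hi
      simp [hf.map_single i hi.1, Pi.single_eq_of_ne (Ne.symm hi.2.1),
        Pi.single_eq_of_ne (Ne.symm hi.2.2)]
    · intro x hx hx0
      simp only [LinearMap.prod_apply, Function.prod, LinearMap.add_apply,
        LinearMap.smulRight_apply, LinearMap.proj_apply, Prod.mk_eq_zero] at hx0
      have hxjk : x j = x k := CharTwo.add_eq_zero.1 hx0.2
      have : x + x k • c ∈ C := by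
        refine hf.mem_of_map_eq_zero _ (fun i hi => ?_) (by simpa using hx0.1)
        by_cases hij : i = j
        · subst hij; simp [hcj, hxjk, CharTwo.add_self_eq_zero]
        by_cases hik : i = k
        · subst hik; simp [hck, CharTwo.add_self_eq_zero]
        have hci : c i = 0 := by
          by_contra h0
          exact ((hmem i).1 ⟨hi, h0⟩).elim hij hik
        simp [hci, hx i (by simp [hi, hij, hik])]
      exact (C.add_mem_iff_left (C.smul_mem _ hc)).1 this
  · refine le_trans ?_ (mul_le_rpow_of_card_eq (K := 1 + 2 * lam / (1 + lam)) (t := 2)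
      (by positivity) hlam0 ?_ hsum ?_)
    · have hsplit : ∑ x : V × ZMod 2,
          (if x.2 = 0 then f x.1 else lam * max (f x.1) (f (x.1 + s))) =
          ∑ x, f x + lam * ∑ x, max (f x) (f (x + s)) := by
        rw [Fintype.sum_prod_type, mul_sum, ← sum_add_distrib]
        refine sum_congr rfl fun x _ => ?_
        rw [show (univ : Finset (ZMod 2)) = {0, 1} from rfl]
        simp
      have key' := two_mul_sum_eq_sum_add_translate f s
      have : ∑ x, 2 * max (f x) (f (x + s)) ≤ ∑ x, 2 / (1 + lam) * (f x + f (x + s)) :=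
        sum_le_sum fun x _ => two_mul_max_le hlam0 (hle x) (hle' x)
      rw [← mul_sum, ← mul_sum, ← key'] at this
      have h2 : ∑ x, max (f x) (f (x + s)) ≤ 2 / (1 + lam) * ∑ x, f x := by linarith
      have h3 := mul_le_mul_of_nonneg_left h2 hlam0
      rw [hsplit]
      refine (add_le_add_right h3 _).trans_eq ?_
      ring
    · rw [card_union_of_disjoint (by simp [hjT, hkT]), card_pair hjk]
    · have : 1 + 2 * lam / (1 + lam) = (1 + 3 * lam) / (1 + lam) := by field_simp; ring
      rw [this, div_pow, div_le_iff₀ (by positivity), pow_succ]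
      refine mul_le_mul_of_nonneg_left ?_ (by positivity)
      have : 0 ≤ lam ^ 3 := by positivity
      nlinarith [sq_nonneg lam]

lemma HasCosetMajorant.insert_three (hlam0 : 0 ≤ lam) (hlam1 : lam ≤ 1)
    (h : HasCosetMajorant C lam T) {c : Fin n → ZMod 2} (hc : c ∈ C) {j k l : Fin n}
    (hjk : j ≠ k) (hjl : j ≠ l) (hkl : k ≠ l)
    (hN : ({i ∈ Tᶜ | c i ≠ 0} : Finset (Fin n)) = {j, k, l}) (hcT : #{i ∈ T | c i ≠ 0} = 0) :
    HasCosetMajorant C lam (T ∪ {j, k, l}) := by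
  obtain ⟨V, _, _, _, π, f, hf, hsum⟩ := h
  have hmem (i : Fin n) : (i ∉ T ∧ c i ≠ 0) ↔ i = j ∨ i = k ∨ i = l := by
    have := congrArg (i ∈ ·) hN
    simpa using this
  obtain ⟨hjT, hcj⟩ := (hmem j).2 (by simp)
  obtain ⟨hkT, hck⟩ := (hmem k).2 (by simp)
  obtain ⟨hlT, hcl⟩ := (hmem l).2 (by simp)
  have hcj := zmod_two_eq_one_of_ne_zero hcj
  have hck := zmod_two_eq_one_of_ne_zero hck
  have hcl := zmod_two_eq_one_of_ne_zero hcl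
  have hcT' : ∀ i ∈ T, c i = 0 := by simpa [filter_eq_empty_iff] using hcT
  have hc_sum : c = Pi.single j 1 + Pi.single k 1 + Pi.single l 1 := by
    ext i
    by_cases hij : i = j
    · subst hij; simp [hcj, hjk, hjl]
    by_cases hik : i = k
    · subst hik; simp [hck, hjk.symm, hkl]
    by_cases hil : i = l
    · subst hil; simp [hcl, hjl.symm, hkl.symm]
    have hci : c i = 0 := by
      by_cases hi : i ∈ T
      · exact hcT' i hi
      · by_contra h0
        have := (hmem i).1 ⟨hi, h0⟩
        tauto
    simp [hci, hij, hik, hil]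
  have hπc : π c = 0 := by
    simp [hc_sum, hf.map_single j hjT, hf.map_single k hkT, hf.map_single l hlT]
  refine ⟨V × (ZMod 2 × ZMod 2), inferInstance, inferInstance, inferInstance,
    π.prod (LinearMap.prod (LinearMap.proj (R := ZMod 2) (φ := fun _ => ZMod 2) j +
        LinearMap.proj (R := ZMod 2) (φ := fun _ => ZMod 2) l)
      (LinearMap.proj (R := ZMod 2) (φ := fun _ => ZMod 2) k +
        LinearMap.proj (R := ZMod 2) (φ := fun _ => ZMod 2) l)),
    fun x => (if x.2 = 0 then 1 else lam) * f x.1, ?_, ?_⟩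
  · have hle1 (e : ZMod 2 × ZMod 2) : (if e = 0 then 1 else lam) ≤ 1 := by
      split_ifs <;> simp [hlam1]
    have hge (e : ZMod 2 × ZMod 2) : lam ≤ (if e = 0 then 1 else lam) := by
      split_ifs <;> simp [hlam1]
    have hw (e : ZMod 2 × ZMod 2) : 0 ≤ (if e = 0 then 1 else lam) := hlam0.trans (hge e)
    refine ⟨fun x => mul_nonneg (hw _) (hf.nonneg _), by simpa using hf.one_le, ?_, ?_, ?_⟩
    · rintro i ⟨x, e⟩
      by_cases hi : i ∈ T
      · have hij : i ≠ j := by rintro rfl; exact hjT hi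
        have hik : i ≠ k := by rintro rfl; exact hkT hi
        have hil : i ≠ l := by rintro rfl; exact hlT hi
        simp only [LinearMap.prod_apply, Function.prod, LinearMap.add_apply, LinearMap.proj_apply,
          Pi.single_eq_of_ne hij.symm, Pi.single_eq_of_ne hik.symm, Pi.single_eq_of_ne hil.symm,
          add_zero, Prod.mk_add_mk, Prod.mk_zero_zero]
        rw [mul_left_comm]
        exact mul_le_mul_of_nonneg_left (hf.step _ _) (hw _)
      · simp only [LinearMap.prod_apply, Function.prod, hf.map_single i hi, Prod.mk_add_mk, add_zero]
        rw [← mul_assoc]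
        refine mul_le_mul_of_nonneg_right ?_ (hf.nonneg _)
        exact (mul_le_of_le_one_right hlam0 (hle1 _)).trans (hge _)
    · intro i hi
      simp only [mem_union, mem_insert, mem_singleton, not_or] at hi
      simp [hf.map_single i hi.1, Pi.single_eq_of_ne (Ne.symm hi.2.1),
        Pi.single_eq_of_ne (Ne.symm hi.2.2.1), Pi.single_eq_of_ne (Ne.symm hi.2.2.2)]
    · intro x hx hx0
      simp only [LinearMap.prod_apply, Function.prod, LinearMap.add_apply, LinearMap.proj_apply,
        Prod.mk_eq_zero] at hx0
      have hxj : x j = x l := CharTwo.add_eq_zero.1 hx0.2.1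
      have hxk : x k = x l := CharTwo.add_eq_zero.1 hx0.2.2
      have : x + x l • c ∈ C := by
        refine hf.mem_of_map_eq_zero _ (fun i hi => ?_) (by simp [hπc, hx0.1])
        by_cases hij : i = j
        · subst hij; simp [hcj, hxj, CharTwo.add_self_eq_zero]
        by_cases hik : i = k
        · subst hik; simp [hck, hxk, CharTwo.add_self_eq_zero]
        by_cases hil : i = l
        · subst hil; simp [hcl, CharTwo.add_self_eq_zero]
        have hci : c i = 0 := by
          by_contra h0
          have := (hmem i).1 ⟨hi, h0⟩
          tauto
        simp [hci, hx i (by simp [hi, hij, hik, hil])]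
      exact (C.add_mem_iff_left (C.smul_mem _ hc)).1 this
  · refine le_trans (le_of_eq ?_) (mul_le_rpow_of_card_eq (K := 1 + 3 * lam) (t := 3)
      (by positivity) hlam0 ?_ hsum le_rfl)
    · rw [Fintype.sum_prod_type_right, ← sum_mul_sum univ univ
        (fun e : ZMod 2 × ZMod 2 => if e = 0 then 1 else lam) f]
      congr 1
      rw [Fintype.sum_prod_type, show (univ : Finset (ZMod 2)) = {0, 1} from rfl]
      simp
      ring
    · rw [card_union_of_disjoint (by simp [hjT, hkT, hlT]),
        card_eq_three.2 ⟨j, k, l, hjk, hjl, hkl, rfl⟩]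

lemma hasCosetMajorant_empty (hlam1 : lam ≤ 1) : HasCosetMajorant C lam ∅ := by
  refine ⟨PUnit, inferInstance, inferInstance, inferInstance, 0, fun _ => 1, ?_, by simp⟩
  exact ⟨by simp, le_rfl, fun _ _ => by simpa using hlam1, by simp, fun x hx _ => by
    rw [show x = 0 from funext fun i => hx i (by simp)]; exact C.zero_mem⟩

lemma HasCosetMajorant.exists_ssuperset (hlam0 : 0 ≤ lam) (hlam1 : lam ≤ 1)
    (h : HasCosetMajorant C lam T) {c : Fin n → ZMod 2} (hc : c ∈ C) (hc3 : hammingNorm c ≤ 3)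
    {i : Fin n} (hi : i ∉ T) (hci : c i ≠ 0) :
    ∃ T', T ⊂ T' ∧ HasCosetMajorant C lam T' := by
  have hcard := card_filter_add_card_filter T c
  have hiN : i ∈ ({i ∈ Tᶜ | c i ≠ 0} : Finset (Fin n)) := by simp [hi, hci]
  have hpos : 0 < #{i ∈ Tᶜ | c i ≠ 0} := card_pos.2 ⟨i, hiN⟩
  refine ⟨T ∪ {i ∈ Tᶜ | c i ≠ 0}, ?_, ?_⟩
  · exact (ssubset_iff_of_subset subset_union_left).2 ⟨i, mem_union_right _ hiN, hi⟩
  · have : #{i ∈ Tᶜ | c i ≠ 0} = 1 ∨ #{i ∈ Tᶜ | c i ≠ 0} = 2 ∨ #{i ∈ Tᶜ | c i ≠ 0} = 3 := by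
      omega
    rcases this with h1 | h2 | h3
    · obtain ⟨j, hN⟩ := card_eq_one.1 h1
      rw [hN]
      exact h.insert_one hlam0 hlam1 hc hN (by omega)
    · obtain ⟨j, k, hjk, hN⟩ := card_eq_two.1 h2
      rw [hN]
      exact h.insert_two hlam0 hlam1 hc hjk hN (by omega)
    · obtain ⟨j, k, l, hjk, hjl, hkl, hN⟩ := card_eq_three.1 h3
      rw [hN]
      exact h.insert_three hlam0 hlam1 hc hjk hjl hkl hN (by omega)

lemma hasCosetMajorant_univ (hlam0 : 0 ≤ lam) (hlam1 : lam ≤ 1)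
    (hC : ∀ i, ∃ c ∈ C, hammingNorm c ≤ 3 ∧ c i ≠ 0) :
    HasCosetMajorant C lam univ := by
  obtain ⟨T, hT⟩ := (Set.toFinite {T : Finset (Fin n) | HasCosetMajorant C lam T}).exists_maximal
    ⟨∅, hasCosetMajorant_empty hlam1⟩
  suffices T = univ by rw [← this]; exact hT.prop
  by_contra hne
  obtain ⟨i, hi⟩ := not_forall.1 (mt eq_univ_iff_forall.2 hne)
  obtain ⟨c, hc, hc3, hci⟩ := hC i
  obtain ⟨T', hlt, hT'⟩ := HasCosetMajorant.exists_ssuperset hlam0 hlam1 hT.prop hc hc3 hi hci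
  exact hT.not_gt hT' hlt

lemma HasCosetMajorant.cosetGF_le (hlam0 : 0 ≤ lam) (hlam1 : lam ≤ 1)
    (h : HasCosetMajorant C lam univ) : cosetGF C lam ≤ (1 + 3 * lam) ^ ((n : ℝ) / 3) := by
  classical
  obtain ⟨V, _, _, _, π, f, hf, hsum⟩ := h
  have hex (A : (Fin n → ZMod 2) ⧸ C) :
      ∃ x, Submodule.Quotient.mk x = A ∧ hammingNorm x = cosetWeight C A := by
    obtain ⟨x, hx⟩ := Submodule.Quotient.mk_surjective C A
    exact Nat.sInf_mem
      (s := {k | ∃ x : Fin n → ZMod 2, Submodule.Quotient.mk x = A ∧ hammingNorm x = k})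
      ⟨_, x, hx, rfl⟩
  choose r hr hrw using hex
  have : Fintype ((Fin n → ZMod 2) ⧸ C) :=
    have : Finite ((Fin n → ZMod 2) ⧸ C) := Finite.of_surjective _ (Submodule.mkQ_surjective C)
    Fintype.ofFinite _
  have hinj : Function.Injective (fun A => π (r A)) := by
    intro A B hAB
    rw [← hr A, ← hr B, Submodule.Quotient.eq]
    exact hf.mem_of_map_eq_zero _ (by simp) (by simpa [sub_eq_zero] using hAB)
  rw [card_univ, Fintype.card_fin] at hsum
  refine le_trans ?_ hsum
  rw [cosetGF, finsum_eq_sum_of_fintype]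
  calc ∑ A, lam ^ cosetWeight C A ≤ ∑ A, f (π (r A)) := by
        refine sum_le_sum fun A _ => ?_
        have h1 := hf.pow_card_mul_le hlam0 hlam1 (r A) 0
        rw [zero_add] at h1
        rw [← hrw A]
        exact (le_mul_of_one_le_right (by positivity) hf.one_le).trans h1
    _ = ∑ x ∈ univ.image (fun A => π (r A)), f x := (sum_image hinj.injOn).symm
    _ ≤ ∑ x, f x := sum_le_sum_of_subset_of_nonneg (subset_univ _) fun x _ _ => hf.nonneg x

end

/-- if `C ≤ F₂ⁿ` is spanned by vectors of Hamming weight at most `3`,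
and the union of the supports of the codewords of `C` is `{1,…,n}`, then for `0 ≤ λ ≤ 1`,
`Q_C(λ) ≤ (1+3λ)^(n/3)`. -/
theorem coset_gf_le_of_spanned_by_weight_three (n : ℕ)
    (C : Submodule (ZMod 2) (Fin n → ZMod 2))
    (hspan : ∃ S : Set (Fin n → ZMod 2),
      (∀ x ∈ S, hammingNorm x ≤ 3) ∧ Submodule.span (ZMod 2) S = C)
    (hcover : (⋃ c ∈ (C : Set (Fin n → ZMod 2)), Function.support c) = Set.univ)
    (lam : ℝ) (hlam0 : 0 ≤ lam) (hlam1 : lam ≤ 1) :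
    cosetGF C lam ≤ (1 + 3 * lam) ^ ((n : ℝ) / 3) := by
  obtain ⟨S, hS, rfl⟩ := hspan
  refine (hasCosetMajorant_univ hlam0 hlam1 fun i => ?_).cosetGF_le hlam0 hlam1
  by_contra! hcon
  have hle : Submodule.span (ZMod 2) S ≤
      LinearMap.ker (LinearMap.proj i : (Fin n → ZMod 2) →ₗ[ZMod 2] ZMod 2) :=
    Submodule.span_le.2 fun x hx => hcon x (Submodule.subset_span hx) (hS x hx)
  have hi : i ∈ ⋃ c ∈ (Submodule.span (ZMod 2) S : Set (Fin n → ZMod 2)), Function.support c := by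
    rw [hcover]; trivial
  simp only [Set.mem_iUnion, Function.mem_support] at hi
  obtain ⟨c, hc, hci⟩ := hi
  exact hci (hle hc)
end

section
/- Let C ≤ F₂ⁿ be a linear code spanned by vectors of Hamming weight at most 4 such that the union of the supports of the codewords of C equals {1,…,n}. Then for every real λ with 0 ≤ λ ≤ 1, Q_C(λ) ≤ (1+4λ+6λ²)^(n/4). -/
open Classical in
/-- The generating function, by cardinality, of the members of `L` that are contained in `X`. -/
noncomputable def localGF {ι : Type*} (L : Set (Finset ι)) (lam : ℝ) (X : Finset ι) : ℝ :=
  ∑ s ∈ X.powerset with s ∈ L, lam ^ s.card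

section LocalGF

variable {ι : Type*} {L : Set (Finset ι)} {lam : ℝ}

lemma localGF_nonneg (hlam : 0 ≤ lam) (X : Finset ι) : 0 ≤ localGF L lam X :=
  Finset.sum_nonneg fun _ _ => pow_nonneg hlam _

lemma sum_powerset_pow_card (lam : ℝ) (X : Finset ι) :
    ∑ s ∈ X.powerset, lam ^ s.card = (1 + lam) ^ X.card := by
  have := Finset.sum_pow_mul_eq_add_pow lam 1 X
  simpa [add_comm] using this

lemma localGF_le_one_add_pow (hlam : 0 ≤ lam) (X : Finset ι) :
    localGF L lam X ≤ (1 + lam) ^ X.card := by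
  classical
  rw [← sum_powerset_pow_card]
  exact Finset.sum_le_sum_of_subset_of_nonneg (Finset.filter_subset _ _)
    fun _ _ _ => pow_nonneg hlam _

lemma localGF_singleton_le (hlam : 0 ≤ lam) (d : ι) :
    localGF L lam {d} ≤ (1 + lam) ^ 0 + lam := by
  simpa using localGF_le_one_add_pow (L := L) hlam {d}

variable [DecidableEq ι]

lemma localGF_union_le (hL : IsLowerSet L) (hlam : 0 ≤ lam) {X Y : Finset ι}
    (hXY : Disjoint X Y) :
    localGF L lam (X ∪ Y) ≤ localGF L lam X * localGF L lam Y := by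
  classical
  unfold localGF
  rw [Finset.sum_mul_sum, ← Finset.sum_product']
  have hcut : ∀ s ⊆ X ∪ Y, (s ∩ X) ∪ (s ∩ Y) = s := fun s hs => by
    rw [← Finset.inter_union_distrib_left, Finset.inter_eq_left.2 hs]
  have hinj : Set.InjOn (fun s : Finset ι => (s ∩ X, s ∩ Y))
      ((X ∪ Y).powerset.filter (· ∈ L)) := by
    intro s hs t ht hst
    simp only [Finset.coe_filter, Finset.mem_powerset, Set.mem_ofPred_eq] at hs ht
    simp only [Prod.mk.injEq] at hst
    rw [← hcut s hs.1, ← hcut t ht.1, hst.1, hst.2]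
  calc ∑ s ∈ (X ∪ Y).powerset with s ∈ L, lam ^ s.card
      = ∑ s ∈ (X ∪ Y).powerset with s ∈ L, lam ^ (s ∩ X).card * lam ^ (s ∩ Y).card := by
        refine Finset.sum_congr rfl fun s hs => ?_
        simp only [Finset.mem_filter, Finset.mem_powerset] at hs
        rw [← pow_add, ← Finset.card_union_of_disjoint, hcut s hs.1]
        exact hXY.mono Finset.inter_subset_right Finset.inter_subset_right
    _ = ∑ p ∈ ((X ∪ Y).powerset.filter (· ∈ L)).image fun s => (s ∩ X, s ∩ Y),
          lam ^ p.1.card * lam ^ p.2.card := by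
        rw [Finset.sum_image hinj]
    _ ≤ _ := by
        refine Finset.sum_le_sum_of_subset_of_nonneg ?_ fun _ _ _ => by positivity
        intro p hp
        simp only [Finset.mem_image, Finset.mem_filter, Finset.mem_powerset] at hp
        obtain ⟨s, ⟨-, hs⟩, rfl⟩ := hp
        simp only [Finset.mem_product, Finset.mem_filter, Finset.mem_powerset]
        exact ⟨⟨Finset.inter_subset_right, hL Finset.inter_subset_left hs⟩,
          Finset.inter_subset_right, hL Finset.inter_subset_left hs⟩

lemma localGF_biUnion_le {α : Type*} (hL : IsLowerSet L) (hlam : 0 ≤ lam)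
    {g : ℝ} (hg : 0 ≤ g) {I : Finset α} {X : α → Finset ι}
    (hdisj : (I : Set α).PairwiseDisjoint X)
    (hX : ∀ i ∈ I, localGF L lam (X i) ≤ g ^ (X i).card) :
    localGF L lam (I.biUnion X) ≤ g ^ (I.biUnion X).card := by
  classical
  induction I using Finset.induction_on with
  | empty => simpa using localGF_le_one_add_pow (L := L) hlam ∅
  | insert i I hi ih =>
    have hdisj' : Disjoint (X i) (I.biUnion X) := by
      rw [Finset.disjoint_biUnion_right]
      intro j hj
      exact hdisj (by simp) (by simp [hj]) (by rintro rfl; exact hi hj)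
    rw [Finset.biUnion_insert, Finset.card_union_of_disjoint hdisj', pow_add]
    refine (localGF_union_le hL hlam hdisj').trans ?_
    refine mul_le_mul (hX i (by simp)) (ih (hdisj.subset (by simp)) fun j hj => hX j (by simp [hj]))
      (localGF_nonneg hlam _) (by positivity)

lemma localGF_insert_le (hL : IsLowerSet L) (hlam : 0 ≤ lam) {X : Finset ι} {y b : ι}
    (hy : y ∉ X) (hb : b ∈ X) (hyb : {y, b} ∉ L) {k : ℕ} (hk : X.card = k + 1)
    (hX : localGF L lam X ≤ (1 + lam) ^ k + lam) :
    localGF L lam (insert y X) ≤ (1 + lam) ^ (k + 1) + lam := by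
  classical
  have h2 : ∑ s ∈ X.powerset, (if insert y s ∈ L then lam ^ (insert y s).card else 0)
      ≤ lam * (1 + lam) ^ k := by
    have hcard : (X.erase b).card = k := by rw [Finset.card_erase_of_mem hb, hk]; simp
    rw [← hcard, ← sum_powerset_pow_card, Finset.mul_sum, ← Finset.sum_filter]
    calc ∑ s ∈ X.powerset with insert y s ∈ L, lam ^ (insert y s).card
        = ∑ s ∈ X.powerset with insert y s ∈ L, lam * lam ^ s.card := by
          refine Finset.sum_congr rfl fun s hs => ?_
          simp only [Finset.mem_filter, Finset.mem_powerset] at hs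
          rw [Finset.card_insert_of_notMem fun h => hy (hs.1 h), pow_succ']
      _ ≤ _ := by
          refine Finset.sum_le_sum_of_subset_of_nonneg ?_ fun _ _ _ => by positivity
          intro s hs
          simp only [Finset.mem_filter, Finset.mem_powerset] at hs ⊢
          refine Finset.subset_erase.2 ⟨hs.1, fun hbs => hyb (hL ?_ hs.2)⟩
          intro j
          simp only [Finset.mem_insert, Finset.mem_singleton]
          rintro (rfl | rfl)
          · exact Or.inl rfl
          · exact Or.inr hbs
  have h1 : localGF L lam X = ∑ s ∈ X.powerset, (if s ∈ L then lam ^ s.card else 0) :=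
    Finset.sum_filter _ _
  rw [show localGF L lam (insert y X)
      = ∑ s ∈ (insert y X).powerset, (if s ∈ L then lam ^ s.card else 0) from
      Finset.sum_filter _ _, Finset.sum_powerset_insert hy, ← h1]
  calc _ ≤ (1 + lam) ^ k + lam + lam * (1 + lam) ^ k := add_le_add hX h2
    _ = _ := by ring

/-- Attaching a set `Y` of new vertices, each forming a pair outside `L` with some old vertex. -/
lemma localGF_union_le_of_attached (hL : IsLowerSet L) (hlam : 0 ≤ lam) {X : Finset ι} {k : ℕ}
    (hk : X.card = k + 1) (hX : localGF L lam X ≤ (1 + lam) ^ k + lam) {Y : Finset ι}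
    (hXY : Disjoint X Y) (hY : ∀ y ∈ Y, ∃ b ∈ X, {y, b} ∉ L) :
    localGF L lam (X ∪ Y) ≤ (1 + lam) ^ (k + Y.card) + lam := by
  induction Y using Finset.induction_on with
  | empty => simpa using hX
  | insert y Y hy ih =>
    rw [Finset.disjoint_insert_right] at hXY
    obtain ⟨b, hb, hyb⟩ := hY y (by simp)
    rw [Finset.union_insert, Finset.card_insert_of_notMem hy, ← add_assoc]
    refine localGF_insert_le hL hlam (b := b) ?_ (by simp [hb]) hyb ?_
      (ih hXY.2 fun z hz => hY z (by simp [hz]))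
    · simp [hy, hXY.1]
    · rw [Finset.card_union_of_disjoint hXY.2, hk]; ring

end LocalGF

/-- For every bipartite incidence `t` and capacity `s`, the left side `U` splits into a part `U'`
with few neighbours and a part that can be assigned, within the capacity, to the other vertices. -/
lemma exists_capacitated_assignment {ι α : Type*} [DecidableEq ι] [DecidableEq α] [Nonempty α]
    (U : Finset ι) (t : ι → Finset α) (s : ℕ) :
    ∃ U' ⊆ U, s * (U'.biUnion t).card ≤ U'.card ∧ ∃ f : ι → α,
      (∀ y ∈ U \ U', f y ∈ t y \ U'.biUnion t) ∧
      ∀ b, (((U \ U').filter fun y => f y = b).card ≤ s) := by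
  obtain ⟨U', hU', hmax⟩ := Finset.exists_max_image U.powerset
    (fun V => (V.card : ℤ) - s * (V.biUnion t).card) ⟨∅, by simp⟩
  rw [Finset.mem_powerset] at hU'
  refine ⟨U', hU', ?_, ?_⟩
  · have := hmax ∅ (by simp)
    simp only [Finset.card_empty, Finset.biUnion_empty] at this
    push_cast at this
    zify
    linarith
  · have hall := (Finset.all_card_le_biUnion_card_iff_exists_injective
      (fun y : {y // y ∈ U \ U'} => (t y \ U'.biUnion t) ×ˢ (Finset.univ : Finset (Fin s)))).1 ?_
    · obtain ⟨f, hf, hft⟩ := hall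
      simp only [Finset.mem_product, Finset.mem_univ, and_true] at hft
      by_cases hne : (U \ U').Nonempty
      · obtain ⟨y0, hy0⟩ := hne
        refine ⟨fun y => if h : y ∈ U \ U' then (f ⟨y, h⟩).1 else (f ⟨y0, hy0⟩).1, ?_, ?_⟩
        · intro y hy
          simpa only [dif_pos hy] using hft ⟨y, hy⟩
        · intro b
          refine le_of_le_of_eq ?_ (Finset.card_fin s)
          refine Finset.card_le_card_of_injOn
            (fun y => if h : y ∈ U \ U' then (f ⟨y, h⟩).2 else (f ⟨y0, hy0⟩).2) (by simp) ?_
          intro y hy z hz hyz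
          rw [Finset.coe_filter] at hy hz
          obtain ⟨hy, hyb⟩ := hy
          obtain ⟨hz, hzb⟩ := hz
          simp only [dif_pos hy, dif_pos hz] at hyb hzb hyz
          have := hf (Prod.ext (hyb.trans hzb.symm) hyz)
          simpa using this
      · rw [Finset.not_nonempty_iff_eq_empty] at hne
        exact ⟨fun _ => Classical.arbitrary α, by simp [hne], by simp [hne]⟩
    · intro S
      set X : Finset ι := S.map (Function.Embedding.subtype _) with hX
      have hXU : X ⊆ U \ U' := by
        intro y hy
        simp only [hX, Finset.mem_map, Function.Embedding.coe_subtype] at hy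
        obtain ⟨z, -, rfl⟩ := hy
        exact z.2
      have hbi : S.biUnion (fun y => (t y \ U'.biUnion t) ×ˢ (Finset.univ : Finset (Fin s)))
          = (X.biUnion t \ U'.biUnion t) ×ˢ (Finset.univ : Finset (Fin s)) := by
        ext ⟨a, i⟩
        simp [hX]
        grind
      rw [hbi, Finset.card_product, Finset.card_univ, Fintype.card_fin]
      have h := hmax (U' ∪ X) (Finset.mem_powerset.2
        (Finset.union_subset hU' (hXU.trans Finset.sdiff_subset)))
      have hdis : Disjoint U' X := (Finset.disjoint_sdiff).mono_right hXU
      have hc : ((U' ∪ X).biUnion t).card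
          = (X.biUnion t \ U'.biUnion t).card + (U'.biUnion t).card := by
        rw [Finset.union_biUnion, Finset.card_sdiff_add_card, Finset.union_comm]
      simp only [Finset.card_union_of_disjoint hdis, hc] at h
      have hSX : X.card = S.card := by simp [hX]
      rw [← hSX]
      push_cast at h
      zify
      nlinarith

/-- `(1 + x)^t + x` is dominated by the `(t+1)/4`-th power of `1 + 4x + 6x²`, provided the
Bernoulli-type condition `h` holds. -/
lemma star_le_of_bernoulli {lam g : ℝ} (h0 : 0 < lam) (hg : 0 < g)
    (hg4 : g ^ 4 = 1 + 4 * lam + 6 * lam ^ 2) {t : ℕ} (ht : 3 ≤ t)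
    (h : (t + 1) * (lam + lam ^ 2 / 4) * lam * (1 + lam) ^ t
      ≤ (1 + lam) ^ 3 * ((1 + lam) ^ t - 1)) :
    (1 + lam) ^ t + lam ≤ g ^ (t + 1) := by
  set b : ℝ := 1 + lam with hb
  have hb0 : 0 < b := by positivity
  set c : ℝ := (4 * lam ^ 3 + lam ^ 4) / b ^ 4 with hc
  have hc1 : 1 + -c = (g / b) ^ 4 := by
    rw [div_pow, hg4, hc, hb]; field_simp; ring
  have hpow : (1 + -c) ^ (((t : ℝ) + 1) / 4) = (g / b) ^ (t + 1) := by
    rw [hc1, ← Real.rpow_natCast, ← Real.rpow_mul (by positivity), ← Real.rpow_natCast]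
    congr 1; push_cast; ring
  have hB : 1 + ((t : ℝ) + 1) / 4 * (-c) ≤ (g / b) ^ (t + 1) := by
    rw [← hpow]
    refine one_add_mul_self_le_rpow_one_add ?_ ?_
    · have : 0 ≤ (g / b) ^ 4 := by positivity
      linarith
    · have : (3 : ℝ) ≤ t := by exact_mod_cast ht
      linarith
  have hgt : g ^ (t + 1) = (g / b) ^ (t + 1) * b ^ (t + 1) := by
    rw [div_pow]; field_simp
  rw [hgt]
  refine le_trans ?_ (mul_le_mul_of_nonneg_right hB (by positivity))
  have hexp : b ^ 3 * ((1 + ((t : ℝ) + 1) / 4 * (-c)) * b ^ (t + 1) - (b ^ t + lam))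
      = lam * (b ^ 3 * (b ^ t - 1) - (t + 1) * (lam + lam ^ 2 / 4) * lam * b ^ t) := by
    rw [hc]; field_simp; rw [hb]; ring
  have : 0 ≤ b ^ 3 * ((1 + ((t : ℝ) + 1) / 4 * (-c)) * b ^ (t + 1) - (b ^ t + lam)) := by
    rw [hexp]; exact mul_nonneg h0.le (by linarith)
  have := nonneg_of_mul_nonneg_right this (by positivity)
  linarith

lemma star_le_of_le_five {lam g : ℝ} (h0 : 0 < lam) (h1 : lam ≤ 1) (hg : 0 < g)
    (hg4 : g ^ 4 = 1 + 4 * lam + 6 * lam ^ 2) {t : ℕ} (ht1 : 1 ≤ t) (ht5 : t ≤ 5) :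
    (1 + lam) ^ t + lam ≤ g ^ (t + 1) := by
  have hp : ∀ k : ℕ, 0 ≤ lam ^ k * (1 - lam) := fun k =>
    mul_nonneg (by positivity) (by linarith)
  have hq : ∀ k : ℕ, 0 < lam ^ k := fun k => by positivity
  interval_cases t
  · refine le_of_pow_le_pow_left₀ (n := 2) two_ne_zero (by positivity) ?_
    rw [← pow_mul, hg4]; nlinarith [sq_nonneg lam]
  · refine le_of_pow_le_pow_left₀ (n := 4) four_ne_zero (by positivity) ?_
    rw [← pow_mul, show (2 + 1) * 4 = 4 * 3 by norm_num, pow_mul, hg4]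
    nlinarith [hp 6, hp 7, hp 5, hq 2, hq 3, hq 4, hq 5, hq 6, hq 7]
  · rw [hg4]; nlinarith [hp 2, hq 2]
  · refine star_le_of_bernoulli h0 hg hg4 (by norm_num) ?_
    push_cast
    have h : (1 + lam) ^ 3 * (5 * (lam + lam ^ 2 / 4) * lam * (1 + lam))
        ≤ (1 + lam) ^ 3 * ((1 + lam) ^ 4 - 1) := by
      refine mul_le_mul_of_nonneg_left ?_ (by positivity)
      nlinarith [hp 1, hp 2, hp 3, hq 1, hq 2, hq 3, hq 4]
    linarith
  · refine star_le_of_bernoulli h0 hg hg4 (by norm_num) ?_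
    push_cast
    have h : (1 + lam) ^ 3 * (6 * (lam + lam ^ 2 / 4) * lam * (1 + lam) ^ 2)
        ≤ (1 + lam) ^ 3 * ((1 + lam) ^ 5 - 1) := by
      refine mul_le_mul_of_nonneg_left ?_ (by positivity)
      nlinarith [hp 1, hp 2, hp 3, hp 4, hq 1, hq 2, hq 3, hq 4, hq 5]
    linarith

lemma star_le_six {lam g : ℝ} (h0 : 0 < lam) (h1 : lam ≤ 3 / 4) (hg : 0 < g)
    (hg4 : g ^ 4 = 1 + 4 * lam + 6 * lam ^ 2) :
    (1 + lam) ^ 6 + lam ≤ g ^ (6 + 1) := by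
  have hp : ∀ k : ℕ, 0 ≤ lam ^ k * (3 / 4 - lam) := fun k =>
    mul_nonneg (by positivity) (by linarith)
  have hq : ∀ k : ℕ, 0 < lam ^ k := fun k => by positivity
  refine star_le_of_bernoulli h0 hg hg4 (by norm_num) ?_
  push_cast
  have h : (1 + lam) ^ 3 * (7 * (lam + lam ^ 2 / 4) * lam * (1 + lam) ^ 3)
      ≤ (1 + lam) ^ 3 * ((1 + lam) ^ 6 - 1) := by
    refine mul_le_mul_of_nonneg_left ?_ (by positivity)
    nlinarith [hp 0, hp 1, hp 2, hp 3, hp 4, hq 1, hq 2, hq 3, hq 4, hq 5, hq 6]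
  linarith

lemma star_le_of_seven_le {lam g : ℝ} (h0 : 0 < lam) (hg : 0 < g)
    (hg4 : g ^ 4 = 1 + 4 * lam + 6 * lam ^ 2) {t : ℕ} (ht : 7 ≤ t) (htl : t * lam ≤ 4) :
    (1 + lam) ^ t + lam ≤ g ^ (t + 1) := by
  have htR : (7 : ℝ) ≤ t := by exact_mod_cast ht
  have hlam : lam ≤ 4 / 7 := by nlinarith
  refine star_le_of_bernoulli h0 hg hg4 (by omega) ?_
  have hbt : 1 + t * lam ≤ (1 + lam) ^ t := one_add_mul_le_pow (by linarith) t
  set B : ℝ := (1 + lam) ^ t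
  have hB : t * lam * B ≤ 5 * (B - 1) := by
    have hx : 0 ≤ t * lam := by positivity
    nlinarith [mul_nonneg (sub_nonneg.2 htl) hx,
      mul_nonneg (sub_nonneg.2 (htl.trans (by norm_num : (4 : ℝ) ≤ 5))) (sub_nonneg.2 hbt)]
  have key : 5 * ((t + 1) * (lam + lam ^ 2 / 4)) ≤ (1 + lam) ^ 3 * t := by
    have hpoly : 5 * (lam + lam ^ 2 / 4) ≤ 7 / 8 * (1 + lam) ^ 3 := by
      nlinarith [mul_nonneg h0.le (sq_nonneg (lam - 11 / 20)), sq_nonneg (lam - 11 / 20)]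
    nlinarith [sq_nonneg lam]
  have hB0 : 0 < B := by positivity
  have := mul_le_mul_of_nonneg_right key (by positivity : 0 ≤ lam * B)
  have := mul_le_mul_of_nonneg_left hB (by positivity : 0 ≤ (1 + lam) ^ 3)
  linarith

/-- The size threshold below which trees are sparse enough, and above which the trivial bound `16`
on the number of subsets of a four-element set suffices. -/
lemma exists_size_threshold {lam g : ℝ} (h0 : 0 < lam) (h1 : lam ≤ 1) (hg : 0 < g)
    (hg4 : g ^ 4 = 1 + 4 * lam + 6 * lam ^ 2) :
    ∃ m : ℕ, 4 ≤ m ∧ 16 ≤ g ^ m ∧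
      ∀ t : ℕ, 1 ≤ t → t < m → (1 + lam) ^ t + lam ≤ g ^ (t + 1) := by
  rcases lt_or_ge (3 / 4) lam with h | h
  · refine ⟨6, by norm_num, ?_, fun t ht1 ht => star_le_of_le_five h0 h1 hg hg4 ht1 (by omega)⟩
    refine le_of_pow_le_pow_left₀ (n := 2) two_ne_zero (by positivity) ?_
    rw [← pow_mul, show 6 * 2 = 4 * 3 by norm_num, pow_mul]
    calc (16 : ℝ) ^ 2 ≤ 7 ^ 3 := by norm_num
      _ ≤ _ := by gcongr; nlinarith
  rcases lt_or_ge (4 / 7) lam with h' | h'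
  · refine ⟨7, by norm_num, ?_, fun t ht1 ht => ?_⟩
    · refine le_of_pow_le_pow_left₀ (n := 4) four_ne_zero (by positivity) ?_
      rw [← pow_mul, mul_comm, pow_mul]
      calc (16 : ℝ) ^ 4 ≤ 5 ^ 7 := by norm_num
        _ ≤ _ := by gcongr; nlinarith
    · rcases (show t ≤ 5 ∨ t = 6 by omega) with h5 | rfl
      · exact star_le_of_le_five h0 h1 hg hg4 ht1 h5
      · exact star_le_six h0 h hg hg4
  have hfl : (⌊4 / lam⌋₊ : ℝ) ≤ 4 / lam := Nat.floor_le (by positivity)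
  have hfl' : 4 / lam < (⌊4 / lam⌋₊ : ℝ) + 1 := Nat.lt_floor_add_one _
  have h7 : 7 ≤ ⌊4 / lam⌋₊ := Nat.le_floor (by rw [le_div_iff₀ h0]; push_cast; linarith)
  have hg1 : 1 ≤ g := le_of_pow_le_pow_left₀ (n := 4) four_ne_zero hg.le (by rw [hg4]; nlinarith)
  refine ⟨⌊4 / lam⌋₊ + 1, by omega, ?_, fun t ht1 ht => ?_⟩
  · rcases lt_or_ge (1 / 2) lam with h2 | h2
    · calc (16 : ℝ) ≤ (4.5) ^ 2 := by norm_num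
        _ ≤ (g ^ 4) ^ 2 := by gcongr; rw [hg4]; nlinarith
        _ = g ^ 8 := by ring
        _ ≤ _ := pow_le_pow_right₀ hg1 (by omega)
    · have hg2 : 1 + 2 * lam ≤ g ^ 2 := by
        refine le_of_pow_le_pow_left₀ (n := 2) two_ne_zero (by positivity) ?_
        rw [← pow_mul, hg4]; nlinarith [sq_nonneg lam]
      have hB : (2 : ℝ) ≤ (1 + 2 * lam) ^ (1 / (2 * lam)) := by
        refine le_trans (le_of_eq ?_) (one_add_mul_self_le_rpow_one_add (by linarith) ?_)
        · field_simp; norm_num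
        · rw [le_div_iff₀ (by positivity)]; linarith
      calc (16 : ℝ) = 2 ^ 4 := by norm_num
        _ ≤ ((1 + 2 * lam) ^ (1 / (2 * lam))) ^ 4 := by gcongr
        _ ≤ ((g ^ 2) ^ (1 / (2 * lam))) ^ 4 := by gcongr
        _ = g ^ (4 / lam) := by
          rw [← Real.rpow_natCast g 2, ← Real.rpow_mul hg.le, ← Real.rpow_natCast,
            ← Real.rpow_mul hg.le]
          congr 1; push_cast; field_simp
        _ ≤ g ^ ((⌊4 / lam⌋₊ + 1 : ℕ) : ℝ) := by
          refine Real.rpow_le_rpow_of_exponent_le hg1 ?_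
          push_cast; exact hfl'.le
        _ = _ := Real.rpow_natCast _ _
  · rcases (show t ≤ 5 ∨ t = 6 ∨ 7 ≤ t by omega) with h5 | rfl | h7
    · exact star_le_of_le_five h0 h1 hg hg4 ht1 h5
    · exact star_le_six h0 h hg hg4
    · refine star_le_of_seven_le h0 hg hg4 h7 ?_
      have : (t : ℝ) ≤ 4 / lam := le_trans (by exact_mod_cast Nat.lt_succ_iff.1 ht) hfl
      rwa [le_div_iff₀ h0] at this

section LexCost

variable {ι : Type} [Fintype ι]

/-- A cost refining the cardinality, ties being broken by the binary expansion along `ρ`. -/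
def lexCost (ρ : ι → ℕ) (s : Finset ι) : ℕ :=
  ∑ j ∈ s, ((∑ i, 2 ^ ρ i) + 1 + 2 ^ ρ j)

lemma lexCost_eq (ρ : ι → ℕ) (s : Finset ι) :
    lexCost ρ s = s.card * ((∑ i, 2 ^ ρ i) + 1) + ∑ j ∈ s, 2 ^ ρ j := by
  simp [lexCost, Finset.sum_add_distrib]

lemma sum_two_pow_le (ρ : ι → ℕ) (s : Finset ι) : ∑ j ∈ s, 2 ^ ρ j ≤ ∑ i, 2 ^ ρ i :=
  Finset.sum_le_sum_of_subset (Finset.subset_univ s)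

lemma lexCost_lt_of_card_lt {ρ : ι → ℕ} {s t : Finset ι} (h : s.card < t.card) :
    lexCost ρ s < lexCost ρ t := by
  rw [lexCost_eq, lexCost_eq]
  have := sum_two_pow_le ρ s
  have := Nat.mul_le_mul_right ((∑ i, 2 ^ ρ i) + 1) h
  rw [Nat.succ_mul] at this
  omega

lemma lexCost_injective {ρ : ι → ℕ} (hρ : Function.Injective ρ) :
    Function.Injective (lexCost ρ) := by
  intro s t hst
  have hcard : s.card = t.card := by
    rcases lt_trichotomy s.card t.card with h | h | h
    · exact absurd hst (lexCost_lt_of_card_lt h).ne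
    · exact h
    · exact absurd hst (lexCost_lt_of_card_lt h).ne'
  rw [lexCost_eq, lexCost_eq, hcard, Nat.add_left_cancel_iff] at hst
  refine Finset.map_injective ⟨ρ, hρ⟩ (Finset.geomSum_injective le_rfl ?_)
  simpa using hst

end LexCost

section Leaders

variable {ι : Type} [DecidableEq ι]

/-- The vector over `F₂` with support `s`. -/
def indicatorVec (s : Finset ι) : ι → ZMod 2 := fun i => if i ∈ s then 1 else 0

lemma indicatorVec_union {s t : Finset ι} (h : Disjoint s t) :
    indicatorVec (s ∪ t) = indicatorVec s + indicatorVec t := by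
  ext i
  have : i ∈ s → i ∉ t := fun hi => Finset.disjoint_left.1 h hi
  by_cases hs : i ∈ s <;> by_cases ht : i ∈ t <;> simp_all [indicatorVec]

lemma indicatorVec_symmDiff (s t : Finset ι) :
    indicatorVec (symmDiff s t) = indicatorVec s + indicatorVec t := by
  ext i
  have h2 : (1 + 1 : ZMod 2) = 0 := by decide
  by_cases hs : i ∈ s <;> by_cases ht : i ∈ t <;>
    simp [indicatorVec, Finset.mem_symmDiff, hs, ht, h2]

variable [Fintype ι]

lemma indicatorVec_support (x : ι → ZMod 2) :
    indicatorVec (Finset.univ.filter fun i => x i ≠ 0) = x := by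
  ext i
  have : ∀ a : ZMod 2, (if a ≠ 0 then 1 else 0) = a := by decide
  simpa [indicatorVec] using this (x i)

lemma hammingNorm_indicatorVec (s : Finset ι) : hammingNorm (indicatorVec s) = s.card := by
  simp [hammingNorm, indicatorVec]

/-- The supports of the cost-minimal vectors in the cosets of `C`. -/
def leaders (C : Submodule (ZMod 2) (ι → ZMod 2)) (ρ : ι → ℕ) : Set (Finset ι) :=
  {s | ∀ t, indicatorVec s - indicatorVec t ∈ C → lexCost ρ s ≤ lexCost ρ t}

variable {C : Submodule (ZMod 2) (ι → ZMod 2)} {ρ : ι → ℕ}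

lemma isLowerSet_leaders : IsLowerSet (leaders C ρ) := by
  intro s s' hs's hs t ht
  have hs's : s' ⊆ s := hs's
  have hsplit : s' ∪ (s \ s') = s := Finset.union_sdiff_of_subset hs's
  have h := hs (symmDiff (s \ s') t) (by
    rw [indicatorVec_symmDiff, ← hsplit, indicatorVec_union Finset.disjoint_sdiff, hsplit]
    convert ht using 1
    ring)
  have h1 : lexCost ρ s = lexCost ρ s' + lexCost ρ (s \ s') := by
    conv_lhs => rw [← hsplit]
    exact Finset.sum_union Finset.disjoint_sdiff
  have h2 : lexCost ρ (symmDiff (s \ s') t) ≤ lexCost ρ (s \ s') + lexCost ρ t := by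
    unfold lexCost
    rw [← Finset.sum_union_inter]
    refine le_add_right (Finset.sum_le_sum_of_subset ?_)
    intro i
    simp only [Finset.mem_symmDiff, Finset.mem_union]
    tauto
  omega

lemma leaders_eq_of_sub_mem (hρ : Function.Injective ρ) {s t : Finset ι}
    (hs : s ∈ leaders C ρ) (ht : t ∈ leaders C ρ) (h : indicatorVec s - indicatorVec t ∈ C) :
    s = t :=
  lexCost_injective hρ (le_antisymm (hs t h) (ht s (by rw [← neg_sub]; exact C.neg_mem h)))

/-- Two elements of a codeword of weight at most `4`, one of which is the last of that codeword,
are not both contained in a leader. -/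
lemma pair_notMem_leaders (hρ : Function.Injective ρ) {W : Finset ι} (hW : indicatorVec W ∈ C)
    (hcard : W.card ≤ 4) {a d : ι} (ha : a ∈ W) (hd : d ∈ W) (had : a ≠ d)
    (hlast : ∀ j ∈ W, j ≠ d → ρ j < ρ d) : {d, a} ∉ leaders C ρ := by
  intro hmem
  have hsub : {d, a} ⊆ W := by simp [Finset.insert_subset_iff, ha, hd]
  have hda : ({d, a} : Finset ι).card = 2 := Finset.card_pair had.symm
  have hc : (W \ {d, a}).card + 2 = W.card := by
    rw [← hda, Finset.card_sdiff_add_card_eq_card hsub]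
  have h := hmem (W \ {d, a}) (by
    rw [ZModModule.sub_eq_add, ← indicatorVec_union Finset.disjoint_sdiff,
      Finset.union_sdiff_of_subset hsub]
    exact hW)
  refine absurd h (not_le.2 ?_)
  rcases Nat.lt_or_ge (W \ {d, a}).card 2 with hlt | hge
  · exact lexCost_lt_of_card_lt (by omega)
  · rw [lexCost_eq, lexCost_eq, hda, show (W \ {d, a}).card = 2 by omega]
    refine Nat.add_lt_add_left ?_ _
    rw [Finset.sum_pair had.symm]
    refine Nat.lt_add_right _ ?_
    have := Nat.geomSum_lt (m := 2) (n := ρ d) (s := (W \ {d, a}).map ⟨ρ, hρ⟩) le_rfl (by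
      intro k hk
      simp only [Finset.mem_map, Function.Embedding.coeFn_mk] at hk
      obtain ⟨j, hj, rfl⟩ := hk
      simp only [Finset.mem_sdiff, Finset.mem_insert, Finset.mem_singleton, not_or] at hj
      exact hlast j hj.1 hj.2.1)
    simpa using this

/-- If every element of `V` outside `B` is determined by `B` through a codeword, then `V` contains
at most `2 ^ |B|` leaders. -/
lemma localGF_leaders_le_two_pow (hρ : Function.Injective ρ) {lam : ℝ} (h0 : 0 ≤ lam)
    (h1 : lam ≤ 1) {V B : Finset ι}
    (hV : ∀ y ∈ V, y ∉ B → ∃ W : Finset ι, indicatorVec W ∈ C ∧ y ∈ W ∧ W.erase y ⊆ B) :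
    localGF (leaders C ρ) lam V ≤ 2 ^ B.card := by
  classical
  have hred : ∀ s ⊆ V, ∃ z ⊆ B, indicatorVec s - indicatorVec z ∈ C := by
    intro s
    induction s using Finset.induction_on with
    | empty => exact fun _ => ⟨∅, by simp, by simp⟩
    | insert y s hy ih =>
      intro hs
      obtain ⟨z, hzB, hz⟩ := ih ((Finset.subset_insert y s).trans hs)
      have hsplit : indicatorVec (insert y s) = indicatorVec {y} + indicatorVec s := by
        rw [← indicatorVec_union (by simpa using hy)]; rfl
      by_cases hyB : y ∈ B
      · refine ⟨symmDiff {y} z, ?_, ?_⟩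
        · intro i
          simp only [Finset.mem_symmDiff, Finset.mem_singleton]
          rintro (⟨rfl, -⟩ | ⟨h, -⟩)
          exacts [hyB, hzB h]
        · rw [hsplit, indicatorVec_symmDiff, add_sub_add_left_eq_sub]
          exact hz
      · obtain ⟨W, hW, hyW, hWB⟩ := hV y (hs (by simp)) hyB
        refine ⟨symmDiff (W.erase y) z, ?_, ?_⟩
        · intro i
          simp only [Finset.mem_symmDiff]
          rintro (⟨h, -⟩ | ⟨h, -⟩)
          exacts [hWB h, hzB h]
        · have hWsplit : indicatorVec W = indicatorVec {y} + indicatorVec (W.erase y) := by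
            rw [← indicatorVec_union (by simp)]
            congr 1
            exact (Finset.insert_erase hyW).symm
          rw [hsplit, indicatorVec_symmDiff, add_sub_add_comm, ZModModule.sub_eq_add, ← hWsplit]
          exact C.add_mem hW hz
  choose! r hrB hr using hred
  have hcard : ((V.powerset.filter (· ∈ leaders C ρ)).card) ≤ 2 ^ B.card := by
    rw [← Finset.card_powerset]
    refine Finset.card_le_card_of_injOn r ?_ ?_
    · intro s hs
      simp only [Finset.coe_filter, Finset.mem_powerset, Set.mem_ofPred_eq] at hs
      simpa using hrB s hs.1
    · intro s hs t ht hst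
      simp only [Finset.coe_filter, Finset.mem_powerset, Set.mem_ofPred_eq] at hs ht
      refine leaders_eq_of_sub_mem hρ hs.2 ht.2 ?_
      have := C.sub_mem (hr s hs.1) (hr t ht.1)
      rwa [hst, sub_sub_sub_cancel_right] at this
  calc localGF (leaders C ρ) lam V
      ≤ (V.powerset.filter (· ∈ leaders C ρ)).card • (1 : ℝ) :=
        Finset.sum_le_card_nsmul _ _ _ fun s _ => pow_le_one₀ h0 h1
    _ ≤ _ := by
        rw [nsmul_eq_mul, mul_one]
        exact_mod_cast hcard

lemma cosetGF_le_localGF_leaders (C : Submodule (ZMod 2) (ι → ZMod 2)) (ρ : ι → ℕ) {lam : ℝ}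
    (h0 : 0 ≤ lam) (h1 : lam ≤ 1) :
    cosetGF C lam ≤ localGF (leaders C ρ) lam Finset.univ := by
  classical
  have hmin : ∀ A : (ι → ZMod 2) ⧸ C, ∃ s ∈ leaders C ρ,
      Submodule.Quotient.mk (indicatorVec s) = A ∧ s.card ≤ cosetWeight C A := by
    intro A
    have hne : (Finset.univ.filter fun s : Finset ι =>
        Submodule.Quotient.mk (p := C) (indicatorVec s) = A).Nonempty := by
      obtain ⟨x, rfl⟩ := Submodule.Quotient.mk_surjective C A
      exact ⟨Finset.univ.filter fun i => x i ≠ 0, by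
        simp only [Finset.mem_filter_univ, indicatorVec_support]⟩
    obtain ⟨s, hs, hsmin⟩ := Finset.exists_min_image _ (lexCost ρ) hne
    simp only [Finset.mem_filter_univ] at hs hsmin
    refine ⟨s, fun t ht => hsmin t ?_, hs, ?_⟩
    · rw [← hs]
      exact ((Submodule.Quotient.eq C).2 ht).symm
    · have hw : cosetWeight C A ∈
          {k | ∃ x : ι → ZMod 2, Submodule.Quotient.mk x = A ∧ hammingNorm x = k} :=
        Nat.sInf_mem ⟨_, indicatorVec s, hs, rfl⟩
      obtain ⟨x, hx, hxw⟩ := hw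
      rw [← hxw, ← indicatorVec_support x, hammingNorm_indicatorVec]
      refine le_of_not_gt fun hlt => ?_
      refine absurd (hsmin _ ?_) (not_le.2 (lexCost_lt_of_card_lt hlt))
      rw [indicatorVec_support, hx]
  choose r hrL hrA hrw using hmin
  have : Fintype ((ι → ZMod 2) ⧸ C) := Fintype.ofFinite _
  have hinj : Function.Injective r := fun A A' h => by rw [← hrA A, ← hrA A', h]
  unfold cosetGF localGF
  rw [finsum_eq_sum_of_fintype]
  calc ∑ A, lam ^ cosetWeight C A ≤ ∑ A, lam ^ (r A).card :=
        Finset.sum_le_sum fun A _ => pow_le_pow_of_le_one h0 h1 (hrw A)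
    _ = ∑ s ∈ Finset.univ.image r, lam ^ s.card := by
        rw [Finset.sum_image hinj.injOn]
    _ ≤ _ := by
        refine Finset.sum_le_sum_of_subset_of_nonneg ?_ fun _ _ _ => by positivity
        intro s hs
        obtain ⟨A, -, rfl⟩ := Finset.mem_image.1 hs
        simpa using hrL A

end Leaders

/-- A family of disjoint blocks, enumerated by `ρ` before all other elements, each of which is the
new part of a codeword of weight at most `4`. -/
structure IsBlockFamily {ι : Type} [DecidableEq ι] (C : Submodule (ZMod 2) (ι → ZMod 2))
    (ρ : ι → ℕ) (𝓑 : Finset (Finset ι)) : Prop where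
  injective : Function.Injective ρ
  disjoint : (𝓑 : Set (Finset ι)).PairwiseDisjoint id
  lt_of_notMem : ∀ b ∈ 𝓑.biUnion id, ∀ y ∉ 𝓑.biUnion id, ρ b < ρ y
  two_le_card : ∀ N ∈ 𝓑, 2 ≤ N.card
  exists_word : ∀ N ∈ 𝓑, ∃ d ∈ N, ∃ W : Finset ι, indicatorVec W ∈ C ∧ W.card ≤ 4 ∧
    N ⊆ W ∧ W ⊆ 𝓑.biUnion id ∧ ∀ j ∈ W, j ≠ d → ρ j < ρ d

lemma IsBlockFamily.extend {n : ℕ} {C : Submodule (ZMod 2) (Fin n → ZMod 2)} {ρ : Fin n → ℕ}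
    {𝓑 : Finset (Finset (Fin n))} (h : IsBlockFamily C ρ 𝓑) {W : Finset (Fin n)}
    (hW : indicatorVec W ∈ C) (hW4 : W.card ≤ 4) (hnew : 2 ≤ (W \ 𝓑.biUnion id).card) :
    ∃ ρ', IsBlockFamily C ρ' (insert (W \ 𝓑.biUnion id) 𝓑) := by
  set B := 𝓑.biUnion id with hB
  set M := (∑ i, ρ i) + 1 with hM
  have hρM : ∀ i, ρ i < M := fun i =>
    Nat.lt_succ_of_le (Finset.single_le_sum (f := ρ) (fun _ _ => Nat.zero_le _) (Finset.mem_univ i))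
  have hB' : (insert (W \ B) 𝓑).biUnion id = W \ B ∪ B := by
    rw [Finset.biUnion_insert, ← hB]; rfl
  have hsubB : ∀ N ∈ 𝓑, N ⊆ B := fun N hN => Finset.subset_biUnion_of_mem id hN
  let ρ' : Fin n → ℕ := fun j => if j ∈ B then ρ j else if j ∈ W then M + j else M + n + j
  have hρB : ∀ j ∈ B, ρ' j = ρ j := fun j hj => by simp [ρ', hj]
  have hρN : ∀ j ∉ B, j ∈ W → ρ' j = M + j := fun j hj hj' => by simp [ρ', hj, hj']
  have hρU : ∀ j ∉ B, j ∉ W → ρ' j = M + n + j := fun j hj hj' => by simp [ρ', hj, hj']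
  refine ⟨ρ', ⟨?_, ?_, ?_, ?_, ?_⟩⟩
  · intro i j hij
    have hi := hρM i
    have hj := hρM j
    have hi' := i.2
    have hj' := j.2
    by_cases h1 : i ∈ B <;> by_cases h2 : j ∈ B
    · rw [hρB i h1, hρB j h2] at hij
      exact h.injective hij
    all_goals
      simp only [ρ', h1, h2, if_true, if_false] at hij
      ext
      split_ifs at hij <;> omega
  · rw [Finset.coe_insert]
    refine h.disjoint.insert fun N hN _ => ?_
    exact Finset.sdiff_disjoint.mono_right (hsubB N hN)
  · rw [hB']
    intro b hb y hy
    simp only [Finset.mem_union, Finset.mem_sdiff, not_or, not_and, not_not] at hb hy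
    have hyW : y ∉ W := fun hyW => hy.2 (hy.1 hyW)
    rw [hρU y hy.2 hyW]
    rcases hb with ⟨hbW, hbB⟩ | hb
    · rw [hρN b hbB hbW]
      omega
    · rw [hρB b hb]
      have := hρM b
      omega
  · intro N hN
    rcases Finset.mem_insert.1 hN with rfl | hN
    exacts [hnew, h.two_le_card N hN]
  · rw [hB']
    intro N hN
    rcases Finset.mem_insert.1 hN with rfl | hN
    · obtain ⟨d, hd, hmax⟩ := Finset.exists_max_image (W \ B) id
        (Finset.card_pos.1 (by omega))
      refine ⟨d, hd, W, hW, hW4, Finset.sdiff_subset, by simp, fun j hj hjd => ?_⟩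
      rw [Finset.mem_sdiff] at hd
      rw [hρN d hd.2 hd.1]
      by_cases hjB : j ∈ B
      · rw [hρB j hjB]
        have := hρM j
        omega
      · rw [hρN j hjB hj]
        have := lt_of_le_of_ne (hmax j (Finset.mem_sdiff.2 ⟨hj, hjB⟩)) hjd
        exact Nat.add_lt_add_left this _
    · obtain ⟨d, hd, X, hX, hX4, hNX, hXB, hlast⟩ := h.exists_word N hN
      refine ⟨d, hd, X, hX, hX4, hNX, hXB.trans Finset.subset_union_right, fun j hj hjd => ?_⟩
      rw [hρB j (hXB hj), hρB d (hXB (hNX hd))]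
      exact hlast j hj hjd

/-- Coordinates covered by codewords of weight at most `4` split into blocks of size at most `4`,
which are stars of pairs outside the leaders, and remaining elements, each attached to blocks
through a codeword. -/
lemma exists_blocks {n : ℕ} {C : Submodule (ZMod 2) (Fin n → ZMod 2)}
    (hcover : ∀ i, ∃ W : Finset (Fin n), indicatorVec W ∈ C ∧ W.card ≤ 4 ∧ i ∈ W) :
    ∃ (ρ : Fin n → ℕ) (𝓑 : Finset (Finset (Fin n))), Function.Injective ρ ∧
      (𝓑 : Set (Finset (Fin n))).PairwiseDisjoint id ∧
      (∀ N ∈ 𝓑, 2 ≤ N.card ∧ N.card ≤ 4 ∧ ∃ d ∈ N, ∀ a ∈ N, a ≠ d → {a, d} ∉ leaders C ρ) ∧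
      ∀ y ∉ 𝓑.biUnion id, ∃ W : Finset (Fin n), indicatorVec W ∈ C ∧ y ∈ W ∧
        W.erase y ⊆ 𝓑.biUnion id ∧ ∀ b ∈ W.erase y, {y, b} ∉ leaders C ρ := by
  classical
  obtain ⟨𝓑, h𝓑, hmax⟩ := Finset.exists_max_image
    (Finset.univ.filter fun 𝓑 : Finset (Finset (Fin n)) => ∃ ρ, IsBlockFamily C ρ 𝓑)
    (fun 𝓑 => (𝓑.biUnion id).card)
    ⟨∅, by
      rw [Finset.mem_filter_univ]
      exact ⟨_, Fin.val_injective, by simp, by simp, by simp, by simp⟩⟩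
  simp only [Finset.mem_filter_univ] at h𝓑 hmax
  obtain ⟨ρ, h⟩ := h𝓑
  refine ⟨ρ, 𝓑, h.injective, h.disjoint, fun N hN => ?_, fun y hy => ?_⟩
  · obtain ⟨d, hd, W, hW, hW4, hNW, -, hlast⟩ := h.exists_word N hN
    refine ⟨h.two_le_card N hN, (Finset.card_le_card hNW).trans hW4, d, hd, fun a ha had => ?_⟩
    rw [Finset.pair_comm]
    exact pair_notMem_leaders h.injective hW hW4 (hNW ha) (hNW hd) had hlast
  · obtain ⟨W, hW, hW4, hyW⟩ := hcover y
    have hsub : W.erase y ⊆ 𝓑.biUnion id := by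
      intro j hj
      by_contra hjB
      rw [Finset.mem_erase] at hj
      have hnew : 2 ≤ (W \ 𝓑.biUnion id).card := by
        rw [← Finset.card_pair hj.1]
        refine Finset.card_le_card ?_
        simp only [Finset.insert_subset_iff, Finset.singleton_subset_iff, Finset.mem_sdiff]
        exact ⟨⟨hj.2, hjB⟩, hyW, hy⟩
      have := hmax _ (h.extend hW hW4 hnew)
      rw [Finset.biUnion_insert, id, Finset.card_union_of_disjoint Finset.sdiff_disjoint] at this
      omega
    refine ⟨W, hW, hyW, hsub, fun b hb => ?_⟩
    rw [Finset.mem_erase] at hb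
    refine pair_notMem_leaders h.injective hW hW4 hb.2 hyW hb.1 fun j hj hjy => ?_
    exact h.lt_of_notMem j (hsub (Finset.mem_erase.2 ⟨hjy, hj⟩)) y hy

lemma localGF_leaders_univ_le {n : ℕ} {C : Submodule (ZMod 2) (Fin n → ZMod 2)}
    (hcover : ∀ i, ∃ W : Finset (Fin n), indicatorVec W ∈ C ∧ W.card ≤ 4 ∧ i ∈ W)
    {lam g : ℝ} (h0 : 0 < lam) (h1 : lam ≤ 1) (hg : 0 < g)
    (hg4 : g ^ 4 = 1 + 4 * lam + 6 * lam ^ 2) :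
    ∃ ρ, localGF (leaders C ρ) lam Finset.univ ≤ g ^ n := by
  classical
  obtain ⟨m, hm4, hm16, hstar⟩ := exists_size_threshold h0 h1 hg hg4
  have hg1 : 1 ≤ g := le_of_pow_le_pow_left₀ (n := 4) four_ne_zero hg.le (by rw [hg4]; nlinarith)
  have hg2 : g ≤ 2 := le_of_pow_le_pow_left₀ (n := 4) four_ne_zero (by norm_num)
    (by rw [hg4]; nlinarith)
  obtain ⟨ρ, 𝓑, hρ, hdisj, hblock, hout⟩ := exists_blocks hcover
  refine ⟨ρ, ?_⟩
  set L := leaders C ρ with hLdef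
  have hL : IsLowerSet L := isLowerSet_leaders
  set B := 𝓑.biUnion id with hB
  choose! W hWC hyW hWB hWL using hout
  obtain ⟨U', hU', hdef, f, hf, hcap⟩ := exists_capacitated_assignment (Finset.univ \ B)
    (fun y => 𝓑.filter fun N => ¬ Disjoint N (W y)) (m - 4)
  set U := Finset.univ \ B with hU
  set 𝓗 := U'.biUnion fun y => 𝓑.filter fun N => ¬ Disjoint N (W y) with h𝓗
  have h𝓗𝓑 : 𝓗 ⊆ 𝓑 := by
    rw [h𝓗, Finset.biUnion_subset]
    exact fun y _ => Finset.filter_subset _ _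
  have hUB : ∀ y ∈ U, y ∉ B := fun y hy => (Finset.mem_sdiff.1 hy).2
  have hsubB : ∀ N ∈ 𝓑, N ⊆ B := fun N hN => Finset.subset_biUnion_of_mem id hN
  -- the heavy part
  have hheavy : localGF L lam (𝓗.biUnion id ∪ U') ≤ g ^ (𝓗.biUnion id ∪ U').card := by
    have hdisjU : Disjoint (𝓗.biUnion id) U' := by
      rw [Finset.disjoint_biUnion_left]
      intro N hN
      exact Finset.disjoint_left.2 fun j hj hjU => hUB j (hU' hjU) (hsubB N (h𝓗𝓑 hN) hj)
    have hcard : (𝓗.biUnion id).card = ∑ N ∈ 𝓗, N.card :=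
      Finset.card_biUnion (hdisj.subset (by exact_mod_cast h𝓗𝓑))
    calc localGF L lam (𝓗.biUnion id ∪ U') ≤ 2 ^ (𝓗.biUnion id).card := by
          refine localGF_leaders_le_two_pow hρ h0.le h1 fun y hy hyH => ?_
          have hyU : y ∈ U' := by simpa [hyH] using (Finset.mem_union.1 hy)
          have hyB := hUB y (hU' hyU)
          refine ⟨W y, hWC y hyB, hyW y hyB, fun b hb => ?_⟩
          obtain ⟨N, hN, hbN⟩ := Finset.mem_biUnion.1 (hWB y hyB hb)
          refine Finset.mem_biUnion.2 ⟨N, ?_, hbN⟩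
          refine Finset.mem_biUnion.2 ⟨y, hyU, Finset.mem_filter.2 ⟨hN, ?_⟩⟩
          exact Finset.not_disjoint_iff.2 ⟨b, hbN, Finset.mem_of_mem_erase hb⟩
      _ = ∏ N ∈ 𝓗, (2 : ℝ) ^ N.card := by rw [hcard, Finset.prod_pow_eq_pow_sum]
      _ ≤ ∏ N ∈ 𝓗, g ^ (N.card + (m - 4)) := by
          refine Finset.prod_le_prod (fun _ _ => by positivity) fun N hN => ?_
          obtain ⟨k, hk⟩ := Nat.exists_eq_add_of_le (hblock N (h𝓗𝓑 hN)).2.1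
          have h16 : (2 : ℝ) ^ N.card * 2 ^ k = 16 := by rw [← pow_add, ← hk]; norm_num
          have hgm : g ^ (N.card + (m - 4)) * g ^ k = g ^ m := by
            rw [← pow_add]; congr 1; omega
          have hgk : g ^ k ≤ 2 ^ k := by gcongr
          refine le_of_mul_le_mul_right ?_ (by positivity : (0 : ℝ) < 2 ^ k)
          calc (2 : ℝ) ^ N.card * 2 ^ k ≤ g ^ (N.card + (m - 4)) * g ^ k := by
                rw [h16, hgm]; exact hm16
            _ ≤ _ := by gcongr
      _ = g ^ ((𝓗.biUnion id).card + (m - 4) * 𝓗.card) := by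
          rw [Finset.prod_pow_eq_pow_sum, Finset.sum_add_distrib, hcard]
          simp [mul_comm]
      _ ≤ _ := by
          rw [Finset.card_union_of_disjoint hdisjU]
          exact pow_le_pow_right₀ hg1 (Nat.add_le_add_left hdef _)
  -- the light part
  let X : Finset (Fin n) → Finset (Fin n) := fun N => N ∪ (U \ U').filter fun y => f y = N
  have hXU : ∀ N ∈ 𝓑, ∀ j ∈ X N, j ∈ B → j ∈ N := by
    intro N hN j hj hjB
    rcases Finset.mem_union.1 hj with h | h
    · exact h
    · exact absurd hjB (hUB j (Finset.mem_sdiff.1 (Finset.mem_filter.1 h).1).1)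
  have hXf : ∀ N ∈ 𝓑, ∀ j ∈ X N, j ∉ B → j ∈ U \ U' ∧ f j = N := by
    intro N hN j hj hjB
    rcases Finset.mem_union.1 hj with h | h
    · exact absurd (hsubB N hN h) hjB
    · exact Finset.mem_filter.1 h
  have hlight : localGF L lam ((𝓑 \ 𝓗).biUnion X) ≤ g ^ ((𝓑 \ 𝓗).biUnion X).card := by
    refine localGF_biUnion_le hL h0.le hg.le ?_ ?_
    · intro N hN N' hN' hNN'
      have hN := (Finset.mem_sdiff.1 (Finset.mem_coe.1 hN)).1
      have hN' := (Finset.mem_sdiff.1 (Finset.mem_coe.1 hN')).1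
      refine Finset.disjoint_left.2 fun j hj hj' => ?_
      by_cases hjB : j ∈ B
      · exact Finset.disjoint_left.1 (hdisj hN hN' hNN') (hXU N hN j hj hjB)
          (hXU N' hN' j hj' hjB)
      · exact hNN' ((hXf N hN j hj hjB).2.symm.trans (hXf N' hN' j hj' hjB).2)
    · intro N hN
      have hN := (Finset.mem_sdiff.1 hN).1
      obtain ⟨h2, h4, d, hd, hdN⟩ := hblock N hN
      have hNE : N = {d} ∪ N.erase d := (Finset.insert_erase hd).symm
      have hNcard : N.card = (N.erase d).card + 1 := (Finset.card_erase_add_one hd).symm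
      have hNstar : localGF L lam N ≤ (1 + lam) ^ (N.erase d).card + lam := by
        have := localGF_union_le_of_attached hL h0.le (k := 0) (Finset.card_singleton d)
          (localGF_singleton_le h0.le d) (Y := N.erase d) (by simp) (fun y hy =>
            ⟨d, by simp, hdN y (Finset.mem_of_mem_erase hy) (Finset.ne_of_mem_erase hy)⟩)
        rwa [← hNE, zero_add] at this
      have hdisjX : Disjoint N ((U \ U').filter fun y => f y = N) :=
        Finset.disjoint_left.2 fun j hj hj' =>
          hUB j (Finset.mem_sdiff.1 (Finset.mem_filter.1 hj').1).1 (hsubB N hN hj)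
      refine (localGF_union_le_of_attached hL h0.le hNcard hNstar hdisjX ?_).trans ?_
      · intro y hy
        obtain ⟨hyU, rfl⟩ := Finset.mem_filter.1 hy
        have hyB := hUB y (Finset.mem_sdiff.1 hyU).1
        have hfy := (Finset.mem_filter.1 (Finset.mem_sdiff.1 (hf y hyU)).1).2
        obtain ⟨b, hbN, hbW⟩ := Finset.not_disjoint_iff.1 hfy
        refine ⟨b, hbN, hWL y hyB b (Finset.mem_erase.2 ⟨?_, hbW⟩)⟩
        rintro rfl
        exact hyB (hsubB _ hN hbN)
      · have hc := hcap N
        rw [Finset.card_union_of_disjoint hdisjX, hNcard, add_right_comm]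
        exact hstar _ (by omega) (by omega)
  have hdisjoint : Disjoint (𝓗.biUnion id ∪ U') ((𝓑 \ 𝓗).biUnion X) := by
    rw [Finset.disjoint_biUnion_right]
    intro N hN
    obtain ⟨hN, hNH⟩ := Finset.mem_sdiff.1 hN
    refine Finset.disjoint_left.2 fun j hj hj' => ?_
    by_cases hjB : j ∈ B
    · rcases Finset.mem_union.1 hj with h | h
      · obtain ⟨N', hN', hjN'⟩ := Finset.mem_biUnion.1 h
        have hne : N' ≠ N := by rintro rfl; exact hNH hN'
        exact Finset.disjoint_left.1 (hdisj (h𝓗𝓑 hN') hN hne) hjN' (hXU N hN j hj' hjB)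
      · exact hUB j (hU' h) hjB
    · have hjX := hXf N hN j hj' hjB
      rcases Finset.mem_union.1 hj with h | h
      · obtain ⟨N', hN', hjN'⟩ := Finset.mem_biUnion.1 h
        exact hjB (hsubB N' (h𝓗𝓑 hN') hjN')
      · exact (Finset.mem_sdiff.1 hjX.1).2 h
  have huniv : (𝓗.biUnion id ∪ U') ∪ (𝓑 \ 𝓗).biUnion X = Finset.univ := by
    refine Finset.eq_univ_iff_forall.2 fun j => ?_
    by_cases hjB : j ∈ B
    · obtain ⟨N, hN, hjN⟩ := Finset.mem_biUnion.1 hjB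
      by_cases hNH : N ∈ 𝓗
      · exact Finset.mem_union_left _ (Finset.mem_union_left _ (Finset.mem_biUnion.2 ⟨N, hNH, hjN⟩))
      · exact Finset.mem_union_right _ (Finset.mem_biUnion.2
          ⟨N, Finset.mem_sdiff.2 ⟨hN, hNH⟩, Finset.mem_union_left _ hjN⟩)
    · by_cases hjU : j ∈ U'
      · exact Finset.mem_union_left _ (Finset.mem_union_right _ hjU)
      · have hj : j ∈ U \ U' := by simp [hU, hjB, hjU]
        obtain ⟨h1, h2⟩ := Finset.mem_sdiff.1 (hf j hj)
        exact Finset.mem_union_right _ (Finset.mem_biUnion.2 ⟨f j,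
          Finset.mem_sdiff.2 ⟨(Finset.mem_filter.1 h1).1, h2⟩,
          Finset.mem_union_right _ (Finset.mem_filter.2 ⟨hj, rfl⟩)⟩)
  have hn : (𝓗.biUnion id ∪ U').card + ((𝓑 \ 𝓗).biUnion X).card = n := by
    rw [← Finset.card_union_of_disjoint hdisjoint, huniv, Finset.card_univ, Fintype.card_fin]
  calc localGF L lam Finset.univ
      ≤ localGF L lam (𝓗.biUnion id ∪ U') * localGF L lam ((𝓑 \ 𝓗).biUnion X) := by
        rw [← huniv]; exact localGF_union_le hL h0.le hdisjoint
    _ ≤ g ^ (𝓗.biUnion id ∪ U').card * g ^ ((𝓑 \ 𝓗).biUnion X).card :=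
        mul_le_mul hheavy hlight (localGF_nonneg h0.le _) (by positivity)
    _ = g ^ n := by rw [← pow_add, hn]

lemma exists_codeword_card_le_four {n : ℕ} {C : Submodule (ZMod 2) (Fin n → ZMod 2)}
    (hspan : ∃ S : Set (Fin n → ZMod 2),
      (∀ x ∈ S, hammingNorm x ≤ 4) ∧ Submodule.span (ZMod 2) S = C)
    (hcover : (⋃ c ∈ (C : Set (Fin n → ZMod 2)), Function.support c) = Set.univ) (i : Fin n) :
    ∃ W : Finset (Fin n), indicatorVec W ∈ C ∧ W.card ≤ 4 ∧ i ∈ W := by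
  obtain ⟨S, hS, rfl⟩ := hspan
  obtain ⟨x, hxS, hxi⟩ : ∃ x ∈ S, x i ≠ 0 := by
    by_contra! hzero
    have hle : Submodule.span (ZMod 2) S ≤ LinearMap.ker (LinearMap.proj i) :=
      Submodule.span_le.2 fun x hx => hzero x hx
    have hi : i ∈ ⋃ c ∈ (Submodule.span (ZMod 2) S : Set (Fin n → ZMod 2)), Function.support c :=
      hcover ▸ Set.mem_univ i
    simp only [Set.mem_iUnion] at hi
    obtain ⟨c, hc, hci⟩ := hi
    exact hci (hle hc)
  refine ⟨Finset.univ.filter fun j => x j ≠ 0, ?_, ?_, by simpa using hxi⟩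
  · rw [indicatorVec_support]
    exact Submodule.subset_span hxS
  · exact hS x hxS

/-- if `C ≤ F₂ⁿ` is spanned by vectors of Hamming weight at most `4`,
and the union of the supports of the codewords of `C` is `{1,…,n}`, then for `0 ≤ λ ≤ 1`,
`Q_C(λ) ≤ (1+4λ+6λ²)^(n/4)`. -/
theorem coset_gf_le_of_spanned_by_weight_four (n : ℕ)
    (C : Submodule (ZMod 2) (Fin n → ZMod 2))
    (hspan : ∃ S : Set (Fin n → ZMod 2),
      (∀ x ∈ S, hammingNorm x ≤ 4) ∧ Submodule.span (ZMod 2) S = C)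
    (hcover : (⋃ c ∈ (C : Set (Fin n → ZMod 2)), Function.support c) = Set.univ)
    (lam : ℝ) (hlam0 : 0 ≤ lam) (hlam1 : lam ≤ 1) :
    cosetGF C lam ≤ (1 + 4 * lam + 6 * lam ^ 2) ^ ((n : ℝ) / 4) := by
  have hcov := exists_codeword_card_le_four hspan hcover
  rcases hlam0.eq_or_lt with rfl | h0
  · refine (cosetGF_le_localGF_leaders C Fin.val le_rfl zero_le_one).trans ?_
    refine (localGF_le_one_add_pow le_rfl _).trans ?_
    simp
  · set P : ℝ := 1 + 4 * lam + 6 * lam ^ 2 with hP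
    have hP0 : 0 < P := by positivity
    have hg4 : (P ^ ((1 : ℝ) / 4)) ^ 4 = P := by
      rw [← Real.rpow_natCast, ← Real.rpow_mul hP0.le]
      norm_num
    obtain ⟨ρ, hρ⟩ := localGF_leaders_univ_le hcov h0 hlam1 (Real.rpow_pos_of_pos hP0 _) hg4
    refine (cosetGF_le_localGF_leaders C ρ hlam0 hlam1).trans (hρ.trans_eq ?_)
    rw [← Real.rpow_natCast, ← Real.rpow_mul hP0.le]
    congr 1
    ring
end

section
/- (Friedman–Tillich) Fix δ ∈ (0,1/2) and set ρ = 1/2 − √(δ(1−δ)). For every ε > 0 there exists N such that for all n ≥ N and every linear code C ≤ F₂ⁿ whose minimum Hamming distance is at least δn, one has |C| ≤ 2^(εn) · |B_T(ρn)|, where T is the coset graph of C and B_T(ρn) is the ball of radius ρn around the zero coset. -/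
/-- The dual code `C⊥ = {x ∈ F₂ⁿ : x·c = 0 for all c ∈ C}`. -/
noncomputable def dualCode {n : ℕ} (C : Submodule (ZMod 2) (Fin n → ZMod 2)) :
    Submodule (ZMod 2) (Fin n → ZMod 2) where
  carrier := {x | ∀ c ∈ C, ∑ i, x i * c i = 0}
  zero_mem' := by intro c hc; simp
  add_mem' := by
    intro a b ha hb c hc
    have h1 := ha c hc
    have h2 := hb c hc
    simp only [Pi.add_apply, add_mul, Finset.sum_add_distrib, h1, h2, add_zero]
  smul_mem' := by
    intro r a ha c hc
    have h := ha c hc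
    simp only [Pi.smul_apply, smul_eq_mul, mul_assoc, ← Finset.mul_sum, h, mul_zero]

namespace FriedmanTillich

open Finset

/-- The nontrivial sign character of `ZMod 2`. -/
noncomputable def sgn (a : ZMod 2) : ℝ := if a = 0 then 1 else -1

lemma sgn_zero : sgn 0 = 1 := if_pos rfl

lemma sgn_one : sgn 1 = -1 := if_neg one_ne_zero

lemma sgn_add (a b : ZMod 2) : sgn (a + b) = sgn a * sgn b := by
  have h01 : ∀ a : ZMod 2, a = 0 ∨ a = 1 := by decide
  have h11 : (1 + 1 : ZMod 2) = 0 := rfl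
  rcases h01 a with rfl | rfl <;> rcases h01 b with rfl | rfl <;>
    simp [sgn_zero, sgn_one, h11]

lemma add_self {n : ℕ} (x : Fin n → ZMod 2) : x + x = 0 :=
  funext fun _ => CharTwo.add_self_eq_zero _

/-- The character of `F₂ⁿ` attached to `c`. -/
noncomputable def chi {n : ℕ} (c x : Fin n → ZMod 2) : ℝ := sgn (∑ i, x i * c i)

lemma chi_add_right {n : ℕ} (c x y : Fin n → ZMod 2) : chi c (x + y) = chi c x * chi c y := by
  simp [chi, add_mul, sum_add_distrib, sgn_add]

lemma chi_add_left {n : ℕ} (c d x : Fin n → ZMod 2) : chi (c + d) x = chi c x * chi d x := by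
  simp [chi, mul_add, sum_add_distrib, sgn_add]

lemma chi_zero_left {n : ℕ} (x : Fin n → ZMod 2) : chi 0 x = 1 := by
  simp [chi, sgn_zero]

lemma chi_single {n : ℕ} (c : Fin n → ZMod 2) (i : Fin n) :
    chi c (Pi.single i 1) = sgn (c i) := by
  simp [chi, Pi.single_apply]

lemma sum_sgn {n : ℕ} (c : Fin n → ZMod 2) : ∑ i, sgn (c i) = n - 2 * (hammingNorm c : ℝ) := by
  have h : ∀ i, sgn (c i) = 1 - 2 * (if c i ≠ 0 then (1 : ℝ) else 0) := by
    intro i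
    by_cases hi : c i = 0 <;> simp [sgn, hi]
    norm_num
  simp_rw [h, sum_sub_distrib, ← mul_sum, hammingNorm, sum_boole]
  simp

open Classical in
lemma sum_chi {n : ℕ} (C : Submodule (ZMod 2) (Fin n → ZMod 2)) (x : Fin n → ZMod 2) :
    ∑ c : C, chi (c : Fin n → ZMod 2) x = if x ∈ dualCode C then (Nat.card C : ℝ) else 0 := by
  split_ifs with h
  · have h1 : ∀ c : C, chi (c : Fin n → ZMod 2) x = 1 := fun c => by
      have := h c c.2
      simp [chi, this, sgn_zero]
    simp [h1, Nat.card_eq_fintype_card]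
  · obtain ⟨d, hd, hdx⟩ : ∃ d ∈ C, ∑ i, x i * d i ≠ 0 := by
      by_contra! h'
      exact h h'
    have h1 : chi d x = -1 := if_neg hdx
    have h2 : ∑ c : C, chi (c : Fin n → ZMod 2) x = ∑ c : C, -chi (c : Fin n → ZMod 2) x := by
      rw [← Equiv.sum_comp (Equiv.addRight (⟨d, hd⟩ : C))]
      simp [chi_add_left, h1]
    rw [sum_neg_distrib] at h2
    linarith

/-- The Fourier coefficient of `g` at `c`. -/
noncomputable def fourier {n : ℕ} (g : (Fin n → ZMod 2) → ℝ) (c : Fin n → ZMod 2) : ℝ :=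
  ∑ x, g x * chi c x

/-- The adjacency operator of the Hamming cube. -/
noncomputable def adj {n : ℕ} (g : (Fin n → ZMod 2) → ℝ) (x : Fin n → ZMod 2) : ℝ :=
  ∑ i, g (x + Pi.single i 1)

lemma fourier_adj {n : ℕ} (g : (Fin n → ZMod 2) → ℝ) (c : Fin n → ZMod 2) :
    fourier (adj g) c = (n - 2 * (hammingNorm c : ℝ)) * fourier g c := by
  have h : ∀ i, ∑ x, g (x + Pi.single i 1) * chi c x = sgn (c i) * fourier g c := by
    intro i
    rw [← Equiv.sum_comp (Equiv.addRight (Pi.single i (1 : ZMod 2) : Fin n → ZMod 2)), fourier,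
      mul_sum]
    refine sum_congr rfl fun x _ => ?_
    have h2 : x + Pi.single i 1 + Pi.single i 1 = x := by
      rw [add_assoc, add_self, add_zero]
    simp only [Equiv.coe_addRight, h2, chi_add_right, chi_single]
    ring
  simp_rw [fourier, adj, sum_mul]
  rw [sum_comm, ← sum_sgn, sum_mul]
  exact sum_congr rfl fun i _ => h i

open Classical in
/-- The push-forward of `g` to the quotient by `D`. -/
noncomputable def push {n : ℕ} (D : Submodule (ZMod 2) (Fin n → ZMod 2))
    (g : (Fin n → ZMod 2) → ℝ) (A : (Fin n → ZMod 2) ⧸ D) : ℝ :=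
  ∑ x, if Submodule.Quotient.mk x = A then g x else 0

lemma push_nonneg {n : ℕ} (D : Submodule (ZMod 2) (Fin n → ZMod 2))
    {g : (Fin n → ZMod 2) → ℝ} (hg : ∀ x, 0 ≤ g x) (A : (Fin n → ZMod 2) ⧸ D) :
    0 ≤ push D g A :=
  sum_nonneg fun x _ => by split_ifs <;> simp [hg]

lemma mul_push_le {n : ℕ} (D : Submodule (ZMod 2) (Fin n → ZMod 2))
    {g h : (Fin n → ZMod 2) → ℝ} {l : ℝ} (hgh : ∀ x, l * g x ≤ h x)
    (A : (Fin n → ZMod 2) ⧸ D) : l * push D g A ≤ push D h A := by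
  rw [push, push, mul_sum]
  refine sum_le_sum fun x _ => ?_
  split_ifs <;> simp [hgh]

open Classical in
lemma sum_push {n : ℕ} (D : Submodule (ZMod 2) (Fin n → ZMod 2))
    (g : (Fin n → ZMod 2) → ℝ) : ∑ A, push D g A = ∑ x, g x := by
  simp_rw [push]
  rw [sum_comm]
  simp

open Classical in
lemma parseval {n : ℕ} (C : Submodule (ZMod 2) (Fin n → ZMod 2))
    (g h : (Fin n → ZMod 2) → ℝ) :
    ∑ c : C, fourier g c * fourier h c =
      Nat.card C * ∑ A, push (dualCode C) g A * push (dualCode C) h A := by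
  have hmem : ∀ x y : Fin n → ZMod 2, x + y ∈ dualCode C ↔
      (Submodule.Quotient.mk x : (Fin n → ZMod 2) ⧸ dualCode C) = Submodule.Quotient.mk y := by
    intro x y
    rw [Submodule.Quotient.eq, sub_eq_add_neg, neg_eq_of_add_eq_zero_left (add_self y)]
  have h1 : ∑ c : C, fourier g c * fourier h c =
      ∑ x, ∑ y, g x * h y * ∑ c : C, chi (c : Fin n → ZMod 2) (x + y) := by
    simp_rw [fourier, sum_mul_sum, mul_sum]
    rw [sum_comm]
    refine sum_congr rfl fun x _ => ?_
    rw [sum_comm]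
    refine sum_congr rfl fun y _ => sum_congr rfl fun c _ => ?_
    rw [chi_add_right]
    ring
  have h2 : ∑ A, push (dualCode C) g A * push (dualCode C) h A =
      ∑ x, ∑ y, g x * h y * if x + y ∈ dualCode C then 1 else 0 := by
    simp_rw [push, sum_mul_sum]
    rw [sum_comm]
    refine sum_congr rfl fun x _ => ?_
    rw [sum_comm]
    refine sum_congr rfl fun y _ => ?_
    simp [hmem, eq_comm]
  rw [h1, h2, mul_sum]
  refine sum_congr rfl fun x _ => ?_
  rw [mul_sum]
  refine sum_congr rfl fun y _ => ?_
  rw [sum_chi]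
  split_ifs <;> ring

/-- A nonnegative `l`-subharmonic function with `l > n - 2d` bounds the size of a code of minimum
distance at least `d` by the number of cosets meeting its support. -/
lemma card_le_of_adj {n : ℕ} (C : Submodule (ZMod 2) (Fin n → ZMod 2)) {d l : ℝ} (hd : 0 ≤ d)
    (hC : ∀ c ∈ C, c ≠ 0 → d ≤ (hammingNorm c : ℝ))
    {g : (Fin n → ZMod 2) → ℝ} (hg : ∀ x, 0 ≤ g x) {x₀ : Fin n → ZMod 2} (hx₀ : 0 < g x₀)
    (hadj : ∀ x, l * g x ≤ adj g x) (S : Set ((Fin n → ZMod 2) ⧸ dualCode C))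
    (hS : ∀ x, g x ≠ 0 → Submodule.Quotient.mk x ∈ S) :
    (l - (n - 2 * d)) * Nat.card C ≤ 2 * d * S.ncard := by
  classical
  set F := push (dualCode C) g with hF
  have hF0 : ∀ A, 0 ≤ F A := push_nonneg _ hg
  set E : ℝ := ∑ A, F A * F A with hE
  set s : ℝ := ∑ x, g x with hs
  have hsF : s = ∑ A, F A := (sum_push _ g).symm
  have hs_pos : 0 < s := sum_pos' (fun x _ => hg x) ⟨x₀, mem_univ _, hx₀⟩
  have hK : (0 : ℝ) ≤ Nat.card C := Nat.cast_nonneg _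
  have lower : l * (Nat.card C * E) ≤ ∑ c : C, fourier (adj g) c * fourier g c := by
    rw [parseval, mul_left_comm]
    refine mul_le_mul_of_nonneg_left ?_ hK
    rw [hE, mul_sum]
    refine sum_le_sum fun A _ => ?_
    rw [← mul_assoc]
    exact mul_le_mul_of_nonneg_right (mul_push_le _ hadj A) (hF0 A)
  have hf0 : fourier g ((0 : C) : Fin n → ZMod 2) = s := by
    simp [fourier, chi_zero_left, hs]
  have upper : ∑ c : C, fourier (adj g) c * fourier g c ≤
      (n - 2 * d) * (Nat.card C * E) + 2 * d * s ^ 2 := by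
    have hterm : ∀ c : C, fourier (adj g) c * fourier g c ≤
        (n - 2 * d) * (fourier g c * fourier g c) + if c = 0 then 2 * d * s ^ 2 else 0 := by
      intro c
      rw [fourier_adj]
      split_ifs with hc
      · subst hc
        rw [hf0]
        simp
        nlinarith
      · have := hC c c.2 (by simpa using hc)
        nlinarith [mul_self_nonneg (fourier g c)]
    refine (sum_le_sum fun c _ => hterm c).trans ?_
    rw [sum_add_distrib, ← mul_sum, parseval]
    simp [hE, hF]
  have cs : s ^ 2 ≤ S.ncard * E := by
    have h1 : s = ∑ A ∈ S.toFinset, F A := by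
      rw [hsF]
      refine (sum_subset (subset_univ _) fun A _ hA => ?_).symm
      refine sum_eq_zero fun x _ => ?_
      split_ifs with hx
      · by_contra h
        exact hA (by simpa [hx] using hS x h)
      · rfl
    rw [h1, Set.ncard_eq_toFinset_card']
    refine sq_sum_le_card_mul_sum_sq.trans ?_
    refine mul_le_mul_of_nonneg_left ?_ (Nat.cast_nonneg _)
    simp_rw [hE, ← sq]
    exact sum_le_sum_of_subset_of_nonneg (subset_univ _) fun _ _ _ => sq_nonneg _
  have hE_pos : 0 < E := by
    have : 0 ≤ E := sum_nonneg fun A _ => mul_self_nonneg _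
    rcases this.lt_or_eq with h | h
    · exact h
    · rw [← h] at cs
      nlinarith [pow_pos hs_pos 2]
  have : ((l - (n - 2 * d)) * Nat.card C) * E ≤ (2 * d * S.ncard) * E := by
    nlinarith [mul_le_mul_of_nonneg_left cs (show 0 ≤ 2 * d by linarith)]
  exact le_of_mul_le_mul_right this hE_pos

lemma hammingNorm_add_single {n : ℕ} (x : Fin n → ZMod 2) (i : Fin n) :
    hammingNorm (x + Pi.single i 1) =
      if x i = 0 then hammingNorm x + 1 else hammingNorm x - 1 := by
  have h01 : ∀ a : ZMod 2, a ≠ 0 → a = 1 := by decide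
  split_ifs with h
  · have : ({j | (x + Pi.single i 1 : Fin n → ZMod 2) j ≠ 0} : Finset (Fin n)) =
        insert i ({j | x j ≠ 0} : Finset (Fin n)) := by
      ext j
      by_cases hj : j = i
      · subst hj; simp [h]
      · simp [hj]
    rw [hammingNorm, this, card_insert_of_notMem (by simp [h]), hammingNorm]
  · have : ({j | (x + Pi.single i 1 : Fin n → ZMod 2) j ≠ 0} : Finset (Fin n)) =
        ({j | x j ≠ 0} : Finset (Fin n)).erase i := by
      ext j
      by_cases hj : j = i
      · subst hj; simp [h01 _ h, CharTwo.add_self_eq_zero]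
      · simp [hj]
    rw [hammingNorm, this, card_erase_of_mem (by simp [h]), hammingNorm]

lemma adj_radial {n : ℕ} (u : ℕ → ℝ) (x : Fin n → ZMod 2) :
    adj (fun y => u (hammingNorm y)) x =
      hammingNorm x * u (hammingNorm x - 1) + (n - hammingNorm x) * u (hammingNorm x + 1) := by
  have h1 : (#{j | ¬ x j = 0} : ℝ) = hammingNorm x := rfl
  have h2 : (#{j | x j = 0} : ℝ) = n - hammingNorm x := by
    have := card_filter_add_card_filter_not (s := (univ : Finset (Fin n))) (fun j => x j = 0)
    rw [eq_sub_iff_add_eq, ← h1]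
    exact_mod_cast this.trans (by simp)
  simp_rw [adj, hammingNorm_add_single, apply_ite u]
  rw [sum_ite, sum_const, sum_const, nsmul_eq_mul, nsmul_eq_mul, h1, h2]
  ring

/-- A truncated parabola supported strictly between `L` and `L + M`. -/
noncomputable def bump (L M k : ℕ) : ℝ := max 0 (((k : ℝ) - L) * ((L : ℝ) + M - k))

lemma bump_nonneg (L M k : ℕ) : 0 ≤ bump L M k := le_max_left _ _

lemma bump_ne_zero {L M k : ℕ} (h : bump L M k ≠ 0) : L < k ∧ k < L + M := by
  rw [bump] at h
  have h' : 0 < ((k : ℝ) - L) * ((L : ℝ) + M - k) := by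
    by_contra! h0
    exact h (max_eq_left h0)
  have hM : (0 : ℝ) ≤ M := Nat.cast_nonneg _
  rcases pos_and_pos_or_neg_and_neg_of_mul_pos h' with ⟨h1, h2⟩ | ⟨h1, h2⟩
  · exact ⟨by exact_mod_cast (by linarith : (L : ℝ) < k),
      by exact_mod_cast (by push_cast; linarith : (k : ℝ) < (L + M : ℕ))⟩
  · linarith

lemma bump_superharmonic {L M k : ℕ} (hM : 2 ≤ M) (h : bump L M k ≠ 0) :
    (2 - 2 / ((M : ℝ) - 1)) * bump L M k ≤ bump L M (k - 1) + bump L M (k + 1) := by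
  obtain ⟨h1, h2⟩ := bump_ne_zero h
  have hM' : (2 : ℝ) ≤ M := by exact_mod_cast hM
  have h1' : (L : ℝ) + 1 ≤ k := by exact_mod_cast h1
  have h2' : (k : ℝ) + 1 ≤ L + M := by exact_mod_cast h2
  have hk : ((k - 1 : ℕ) : ℝ) = k - 1 := by
    rw [Nat.cast_sub (by omega)]; simp
  have e0 : bump L M k = ((k : ℝ) - L) * ((L : ℝ) + M - k) :=
    max_eq_right (by nlinarith)
  have e1 : ((k : ℝ) - 1 - L) * ((L : ℝ) + M - (k - 1)) ≤ bump L M (k - 1) := by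
    rw [bump, hk]; exact le_max_right _ _
  have e2 : ((k : ℝ) + 1 - L) * ((L : ℝ) + M - (k + 1)) ≤ bump L M (k + 1) := by
    rw [bump]; push_cast; exact le_max_right _ _
  have e3 : (M : ℝ) - 1 ≤ bump L M k := by rw [e0]; nlinarith
  have e4 : 2 ≤ 2 / ((M : ℝ) - 1) * bump L M k := by
    rw [div_mul_eq_mul_div, le_div_iff₀ (by linarith)]
    linarith
  nlinarith

/-- The test function on the levels `L < k < L + M` of the Hamming cube. -/
lemma exists_test_function {n L M : ℕ} {a b t : ℝ} (hb : 0 < b) (ht : 0 < t)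
    (hab : t ^ 2 = a * b) (hM : 2 ≤ M) (hL : a * n ≤ L) (hLM : (L : ℝ) + M ≤ (1 - b) * n) :
    ∃ g : (Fin n → ZMod 2) → ℝ, (∀ x, 0 ≤ g x) ∧ (∃ x₀, 0 < g x₀) ∧
      (∀ x, t * (2 - 2 / ((M : ℝ) - 1)) * n * g x ≤ adj g x) ∧
      ∀ x, g x ≠ 0 → hammingNorm x ≤ L + M := by
  set q : ℝ := t / b with hq
  have hq0 : 0 < q := div_pos ht hb
  have hqb : b * q = t := by rw [hq]; field_simp
  have hqa : a = t * q := by rw [hq]; field_simp; linarith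
  set u : ℕ → ℝ := fun k => q ^ k * bump L M k with hu
  have hu0 : ∀ k, 0 ≤ u k := fun k => mul_nonneg (pow_nonneg hq0.le _) (bump_nonneg _ _ _)
  have hn : (0 : ℝ) ≤ n := Nat.cast_nonneg _
  have hM' : (2 : ℝ) ≤ M := by exact_mod_cast hM
  refine ⟨fun x => u (hammingNorm x), fun x => hu0 _, ?_, ?_, ?_⟩
  · have hLn : L + 1 ≤ n := by
      have : (L : ℝ) + 1 ≤ n := by nlinarith
      exact_mod_cast this
    obtain ⟨s, -, hs⟩ := exists_subset_card_eq (s := (univ : Finset (Fin n))) (n := L + 1)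
      (by simpa using hLn)
    refine ⟨fun i => if i ∈ s then 1 else 0, ?_⟩
    have hw : hammingNorm (fun i => if i ∈ s then (1 : ZMod 2) else 0) = L + 1 := by
      simp [hammingNorm, hs]
    simp only [hw, hu]
    refine mul_pos (pow_pos hq0 _) (lt_max_of_lt_right ?_)
    push_cast
    nlinarith
  · intro x
    rw [adj_radial]
    beta_reduce
    generalize hk : hammingNorm x = k
    have hkn : (k : ℝ) ≤ n := by
      rw [← hk]; exact_mod_cast (hammingNorm_le_card_fintype (x := x)).trans (by simp)
    have hk0 : (0 : ℝ) ≤ k := Nat.cast_nonneg _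
    by_cases h : bump L M k = 0
    · have h0 : u k = 0 := by simp [hu, h]
      rw [h0, mul_zero]
      exact add_nonneg (mul_nonneg hk0 (hu0 _)) (mul_nonneg (by linarith) (hu0 _))
    · obtain ⟨h1, h2⟩ := bump_ne_zero h
      have h1' : (L : ℝ) < k := by exact_mod_cast h1
      have h2' : (k : ℝ) < L + M := by exact_mod_cast h2
      have hp : q ^ k = q ^ (k - 1) * q := by
        rw [← pow_succ]; congr 1; omega
      have s1 : t * n * (q ^ k * bump L M (k - 1)) ≤ k * u (k - 1) := by
        have : t * n * (q ^ k * bump L M (k - 1)) = (a * n) * u (k - 1) := by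
          simp only [hu]; rw [hp, hqa]; ring
        rw [this]
        exact mul_le_mul_of_nonneg_right (by linarith) (hu0 _)
      have s2 : t * n * (q ^ k * bump L M (k + 1)) ≤ (n - k) * u (k + 1) := by
        have : t * n * (q ^ k * bump L M (k + 1)) = (b * n) * u (k + 1) := by
          simp only [hu]; rw [pow_succ, ← hqb]; ring
        rw [this]
        exact mul_le_mul_of_nonneg_right (by linarith) (hu0 _)
      have s3 := mul_le_mul_of_nonneg_left (bump_superharmonic hM h)
        (show 0 ≤ t * n * q ^ k by positivity)
      calc _ = t * n * q ^ k * ((2 - 2 / ((M : ℝ) - 1)) * bump L M k) := by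
            simp only [hu]; ring
        _ ≤ _ := s3
        _ ≤ _ := by linarith
  · intro x hx
    exact (bump_ne_zero (right_ne_zero_of_mul hx)).2.le

/-- The ball of radius `k` around the zero coset. -/
def ball {n : ℕ} (D : Submodule (ZMod 2) (Fin n → ZMod 2)) (k : ℕ) :
    Set ((Fin n → ZMod 2) ⧸ D) := {A | cosetWeight D A ≤ k}

lemma cosetWeight_mk_le {n : ℕ} (D : Submodule (ZMod 2) (Fin n → ZMod 2))
    (x : Fin n → ZMod 2) : cosetWeight D (Submodule.Quotient.mk x) ≤ hammingNorm x :=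
  Nat.sInf_le ⟨x, rfl, rfl⟩

lemma exists_hammingNorm_eq_cosetWeight {n : ℕ} (D : Submodule (ZMod 2) (Fin n → ZMod 2))
    (A : (Fin n → ZMod 2) ⧸ D) :
    ∃ x : Fin n → ZMod 2, Submodule.Quotient.mk x = A ∧ hammingNorm x = cosetWeight D A := by
  obtain ⟨x, hx⟩ := Submodule.Quotient.mk_surjective D A
  exact Nat.sInf_mem (s := {k | ∃ x : Fin n → ZMod 2, Submodule.Quotient.mk x = A ∧
    hammingNorm x = k}) ⟨_, x, hx, rfl⟩

lemma sphere_card_le {n : ℕ} (D : Submodule (ZMod 2) (Fin n → ZMod 2)) (k : ℕ) :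
    (k + 1) * {A | cosetWeight D A = k + 1}.ncard ≤ n * (ball D k).ncard := by
  classical
  let e : Fin n → (Fin n → ZMod 2) ⧸ D := fun i => Submodule.Quotient.mk (Pi.single i 1)
  let I : (Fin n → ZMod 2) ⧸ D → Finset (Fin n) := fun A => {i | A + e i ∈ ball D k}
  have hI : ∀ A ∈ ({A | cosetWeight D A = k + 1} : Set _).toFinset, k + 1 ≤ #(I A) := by
    intro A hA
    obtain ⟨x, rfl, hx⟩ := exists_hammingNorm_eq_cosetWeight D A
    have hw : hammingNorm x = k + 1 := hx.trans (by simpa using hA)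
    rw [← hw, hammingNorm]
    refine card_le_card fun i hi => ?_
    have hi' : x i ≠ 0 := by simpa using hi
    have := cosetWeight_mk_le D (x + Pi.single i 1)
    rw [hammingNorm_add_single, if_neg hi', hw] at this
    exact mem_filter.2 ⟨mem_univ _, this⟩
  rw [Set.ncard_eq_toFinset_card', Set.ncard_eq_toFinset_card', mul_comm]
  calc _ ≤ ∑ A ∈ ({A | cosetWeight D A = k + 1} : Set _).toFinset, #(I A) := by
        rw [← smul_eq_mul]; exact card_nsmul_le_sum _ _ _ hI
    _ = #(({A | cosetWeight D A = k + 1} : Set _).toFinset.sigma I) := (card_sigma _ _).symm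
    _ ≤ #((univ : Finset (Fin n)) ×ˢ (ball D k).toFinset) := by
        refine card_le_card_of_injOn (fun p => (p.2, p.1 + e p.2)) ?_ ?_
        · rintro ⟨A, i⟩ h
          simp [I] at h
          simp [h.2]
        · rintro ⟨A, i⟩ - ⟨B, j⟩ - h
          simp only [Prod.mk.injEq] at h
          obtain ⟨rfl, h⟩ := h
          obtain rfl := add_right_cancel h
          rfl
    _ = _ := by simp

lemma ball_succ_card_le {n : ℕ} (D : Submodule (ZMod 2) (Fin n → ZMod 2)) {k : ℕ} {r : ℝ}
    (hr : 0 < r) (hk : r * n ≤ k + 1) :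
    ((ball D (k + 1)).ncard : ℝ) ≤ (1 + 1 / r) * (ball D k).ncard := by
  have h1 : ball D (k + 1) = ball D k ∪ {A | cosetWeight D A = k + 1} := by
    ext A; simp [ball]; omega
  have h2 : ((ball D (k + 1)).ncard : ℝ) ≤
      (ball D k).ncard + {A | cosetWeight D A = k + 1}.ncard := by
    rw [h1]; exact_mod_cast Set.ncard_union_le _ _
  have h3 : ((k : ℝ) + 1) * {A | cosetWeight D A = k + 1}.ncard ≤ n * (ball D k).ncard := by
    exact_mod_cast sphere_card_le D k
  have h4 : ({A | cosetWeight D A = k + 1}.ncard : ℝ) ≤ 1 / r * (ball D k).ncard := by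
    rw [div_mul_eq_mul_div, one_mul, le_div_iff₀ hr]
    have hk1 : (0 : ℝ) < k + 1 := by positivity
    refine le_of_mul_le_mul_left ?_ hk1
    have := mul_le_mul_of_nonneg_right hk (Nat.cast_nonneg (α := ℝ) (ball D k).ncard)
    have := mul_le_mul_of_nonneg_left h3 hr.le
    nlinarith
  linarith

lemma ball_add_card_le {n : ℕ} (D : Submodule (ZMod 2) (Fin n → ZMod 2)) {k : ℕ} {r : ℝ}
    (hr : 0 < r) (hk : r * n ≤ k + 1) (m : ℕ) :
    ((ball D (k + m)).ncard : ℝ) ≤ (1 + 1 / r) ^ m * (ball D k).ncard := by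
  induction m with
  | zero => simp
  | succ m ih =>
    have h := ball_succ_card_le D (k := k + m) hr (by push_cast; linarith [m.cast_nonneg (α := ℝ)])
    calc _ ≤ _ := h
      _ ≤ (1 + 1 / r) * ((1 + 1 / r) ^ m * (ball D k).ncard) :=
        mul_le_mul_of_nonneg_left ih (by positivity)
      _ = _ := by ring

/-- The bound with an explicit constant, for a radius `a * n + O(1)` slightly above `ρ * n`. -/
lemma exists_card_le_ball {δ ρ a : ℝ} (hδ0 : 0 < δ) (hδ2 : δ < 1 / 2)
    (hρ : ρ * (1 - ρ) = (1 / 2 - δ) ^ 2) (hρ0 : 0 < ρ) (hρa : ρ < a) (ha : a < 1 / 2) :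
    ∃ (K : ℝ) (M N : ℕ), 0 ≤ K ∧ ∀ n : ℕ, N ≤ n → ∀ C : Submodule (ZMod 2) (Fin n → ZMod 2),
      (∀ c ∈ C, c ≠ 0 → δ * n ≤ (hammingNorm c : ℝ)) →
      (Nat.card C : ℝ) ≤ K * (ball (dualCode C) (⌈a * n⌉₊ + M)).ncard := by
  set τ : ℝ := 1 / 2 - δ with hτ
  have hτ0 : 0 < τ := by linarith
  have ha0 : 0 < a := by linarith
  have haτ : τ ^ 2 < a * (1 - a) := by nlinarith
  set b : ℝ := (τ ^ 2 / a + (1 - a)) / 2 with hb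
  have hab : a * b = (τ ^ 2 + a * (1 - a)) / 2 := by rw [hb]; field_simp
  have hb0 : 0 < b := by
    have : 0 < τ ^ 2 / a := by positivity
    rw [hb]; linarith
  have hba : b < 1 - a := by nlinarith
  set t : ℝ := √(a * b) with ht
  have ht2 : t ^ 2 = a * b := Real.sq_sqrt (by positivity)
  have hτt : τ < t := Real.lt_sqrt_of_sq_lt (by linarith)
  have ht0 : 0 < t := hτ0.trans hτt
  obtain ⟨M, hM⟩ := exists_nat_gt (1 + t / (t - τ))
  have htτ : 0 < t - τ := by linarith
  have h1 : 1 < t / (t - τ) := by rw [lt_div_iff₀ htτ]; linarith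
  have hM2 : 2 ≤ M := by
    have : (2 : ℝ) < M := by linarith
    exact_mod_cast this.le
  have hM1 : t / ((M : ℝ) - 1) < t - τ := by
    rw [div_lt_iff₀ (by linarith)]
    have : t / (t - τ) < (M : ℝ) - 1 := by linarith
    rw [div_lt_iff₀ htτ] at this
    linarith
  set κ : ℝ := t * (2 - 2 / ((M : ℝ) - 1)) - 2 * τ with hκ
  have hκ0 : 0 < κ := by
    have : t * (2 - 2 / ((M : ℝ) - 1)) = 2 * t - 2 * (t / ((M : ℝ) - 1)) := by ring
    rw [hκ, this]; linarith
  obtain ⟨N, hN⟩ := exists_nat_gt ((M + 1) / (1 - b - a))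
  refine ⟨2 * δ / κ, M, N + 1, by positivity, fun n hn C hC => ?_⟩
  have hn0 : (0 : ℝ) < n := by exact_mod_cast (by omega : 0 < n)
  have hLM : ((⌈a * n⌉₊ : ℕ) : ℝ) + M ≤ (1 - b) * n := by
    have h2 := Nat.ceil_lt_add_one (show 0 ≤ a * n by positivity)
    have h3 : (N : ℝ) + 1 ≤ n := by exact_mod_cast hn
    rw [div_lt_iff₀ (by linarith)] at hN
    nlinarith
  obtain ⟨g, hg0, ⟨x₀, hx₀⟩, hadj, hsupp⟩ :=
    exists_test_function hb0 ht0 ht2 hM2 (Nat.le_ceil (a * n)) hLM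
  have key := card_le_of_adj C (by positivity) hC hg0 hx₀ hadj
    (ball (dualCode C) (⌈a * n⌉₊ + M)) fun x hx => (cosetWeight_mk_le _ x).trans (hsupp x hx)
  rw [div_mul_eq_mul_div, le_div_iff₀ hκ0]
  refine le_of_mul_le_mul_left ?_ hn0
  calc _ = _ := by rw [hκ, hτ]; ring
    _ ≤ _ := key
    _ = _ := by ring

lemma ball_ceil_card_le {n : ℕ} (D : Submodule (ZMod 2) (Fin n → ZMod 2)) {ρ a : ℝ}
    (hρ0 : 0 < ρ) (hρa : ρ < a) (M : ℕ) :
    ((ball D (⌈a * n⌉₊ + M)).ncard : ℝ) ≤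
      (1 + 1 / ρ) ^ ((a - ρ) * n + (M + 2)) * (ball D ⌊ρ * n⌋₊).ncard := by
  have hn : (0 : ℝ) ≤ n := Nat.cast_nonneg _
  have hfl := Nat.lt_floor_add_one (ρ * n)
  have hce := Nat.ceil_lt_add_one (show 0 ≤ a * n from mul_nonneg (hρ0.trans hρa).le hn)
  have hle : ⌊ρ * n⌋₊ ≤ ⌈a * n⌉₊ :=
    (Nat.floor_le_ceil _).trans (Nat.ceil_mono (mul_le_mul_of_nonneg_right hρa.le hn))
  have hD : 1 ≤ 1 + 1 / ρ := by linarith [one_div_pos.2 hρ0]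
  obtain ⟨m, hm⟩ := Nat.exists_eq_add_of_le (hle.trans (Nat.le_add_right _ M))
  rw [hm]
  refine (ball_add_card_le D hρ0 hfl.le m).trans ?_
  refine mul_le_mul_of_nonneg_right ?_ (Nat.cast_nonneg _)
  rw [← Real.rpow_natCast]
  refine Real.rpow_le_rpow_of_exponent_le hD ?_
  have : ((⌈a * n⌉₊ : ℕ) : ℝ) + M = (⌊ρ * n⌋₊ : ℕ) + m := by exact_mod_cast hm
  linarith

end FriedmanTillich

/-- Friedman–Tillich: fix `δ ∈ (0,1/2)` and `ρ = 1/2 − √(δ(1−δ))`.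
For every `ε > 0` there exists `N` such that for all `n ≥ N` and every linear code
`C ≤ F₂ⁿ` with minimum Hamming distance at least `δn`,
`|C| ≤ 2^(εn) · |B_T(ρn)|`, where `T` is the coset graph of `C`. -/
theorem friedman_tillich (δ : ℝ) (hδ0 : 0 < δ) (hδ2 : δ < 1 / 2)
    (ρ : ℝ) (hρ : ρ = 1 / 2 - Real.sqrt (δ * (1 - δ)))
    (ε : ℝ) (hε : 0 < ε) :
    ∃ N : ℕ, ∀ n : ℕ, N ≤ n → ∀ C : Submodule (ZMod 2) (Fin n → ZMod 2),
      (∀ c ∈ C, c ≠ 0 → δ * n ≤ (hammingNorm c : ℝ)) →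
      (Nat.card C : ℝ) ≤ 2 ^ (ε * n) *
        (({A : (Fin n → ZMod 2) ⧸ dualCode C |
            (cosetWeight (dualCode C) A : ℝ) ≤ ρ * n}.ncard : ℝ)) := by
  have hδ : 0 < δ * (1 - δ) := mul_pos hδ0 (by linarith)
  set s := Real.sqrt (δ * (1 - δ)) with hs
  have hs2 : s ^ 2 = δ * (1 - δ) := Real.sq_sqrt hδ.le
  have hs0 : 0 < s := Real.sqrt_pos.2 hδ
  have hρ0 : 0 < ρ := by nlinarith
  have hρτ : ρ * (1 - ρ) = (1 / 2 - δ) ^ 2 := by rw [hρ]; linarith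
  set D : ℝ := 1 + 1 / ρ with hD
  have hD1 : 1 < D := by linarith [one_div_pos.2 hρ0]
  have hD0 : 0 < D := by linarith
  have hlog : 0 < Real.logb 2 D := Real.logb_pos one_lt_two hD1
  set η : ℝ := min (ε / 2 / Real.logb 2 D) (s / 2) with hη
  have hη0 : 0 < η := lt_min (by positivity) (by positivity)
  have hηs : η ≤ s / 2 := min_le_right _ _
  have hDη : D ^ η ≤ 2 ^ (ε / 2) := by
    have h1 : D ^ η = 2 ^ (Real.logb 2 D * η) := by
      rw [Real.rpow_mul two_pos.le, Real.rpow_logb two_pos (by norm_num) hD0]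
    rw [h1]
    refine Real.rpow_le_rpow_of_exponent_le one_le_two ?_
    rw [mul_comm, ← le_div_iff₀ hlog]
    exact min_le_left _ _
  obtain ⟨K, M, N₁, hK0, hK⟩ := FriedmanTillich.exists_card_le_ball (a := ρ + η)
    hδ0 hδ2 hρτ hρ0 (by linarith) (by linarith)
  have hlim := tendsto_pow_atTop_atTop_of_one_lt
    (Real.one_lt_rpow one_lt_two (half_pos hε))
  obtain ⟨N₂, hN₂⟩ := Filter.eventually_atTop.1
    (hlim.eventually_ge_atTop (K * D ^ ((M : ℝ) + 2)))
  refine ⟨max N₁ N₂, fun n hn C hC => ?_⟩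
  have hball : {A : (Fin n → ZMod 2) ⧸ dualCode C | (cosetWeight (dualCode C) A : ℝ) ≤ ρ * n} =
      FriedmanTillich.ball (dualCode C) ⌊ρ * n⌋₊ := by
    ext A
    exact (Nat.le_floor_iff (mul_nonneg hρ0.le n.cast_nonneg)).symm
  rw [hball]
  have h1 := hK n (le_of_max_le_left hn) C hC
  have h2 := FriedmanTillich.ball_ceil_card_le (dualCode C) hρ0 (show ρ < ρ + η by linarith) M
  have h3 := hN₂ n (le_of_max_le_right hn)
  set B : ℝ := ((FriedmanTillich.ball (dualCode C) ⌊ρ * n⌋₊).ncard : ℝ)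
  have hB : 0 ≤ B := Nat.cast_nonneg _
  have h4 : D ^ ((ρ + η - ρ) * n + ((M : ℝ) + 2)) ≤ (2 ^ (ε / 2)) ^ n * D ^ ((M : ℝ) + 2) := by
    rw [Real.rpow_add hD0, add_sub_cancel_left, Real.rpow_mul_natCast hD0.le]
    gcongr
  have h5 : (2 : ℝ) ^ (ε * n) = (2 ^ (ε / 2)) ^ n * (2 ^ (ε / 2)) ^ n := by
    rw [← Real.rpow_mul_natCast two_pos.le, ← Real.rpow_add two_pos]
    congr 1
    ring
  calc (Nat.card C : ℝ) ≤ K * ((2 ^ (ε / 2)) ^ n * D ^ ((M : ℝ) + 2) * B) :=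
        h1.trans (mul_le_mul_of_nonneg_left
          (h2.trans (mul_le_mul_of_nonneg_right h4 hB)) hK0)
    _ = (2 ^ (ε / 2)) ^ n * (K * D ^ ((M : ℝ) + 2)) * B := by ring
    _ ≤ 2 ^ (ε * n) * B := by
      rw [h5]
      gcongr
end

section
/- Fix δ ∈ (0,1/2), set ρ = 1/2 − √(δ(1−δ)), and fix a real λ with 0 < λ ≤ 1. For every ε > 0 there exists N such that for all n ≥ N and every linear code C ≤ F₂ⁿ whose minimum Hamming distance is at least δn, one has |C| ≤ 2^(εn) · λ^(−ρn) · Q_{C⊥}(λ). -/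
open Finset Filter

/-- The nontrivial real character of `ZMod 2`. -/
def signChar (a : ZMod 2) : ℝ := if a = 0 then 1 else -1

lemma signChar_add (a b : ZMod 2) : signChar (a + b) = signChar a * signChar b := by
  have key : ∀ a b : ZMod 2, (a + b = 0 ↔ (a = 0 ↔ b = 0)) := by decide
  unfold signChar
  rw [if_congr (key a b) rfl rfl]
  split_ifs <;> simp_all

/-- The restriction to `c` of the Fourier transform of a real function on `F₂ⁿ`. -/
noncomputable def walsh {n : ℕ} (f : (Fin n → ZMod 2) → ℝ) (c : Fin n → ZMod 2) : ℝ :=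
  ∑ x, f x * signChar (x ⬝ᵥ c)

/-- The adjacency operator of the Hamming cube. -/
noncomputable def cubeAdj {n : ℕ} (f : (Fin n → ZMod 2) → ℝ) (x : Fin n → ZMod 2) : ℝ :=
  ∑ i, f (x + Pi.single i 1)

open Classical in
/-- The sums of a function over the cosets of a code. -/
noncomputable def cosetSum {n : ℕ} (D : Submodule (ZMod 2) (Fin n → ZMod 2))
    (f : (Fin n → ZMod 2) → ℝ) (A : (Fin n → ZMod 2) ⧸ D) : ℝ :=
  ∑ x, if Submodule.Quotient.mk x = A then f x else 0

lemma mem_dualCode {n : ℕ} {C : Submodule (ZMod 2) (Fin n → ZMod 2)} {x : Fin n → ZMod 2} :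
    x ∈ dualCode C ↔ ∀ c ∈ C, x ⬝ᵥ c = 0 := Iff.rfl

open Classical in
lemma sum_signChar {n : ℕ} (C : Submodule (ZMod 2) (Fin n → ZMod 2)) [Fintype C]
    (y : Fin n → ZMod 2) :
    ∑ c : C, signChar (y ⬝ᵥ (c : Fin n → ZMod 2)) =
      if y ∈ dualCode C then (Fintype.card C : ℝ) else 0 := by
  split_ifs with h
  · rw [mem_dualCode] at h
    simp [signChar, h]
  · rw [mem_dualCode] at h
    push Not at h
    obtain ⟨c₀, hc₀, hy⟩ := h
    have key : ∑ c : C, signChar (y ⬝ᵥ (c : Fin n → ZMod 2)) =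
        ∑ c : C, signChar (y ⬝ᵥ ((c + ⟨c₀, hc₀⟩ : C) : Fin n → ZMod 2)) :=
      (Equiv.sum_comp (Equiv.addRight (⟨c₀, hc₀⟩ : C))
        (fun c : C => signChar (y ⬝ᵥ (c : Fin n → ZMod 2)))).symm
    have h1 : signChar (y ⬝ᵥ c₀) = -1 := by simp [signChar, hy]
    simp only [Submodule.coe_add, dotProduct_add, signChar_add, h1, mul_neg, mul_one,
      sum_neg_distrib] at key
    linarith

lemma sum_walsh_mul_walsh {n : ℕ} (C : Submodule (ZMod 2) (Fin n → ZMod 2)) [Fintype C]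
    [Fintype ((Fin n → ZMod 2) ⧸ dualCode C)] (f g : (Fin n → ZMod 2) → ℝ) :
    ∑ c : C, walsh f c * walsh g c =
      Fintype.card C * ∑ A, cosetSum (dualCode C) f A * cosetSum (dualCode C) g A := by
  classical
  have h1 : ∑ c : C, walsh f c * walsh g c =
      ∑ x, ∑ y, f x * g y * ∑ c : C, signChar ((x + y) ⬝ᵥ (c : Fin n → ZMod 2)) := by
    simp only [walsh, sum_mul_sum]
    rw [sum_comm]
    refine sum_congr rfl fun x _ => ?_
    rw [sum_comm]
    refine sum_congr rfl fun y _ => ?_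
    rw [mul_sum]
    refine sum_congr rfl fun c _ => ?_
    rw [add_dotProduct, signChar_add]
    ring
  have h2 : ∑ A, cosetSum (dualCode C) f A * cosetSum (dualCode C) g A =
      ∑ x, ∑ y, f x * g y * if x + y ∈ dualCode C then 1 else 0 := by
    simp only [cosetSum, sum_mul_sum]
    rw [sum_comm]
    refine sum_congr rfl fun x _ => ?_
    rw [sum_comm]
    refine sum_congr rfl fun y _ => ?_
    have hxy : x + y ∈ dualCode C ↔
        (Submodule.Quotient.mk y : _ ⧸ dualCode C) = Submodule.Quotient.mk x := by
      rw [Submodule.Quotient.eq, ZModModule.sub_eq_add, add_comm]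
    rw [sum_eq_single (Submodule.Quotient.mk x : _ ⧸ dualCode C)]
    · simp [hxy]
    · intro A _ hA
      simp [hA.symm]
    · simp
  rw [h1, h2]
  simp only [sum_signChar, mul_sum]
  refine sum_congr rfl fun x _ => sum_congr rfl fun y _ => ?_
  split_ifs <;> ring

lemma sum_signChar_apply {n : ℕ} (c : Fin n → ZMod 2) :
    ∑ i, signChar (c i) = n - 2 * hammingNorm c := by
  have : ∀ i, signChar (c i) = 1 - 2 * if c i ≠ 0 then 1 else 0 := by
    intro i
    unfold signChar
    split_ifs <;> first | contradiction | norm_num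
  simp only [this, sum_sub_distrib, ← mul_sum, sum_boole, hammingNorm]
  simp

lemma walsh_cubeAdj {n : ℕ} (f : (Fin n → ZMod 2) → ℝ) (c : Fin n → ZMod 2) :
    walsh (cubeAdj f) c = (n - 2 * hammingNorm c) * walsh f c := by
  rw [← sum_signChar_apply, walsh]
  simp only [cubeAdj, sum_mul]
  rw [sum_comm]
  refine sum_congr rfl fun i _ => ?_
  rw [walsh, mul_sum, ← Equiv.sum_comp (Equiv.addRight (Pi.single i (1 : ZMod 2)))]
  refine sum_congr rfl fun x _ => ?_
  have : x + Pi.single i (1 : ZMod 2) + Pi.single i 1 = x := by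
    rw [add_assoc, ZModModule.add_self, add_zero]
  simp only [Equiv.coe_addRight, this, add_dotProduct, signChar_add, single_dotProduct, one_mul]
  ring

lemma sum_cosetSum {n : ℕ} (D : Submodule (ZMod 2) (Fin n → ZMod 2))
    [Fintype ((Fin n → ZMod 2) ⧸ D)] (f : (Fin n → ZMod 2) → ℝ) :
    ∑ A, cosetSum D f A = ∑ x, f x := by
  classical
  simp only [cosetSum]
  rw [sum_comm]
  simp

lemma cosetSum_mono {n : ℕ} (D : Submodule (ZMod 2) (Fin n → ZMod 2))
    {f g : (Fin n → ZMod 2) → ℝ} (h : ∀ x, f x ≤ g x) (A : (Fin n → ZMod 2) ⧸ D) :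
    cosetSum D f A ≤ cosetSum D g A := by
  refine sum_le_sum fun x _ => ?_
  split_ifs
  · exact h x
  · exact le_rfl

lemma cosetSum_nonneg {n : ℕ} (D : Submodule (ZMod 2) (Fin n → ZMod 2))
    {f : (Fin n → ZMod 2) → ℝ} (h : ∀ x, 0 ≤ f x) (A : (Fin n → ZMod 2) ⧸ D) :
    0 ≤ cosetSum D f A :=
  sum_nonneg fun x _ => by split_ifs; exacts [h x, le_rfl]

lemma cosetSum_const_mul {n : ℕ} (D : Submodule (ZMod 2) (Fin n → ZMod 2)) (a : ℝ)
    (f : (Fin n → ZMod 2) → ℝ) (A : (Fin n → ZMod 2) ⧸ D) :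
    cosetSum D (fun x => a * f x) A = a * cosetSum D f A := by
  simp only [cosetSum, mul_sum, mul_ite, mul_zero]

lemma cosetSum_eq_zero_of_lt_cosetWeight {n r : ℕ} (D : Submodule (ZMod 2) (Fin n → ZMod 2))
    {f : (Fin n → ZMod 2) → ℝ} (hf : ∀ x, r < hammingNorm x → f x = 0)
    {A : (Fin n → ZMod 2) ⧸ D} (hA : r < cosetWeight D A) : cosetSum D f A = 0 := by
  refine sum_eq_zero fun x _ => ?_
  split_ifs with h
  · exact hf x (hA.trans_le (Nat.sInf_le ⟨x, h, rfl⟩))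
  · rfl

/-- A nonnegative function supported in a Hamming ball whose image under the adjacency operator
is large forces many cosets of the dual code to have a representative in that ball. -/
lemma card_le_card_cosetWeight_le {n r : ℕ} (C : Submodule (ZMod 2) (Fin n → ZMod 2))
    [Fintype C] [Fintype ((Fin n → ZMod 2) ⧸ dualCode C)] {d μ : ℝ} (hd : 0 ≤ d)
    (hC : ∀ c ∈ C, c ≠ 0 → d ≤ (hammingNorm c : ℝ)) {f : (Fin n → ZMod 2) → ℝ}
    (hf0 : ∀ x, 0 ≤ f x) (hfpos : 0 < ∑ x, f x) (hfr : ∀ x, r < hammingNorm x → f x = 0)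
    (hadj : ∀ x, μ * f x ≤ cubeAdj f x) (hμ : n - 2 * d + 1 ≤ μ) :
    (Fintype.card C : ℝ) ≤ 2 * d * #{A | cosetWeight (dualCode C) A ≤ r} := by
  classical
  set S : Finset ((Fin n → ZMod 2) ⧸ dualCode C) := {A | cosetWeight (dualCode C) A ≤ r}
  set P := cosetSum (dualCode C) f with hP
  set E := ∑ A, P A * P A with hE
  have hsupp : ∑ A ∈ S, P A = ∑ x, f x := by
    rw [← sum_cosetSum (dualCode C) f]
    refine sum_subset (subset_univ _) fun A _ hA => ?_
    exact cosetSum_eq_zero_of_lt_cosetWeight _ hfr (by simpa [S] using hA)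
  have hcs : (∑ x, f x) ^ 2 ≤ #S * E := by
    rw [← hsupp]
    refine sq_sum_le_card_mul_sum_sq.trans ?_
    gcongr
    rw [hE]
    simp only [← sq]
    exact sum_le_sum_of_subset_of_nonneg (subset_univ _) fun _ _ _ => sq_nonneg _
  have hEpos : 0 < E := by
    by_contra! h
    have : (#S : ℝ) * E ≤ 0 := mul_nonpos_of_nonneg_of_nonpos (by positivity) h
    nlinarith [pow_pos hfpos 2]
  have hlow : μ * (Fintype.card C * E) ≤ ∑ c : C, walsh (cubeAdj f) c * walsh f c := by
    rw [sum_walsh_mul_walsh, mul_left_comm, hE, mul_sum]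
    refine mul_le_mul_of_nonneg_left (sum_le_sum fun A _ => ?_) (Nat.cast_nonneg _)
    rw [← mul_assoc, hP, ← cosetSum_const_mul _ μ]
    exact mul_le_mul_of_nonneg_right (cosetSum_mono _ hadj A) (cosetSum_nonneg _ hf0 A)
  have hw0 : walsh f 0 = ∑ x, f x := by simp [walsh, signChar]
  have hup : ∑ c : C, walsh (cubeAdj f) c * walsh f c ≤
      (n - 2 * d) * (Fintype.card C * E) + 2 * d * (∑ x, f x) ^ 2 := by
    have hz : 2 * d * (∑ x, f x) ^ 2 =
        ∑ c : C, if c = 0 then 2 * d * (walsh f c * walsh f c) else 0 := by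
      simp [hw0, sq]
    rw [hz, hE, ← sum_walsh_mul_walsh, mul_sum, ← sum_add_distrib]
    refine sum_le_sum fun c _ => ?_
    rw [walsh_cubeAdj, mul_assoc]
    split_ifs with h
    · subst h
      simp only [ZeroMemClass.coe_zero, hammingNorm_zero]
      apply le_of_eq
      push_cast
      ring
    · rw [add_zero]
      have := hC c c.2 (by simpa using h)
      exact mul_le_mul_of_nonneg_right (by linarith) (mul_self_nonneg _)
  have hcE : 0 ≤ Fintype.card C * E := by positivity
  have hfin : Fintype.card C * E ≤ 2 * d * #S * E := by
    have h1 := mul_le_mul_of_nonneg_right hμ hcE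
    have h2 := mul_le_mul_of_nonneg_left hcs (show 0 ≤ 2 * d by positivity)
    linarith
  exact le_of_mul_le_mul_right hfin hEpos

lemma card_mul_pow_le_cosetGF {n r : ℕ} (D : Submodule (ZMod 2) (Fin n → ZMod 2))
    [Fintype ((Fin n → ZMod 2) ⧸ D)] {lam : ℝ} (h0 : 0 < lam) (h1 : lam ≤ 1) :
    #{A | cosetWeight D A ≤ r} * lam ^ r ≤ cosetGF D lam := by
  classical
  rw [cosetGF, finsum_eq_sum_of_fintype, ← nsmul_eq_mul]
  refine (card_nsmul_le_sum _ (fun A => lam ^ cosetWeight D A) _ fun A hA => ?_).trans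
    (sum_le_sum_of_subset_of_nonneg (subset_univ _) fun _ _ _ => by positivity)
  exact pow_le_pow_of_le_one h0.le h1 (by simpa using hA)

lemma hammingNorm_add_single {n : ℕ} (x : Fin n → ZMod 2) (i : Fin n) :
    hammingNorm (x + Pi.single i 1) =
      if x i ≠ 0 then hammingNorm x - 1 else hammingNorm x + 1 := by
  have key : ∀ a : ZMod 2, (a + 1 ≠ 0 ↔ a = 0) := by decide
  unfold hammingNorm
  split_ifs with h
  · rw [← card_erase_of_mem (a := i) (by simpa using h)]
    congr 1
    ext j
    by_cases hj : j = i
    · subst hj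
      simp [key, h]
    · simp [hj]
  · rw [← card_insert_of_notMem (a := i) (by simpa using h)]
    congr 1
    ext j
    by_cases hj : j = i
    · subst hj
      simp only [not_not] at h
      simp [h]
    · simp [hj]

lemma cubeAdj_radial {n : ℕ} (g : ℕ → ℝ) (x : Fin n → ZMod 2) :
    cubeAdj (fun y => g (hammingNorm y)) x =
      hammingNorm x * g (hammingNorm x - 1) + (n - hammingNorm x) * g (hammingNorm x + 1) := by
  have h : ∀ i, g (hammingNorm (x + Pi.single i 1)) = g (hammingNorm x + 1) +
      (if x i ≠ 0 then 1 else 0) * (g (hammingNorm x - 1) - g (hammingNorm x + 1)) := by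
    intro i
    rw [hammingNorm_add_single]
    split_ifs <;> ring
  simp only [cubeAdj, h, sum_add_distrib, ← sum_mul, sum_boole]
  simp only [sum_const, card_univ, Fintype.card_fin, nsmul_eq_mul, hammingNorm]
  ring

lemma exists_hammingNorm_eq {n k : ℕ} (h : k ≤ n) :
    ∃ x : Fin n → ZMod 2, hammingNorm x = k := by
  obtain ⟨s, -, hs⟩ := exists_subset_card_eq (s := (univ : Finset (Fin n))) (by simpa using h)
  exact ⟨fun i => if i ∈ s then 1 else 0, by simpa [hammingNorm] using hs⟩

/-- A truncated parabola with an exponential factor, supported strictly between `a` and `a + m`. -/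
noncomputable def bump (t : ℝ) (a m i : ℕ) : ℝ := t ^ i * ((i - a) * (a + m - i) : ℕ)

lemma bump_nonneg {t : ℝ} (ht : 0 < t) (a m i : ℕ) : 0 ≤ bump t a m i := by
  unfold bump
  positivity

lemma bump_recurrence {t σ K : ℝ} {a m n i : ℕ} (ht : 0 < t) (hσ : 0 < σ) (hm : 2 ≤ m)
    (hin : i ≤ n) (ha : t * (σ * n) ≤ a) (hK : σ * n - K ≤ (n - a - m) * t) (hK0 : 0 ≤ K) :
    (2 * (σ * n) * (1 - 1 / (m - 1)) - 2 * K) * bump t a m i ≤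
      i * bump t a m (i - 1) + (n - i) * bump t a m (i + 1) := by
  have hin' : (0 : ℝ) ≤ n - i := by
    rw [sub_nonneg]
    exact_mod_cast hin
  by_cases hi : a < i ∧ i < a + m
  · obtain ⟨j, rfl⟩ : ∃ j, i = a + j + 1 := ⟨i - a - 1, by lia⟩
    obtain ⟨l, rfl⟩ : ∃ l, m = j + l + 2 := ⟨m - j - 2, by lia⟩
    simp only [bump]
    have e1 : a + j + 1 - a = j + 1 := by lia
    have e2 : a + (j + l + 2) - (a + j + 1) = l + 1 := by lia
    have e3 : a + j + 1 - 1 - a = j := by lia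
    have e4 : a + (j + l + 2) - (a + j + 1 - 1) = l + 2 := by lia
    have e5 : a + j + 1 + 1 - a = j + 2 := by lia
    have e6 : a + (j + l + 2) - (a + j + 1 + 1) = l := by lia
    rw [e1, e2, e3, e4, e5, e6, Nat.add_sub_cancel]
    push_cast at *
    have hA : t * (σ * n) ≤ a + j + 1 := by linarith [(Nat.cast_nonneg j : (0 : ℝ) ≤ j)]
    have hB : σ * n - K ≤ (n - (a + j + 1)) * t := by
      refine hK.trans (mul_le_mul_of_nonneg_right ?_ ht.le)
      linarith [(Nat.cast_nonneg l : (0 : ℝ) ≤ l)]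
    have hL : 2 * (σ * n) * (1 - 1 / ((j : ℝ) + l + 2 - 1)) * ((j + 1) * (l + 1)) ≤
        2 * (σ * n) * ((j + 1) * (l + 1) - 1) := by
      have hp : (0 : ℝ) < j + l + 2 - 1 := by
        linarith [(Nat.cast_nonneg l : (0 : ℝ) ≤ l), (Nat.cast_nonneg j : (0 : ℝ) ≤ j)]
      rw [mul_assoc]
      refine mul_le_mul_of_nonneg_left ?_ (by positivity)
      have : 1 ≤ 1 / ((j : ℝ) + l + 2 - 1) * ((j + 1) * (l + 1)) := by
        rw [one_div_mul_eq_div, le_div_iff₀ hp]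
        nlinarith [mul_nonneg (Nat.cast_nonneg (α := ℝ) l) (Nat.cast_nonneg (α := ℝ) j)]
      linarith
    have hM : K * ((j + 2) * l) ≤ 2 * K * ((j + 1) * (l + 1)) := by
      have : ((j : ℝ) + 2) * l ≤ 2 * ((j + 1) * (l + 1)) := by
        nlinarith [mul_nonneg (Nat.cast_nonneg (α := ℝ) l) (Nat.cast_nonneg (α := ℝ) j),
          (Nat.cast_nonneg l : (0 : ℝ) ≤ l), (Nat.cast_nonneg j : (0 : ℝ) ≤ j)]
      nlinarith
    have hA' := mul_le_mul_of_nonneg_right hA (show (0 : ℝ) ≤ j * (l + 2) by positivity)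
    have hB' := mul_le_mul_of_nonneg_right hB (show (0 : ℝ) ≤ (j + 2) * l by positivity)
    have key : t * ((2 * (σ * n) * (1 - 1 / ((j : ℝ) + l + 2 - 1)) - 2 * K) *
        ((j + 1) * (l + 1))) ≤
        (a + j + 1) * (j * (l + 2)) + t * ((n - (a + j + 1)) * t * ((j + 2) * l)) := by
      have h3 := mul_le_mul_of_nonneg_left
        (show (2 * (σ * n) * (1 - 1 / ((j : ℝ) + l + 2 - 1)) - 2 * K) * ((j + 1) * (l + 1)) ≤
          σ * n * (j * (l + 2)) + (n - (a + j + 1)) * t * ((j + 2) * l) by linarith) ht.le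
      linarith
    have := mul_le_mul_of_nonneg_left key (pow_pos ht (a + j)).le
    simp only [pow_succ]
    linarith
  · have h0 : bump t a m i = 0 := by
      have : (i - a) * (a + m - i) = 0 := by
        rw [Nat.mul_eq_zero]
        lia
      simp [bump, this]
    rw [h0, mul_zero]
    have := bump_nonneg ht a m (i - 1)
    have := bump_nonneg ht a m (i + 1)
    positivity

lemma card_le_mul_cosetGF {n a m : ℕ} {t σ K δ lam : ℝ}
    (C : Submodule (ZMod 2) (Fin n → ZMod 2)) (hδ : 0 ≤ δ)
    (hC : ∀ c ∈ C, c ≠ 0 → δ * n ≤ (hammingNorm c : ℝ))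
    (ht : 0 < t) (hσ : 0 < σ) (hm : 2 ≤ m) (han : a + 1 ≤ n) (ha : t * (σ * n) ≤ a)
    (hK : σ * n - K ≤ (n - a - m) * t) (hK0 : 0 ≤ K)
    (hμ : n - 2 * (δ * n) + 1 ≤ 2 * (σ * n) * (1 - 1 / (m - 1)) - 2 * K)
    (h0 : 0 < lam) (h1 : lam ≤ 1) :
    Nat.card C * lam ^ (a + m) ≤ 2 * (δ * n) * cosetGF (dualCode C) lam := by
  classical
  have := Fintype.ofFinite C
  have := Fintype.ofFinite ((Fin n → ZMod 2) ⧸ dualCode C)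
  have hcard := card_le_card_cosetWeight_le (r := a + m) C
    (f := fun x => bump t a m (hammingNorm x)) (by positivity) hC
    (fun x => bump_nonneg ht a m _) ?_ ?_ (fun x => ?_) hμ
  · rw [Nat.card_eq_fintype_card]
    calc (Fintype.card C : ℝ) * lam ^ (a + m)
        ≤ _ := mul_le_mul_of_nonneg_right hcard (by positivity)
      _ ≤ _ := by
        rw [mul_assoc]
        exact mul_le_mul_of_nonneg_left (card_mul_pow_le_cosetGF _ h0 h1) (by positivity)
  · obtain ⟨x, hx⟩ := exists_hammingNorm_eq han
    refine sum_pos' (fun x _ => bump_nonneg ht a m _) ⟨x, mem_univ _, ?_⟩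
    rw [hx, bump]
    have : 0 < (a + 1 - a) * (a + m - (a + 1)) := Nat.mul_pos (by lia) (by lia)
    positivity
  · intro x hx
    simp [bump, Nat.sub_eq_zero_of_le hx.le]
  · rw [cubeAdj_radial]
    refine bump_recurrence ht hσ hm ?_ ha hK hK0
    simpa using hammingNorm_le_card_fintype (x := x)

lemma exists_perturbed_parameters {δ η : ℝ} (hδ0 : 0 < δ) (hδ2 : δ < 1 / 2) (hη : 0 < η) :
    ∃ δ' ρ' σ : ℝ, 0 < δ' ∧ δ' < δ ∧ σ = 1 / 2 - δ' ∧
      0 < ρ' ∧ ρ' ≤ σ ∧ σ ^ 2 = ρ' * (1 - ρ') ∧ ρ' < 1 / 2 - √(δ * (1 - δ)) + η := by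
  have hcont : ContinuousAt (fun x : ℝ => 1 / 2 - √(x * (1 - x))) δ := by fun_prop
  have h1 : ∀ᶠ x in nhdsWithin δ (Set.Iio δ), 1 / 2 - √(x * (1 - x)) <
      1 / 2 - √(δ * (1 - δ)) + η :=
    nhdsWithin_le_nhds (hcont.eventually (gt_mem_nhds (by linarith)))
  have h2 : ∀ᶠ x in nhdsWithin δ (Set.Iio δ), 0 < x :=
    nhdsWithin_le_nhds (lt_mem_nhds hδ0)
  obtain ⟨x, hx1, hx0, hxδ⟩ := (h1.and (h2.and self_mem_nhdsWithin)).exists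
  have hnn : 0 ≤ x * (1 - x) := mul_nonneg hx0.le (by linarith)
  have hs := Real.sq_sqrt hnn
  have hs0 : √(x * (1 - x)) < 1 / 2 := by
    rw [Real.sqrt_lt' (by norm_num)]
    nlinarith [sq_pos_of_pos (show 0 < 1 / 2 - x by linarith)]
  have hsq : (1 / 2 - x) ^ 2 = (1 / 2 - √(x * (1 - x))) * (1 - (1 / 2 - √(x * (1 - x)))) := by
    linarith
  refine ⟨x, 1 / 2 - √(x * (1 - x)), 1 / 2 - x, hx0, hxδ, rfl, by linarith, ?_, hsq, hx1⟩
  refine le_of_sq_le_sq ?_ (by linarith)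
  rw [hsq, sq]
  exact mul_le_mul_of_nonneg_left (by linarith [Real.sqrt_nonneg (x * (1 - x))]) (by linarith)

lemma eventually_log_natCast_le {c : ℝ} (hc : 0 < c) :
    ∀ᶠ n : ℕ in atTop, Real.log n ≤ c * n := by
  filter_upwards [(Real.isLittleO_log_id_atTop.comp_tendsto
    tendsto_natCast_atTop_atTop).bound hc] with n hn
  simpa using (le_abs_self _).trans hn

lemma eventually_le_mul_natCast (b : ℝ) {c : ℝ} (hc : 0 < c) :
    ∀ᶠ n : ℕ in atTop, b ≤ c * n :=
  (tendsto_natCast_atTop_atTop.const_mul_atTop hc).eventually_ge_atTop b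

/-- fix `δ ∈ (0,1/2)`, `ρ = 1/2 − √(δ(1−δ))` and `0 < λ ≤ 1`.
For every `ε > 0` there exists `N` such that for all `n ≥ N` and every linear code
`C ≤ F₂ⁿ` with minimum Hamming distance at least `δn`,
`|C| ≤ 2^(εn) · λ^(−ρn) · Q_{C⊥}(λ)`. -/
theorem card_le_gf_of_min_distance (δ : ℝ) (hδ0 : 0 < δ) (hδ2 : δ < 1 / 2)
    (ρ : ℝ) (hρ : ρ = 1 / 2 - Real.sqrt (δ * (1 - δ)))
    (lam : ℝ) (hlam0 : 0 < lam) (hlam1 : lam ≤ 1)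
    (ε : ℝ) (hε : 0 < ε) :
    ∃ N : ℕ, ∀ n : ℕ, N ≤ n → ∀ C : Submodule (ZMod 2) (Fin n → ZMod 2),
      (∀ c ∈ C, c ≠ 0 → δ * n ≤ (hammingNorm c : ℝ)) →
      (Nat.card C : ℝ) ≤ 2 ^ (ε * n) * lam ^ (-(ρ * n)) * cosetGF (dualCode C) lam := by
  set L := -Real.log lam with hLdef
  have hL : 0 ≤ L := neg_nonneg.2 (Real.log_nonpos hlam0.le hlam1)
  set c := ε * Real.log 2 / 3 with hcdef
  have hc : 0 < c := by have := Real.log_pos one_lt_two; positivity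
  obtain ⟨δ', ρ', σ, hδ'0, hδ', hσ, hρ'0, hρ'σ, hsq, hρ'η⟩ :=
    exists_perturbed_parameters hδ0 hδ2 (η := c / (L + 1)) (by positivity)
  rw [← hρ] at hρ'η
  have hσ0 : 0 < σ := by linarith
  obtain ⟨k, hk⟩ := exists_nat_one_div_lt (sub_pos.2 hδ')
  have hev := (eventually_log_natCast_le hc).and
    ((eventually_le_mul_natCast (L * (k + 3)) hc).and
    ((eventually_le_mul_natCast (2 * (k + 3) + 1) (sub_pos.2 hδ')).and
    ((eventually_le_mul_natCast 2 (show 0 < 1 - ρ' by linarith)).and (eventually_gt_atTop 0))))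
  obtain ⟨N, hN⟩ := eventually_atTop.1 hev
  refine ⟨N, fun n hn C hC => ?_⟩
  obtain ⟨hlog, hLn, hκn, hρn, hnpos⟩ := hN n hn
  have hn0 : (0 : ℝ) < n := Nat.cast_pos.2 hnpos
  have ha1 : ρ' * n ≤ ⌈ρ' * n⌉₊ := Nat.le_ceil _
  have ha2 : (⌈ρ' * n⌉₊ : ℝ) < ρ' * n + 1 := Nat.ceil_lt_add_one (by positivity)
  set a := ⌈ρ' * n⌉₊
  have ht1 : ρ' / σ ≤ 1 := (div_le_one hσ0).2 hρ'σ
  have ht0 : 0 < ρ' / σ := div_pos hρ'0 hσ0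
  have htσ : ρ' / σ * σ = ρ' := div_mul_cancel₀ _ hσ0.ne'
  have htσ' : (1 - ρ') * (ρ' / σ) = σ := by
    field_simp
    linarith
  have hmain := card_le_mul_cosetGF (n := n) (a := a) (m := k + 2) (t := ρ' / σ) (σ := σ)
    (K := k + 3) (δ := δ) C hδ0.le hC ht0 hσ0 (by lia) ?_ ?_ ?_ (by positivity) ?_ hlam0 hlam1
  · have hQ : 0 ≤ cosetGF (dualCode C) lam := finsum_nonneg fun A => by positivity
    have hdn : 2 * (δ * n) ≤ n := by nlinarith
    have hexp : (n : ℝ) ≤ 2 ^ (ε * n) * lam ^ (-(ρ * n)) * lam ^ (a + k + 2) := by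
      rw [← Real.rpow_natCast, Real.rpow_def_of_pos two_pos, Real.rpow_def_of_pos hlam0,
        Real.rpow_def_of_pos hlam0, ← Real.exp_add, ← Real.exp_add,
        ← Real.log_le_iff_le_exp hn0]
      have h1 : L * (a + k + 2) ≤ L * ((ρ + c / (L + 1)) * n + (k + 3)) := by
        refine mul_le_mul_of_nonneg_left ?_ hL
        have := mul_le_mul_of_nonneg_right hρ'η.le hn0.le
        linarith
      have h2 : L * (c / (L + 1)) * n ≤ c * n := by
        refine mul_le_mul_of_nonneg_right ?_ hn0.le
        rw [← mul_div_assoc, div_le_iff₀ (by linarith)]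
        nlinarith
      have hlam : Real.log lam = -L := by rw [hLdef, neg_neg]
      have hlog2 : Real.log 2 * (ε * n) = 3 * (c * n) := by rw [hcdef]; ring
      rw [hlam, hlog2]
      push_cast
      linarith
    refine le_of_mul_le_mul_right (a := lam ^ (a + k + 2)) ?_ (by positivity)
    calc (Nat.card C : ℝ) * lam ^ (a + k + 2)
        ≤ 2 * (δ * n) * cosetGF (dualCode C) lam := hmain
      _ ≤ n * cosetGF (dualCode C) lam := mul_le_mul_of_nonneg_right hdn hQ
      _ ≤ _ := mul_le_mul_of_nonneg_right hexp hQ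
      _ = _ := by ring
  · have : (a : ℝ) + 1 ≤ n := by linarith
    exact_mod_cast this
  · rw [← mul_assoc, htσ]
    exact ha1
  · have h1 : ((1 - ρ') * n - (k + 3)) * (ρ' / σ) ≤
        (n - a - (k + 2 : ℕ)) * (ρ' / σ) := by
      refine mul_le_mul_of_nonneg_right ?_ ht0.le
      push_cast
      linarith
    have h2 : (k + 3 : ℝ) * (ρ' / σ) ≤ k + 3 := mul_le_of_le_one_right (by positivity) ht1
    have h3 : ((1 - ρ') * n - (k + 3)) * (ρ' / σ) = σ * n - (k + 3) * (ρ' / σ) := by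
      rw [sub_mul, mul_right_comm, htσ']
    linarith
  · have e : ((k + 2 : ℕ) : ℝ) - 1 = k + 1 := by
      push_cast
      ring
    rw [e]
    have h1 : 2 * (σ * n) * (1 / ((k : ℝ) + 1)) ≤ (δ - δ') * n := by
      have hσ2 : 2 * (σ * n) ≤ n := by nlinarith
      calc 2 * (σ * n) * (1 / ((k : ℝ) + 1)) ≤ n * (δ - δ') :=
            mul_le_mul hσ2 hk.le (by positivity) hn0.le
        _ = _ := mul_comm _ _
    rw [hσ] at h1 ⊢
    linarith
end

section
/- Suppose w divides n and let b₁,…,b_{n/w} ∈ F₂ⁿ be vectors with pairwise disjoint supports, each of size w, whose supports together cover {1,…,n}. Let C be the linear span of b₁,…,b_{n/w}. Then for every real λ, Q_C(λ) = ((1/2) Σ_{t=0}^{w} binom(w,t) λ^{min{t, w−t}})^(n/w). -/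
/-- Summing a function of the Hamming weight over all binary vectors. -/
theorem sum_hammingNorm_zmod_two {σ : Type*} [Fintype σ] [DecidableEq σ] (g : ℕ → ℝ) :
    ∑ y : σ → ZMod 2, g (hammingNorm y)
      = ∑ t ∈ Finset.range (Fintype.card σ + 1), ((Fintype.card σ).choose t : ℝ) * g t := by
  have key := Finset.sum_powerset_apply_card g (x := (Finset.univ : Finset σ))
  simp only [nsmul_eq_mul, Finset.card_univ] at key
  rw [← key]
  refine Finset.sum_bij' (fun y _ => Finset.univ.filter fun j => y j ≠ 0)
    (fun s _ j => if j ∈ s then 1 else 0) (by simp) (by simp) ?_ ?_ ?_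
  · intro y _
    funext j
    have : ∀ a : ZMod 2, (if a ≠ 0 then 1 else 0) = a := by decide
    simpa using this (y j)
  · intro s _
    ext j
    simp
  · intro y _
    rfl

/-- The Hamming weight is the sum of the weights of the restrictions to the fibers of a map. -/
theorem hammingNorm_eq_sum_fiber {ι κ : Type*} [Fintype ι] [Fintype κ] [DecidableEq κ]
    (f : ι → κ) (x : ι → ZMod 2) :
    hammingNorm x = ∑ k, hammingNorm fun j : {j // f j = k} => x j := by
  classical
  unfold hammingNorm
  rw [Finset.card_eq_sum_card_fiberwise (f := f) (t := Finset.univ) (by simp)]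
  refine Finset.sum_congr rfl fun k _ => ?_
  rw [← Finset.card_map (Function.Embedding.subtype fun j => f j = k)]
  congr 1
  ext j
  simp [and_comm]

/-- Adding a constant to a binary vector either keeps its weight or complements it. -/
theorem hammingNorm_add_const {σ : Type*} [Fintype σ] (y : σ → ZMod 2) (a : ZMod 2) :
    hammingNorm (fun j => y j + a)
      = if a = 0 then hammingNorm y else Fintype.card σ - hammingNorm y := by
  classical
  split_ifs with h
  · simp [h]
  · unfold hammingNorm
    rw [← Finset.card_compl]
    congr 1
    ext j
    have : ∀ u v : ZMod 2, v ≠ 0 → (u + v ≠ 0 ↔ u = 0) := by decide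
    simpa using this (y j) a h

/-- The weight of a coset of the code of vectors constant on the fibers of `f`. -/
theorem cosetWeight_range_funLeft {ι κ : Type} [Fintype ι] [Fintype κ] [DecidableEq κ]
    (f : ι → κ) (x : ι → ZMod 2) :
    cosetWeight (LinearMap.range (LinearMap.funLeft (ZMod 2) (ZMod 2) f))
        (Submodule.Quotient.mk x)
      = ∑ k, min (hammingNorm fun j : {j // f j = k} => x j)
          (Fintype.card {j // f j = k} - hammingNorm fun j : {j // f j = k} => x j) := by
  have weight (c : κ → ZMod 2) : hammingNorm (x + c ∘ f)
      = ∑ k, if c k = 0 then hammingNorm fun j : {j // f j = k} => x j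
          else Fintype.card {j // f j = k} - hammingNorm fun j : {j // f j = k} => x j := by
    rw [hammingNorm_eq_sum_fiber f]
    refine Finset.sum_congr rfl fun k _ => ?_
    rw [← hammingNorm_add_const]
    congr 1
    funext j
    simp [j.2]
  refine IsLeast.csInf_eq ⟨?_, ?_⟩
  · let c : κ → ZMod 2 := fun k => if (hammingNorm fun j : {j // f j = k} => x j) ≤
      Fintype.card {j // f j = k} - hammingNorm fun j : {j // f j = k} => x j then 0 else 1
    refine ⟨x + c ∘ f, ?_, ?_⟩
    · rw [Submodule.Quotient.eq, add_sub_cancel_left]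
      exact ⟨c, rfl⟩
    · rw [weight]
      refine Finset.sum_congr rfl fun k _ => ?_
      simp only [min_def, c]
      split_ifs <;> simp_all
  · rintro _ ⟨y, hy, rfl⟩
    rw [Submodule.Quotient.eq] at hy
    obtain ⟨c, hc⟩ := hy
    have hy' : y = x + c ∘ f := by
      rw [← sub_eq_iff_eq_add']
      exact hc.symm
    rw [hy', weight]
    refine Finset.sum_le_sum fun k _ => ?_
    split_ifs
    · exact min_le_left _ _
    · exact min_le_right _ _

/-- Averaging over a code: a sum over all vectors of a function of the coset. -/
theorem sum_comp_mkQ_eq_card_mul {ι : Type*} [Fintype ι] [DecidableEq ι]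
    (C : Submodule (ZMod 2) (ι → ZMod 2)) (F : (ι → ZMod 2) ⧸ C → ℝ) :
    ∑ x : ι → ZMod 2, F (Submodule.Quotient.mk x) = Nat.card C * ∑ᶠ A, F A := by
  classical
  have : Fintype ((ι → ZMod 2) ⧸ C) := Fintype.ofFinite _
  rw [finsum_eq_sum_of_fintype, Finset.mul_sum,
    ← Finset.sum_fiberwise (g := fun x => (Submodule.Quotient.mk x : (ι → ZMod 2) ⧸ C))]
  refine Finset.sum_congr rfl fun A _ => ?_
  obtain ⟨a, rfl⟩ := Submodule.Quotient.mk_surjective C A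
  rw [Finset.sum_congr rfl (g := fun _ => F (Submodule.Quotient.mk a)) (by simp +contextual),
    Finset.sum_const, nsmul_eq_mul, Nat.card_eq_fintype_card, ← Finset.card_univ]
  congr 2
  refine (Finset.card_bij (fun (c : C) _ => a + (c : ι → ZMod 2)) ?_ ?_ ?_).symm
  · rintro ⟨c, hc⟩ _
    simpa [Submodule.Quotient.eq] using hc
  · intro c _ d _ h
    exact Subtype.ext (add_left_cancel h)
  · intro x hx
    simp only [Finset.mem_filter, Finset.mem_univ, true_and, Submodule.Quotient.eq] at hx
    exact ⟨⟨x - a, hx⟩, Finset.mem_univ _, by simp⟩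

/-- A sum over vectors of a product over the fibers of `f` factors. -/
theorem sum_prod_fiber {ι κ : Type*} [Fintype ι] [DecidableEq ι] [Fintype κ] [DecidableEq κ]
    (f : ι → κ) (G : ∀ k, ({j // f j = k} → ZMod 2) → ℝ) :
    ∑ x : ι → ZMod 2, ∏ k, G k (fun j => x j) = ∏ k, ∑ y, G k y := by
  rw [Finset.prod_univ_sum, Fintype.piFinset_univ]
  refine Fintype.sum_bijective (fun x k (j : {j // f j = k}) => x j) ⟨?_, ?_⟩ _ _ fun x => rfl
  · intro x y h
    funext j
    exact congrFun (congrFun h (f j)) ⟨j, rfl⟩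
  · intro y
    refine ⟨fun j => y (f j) ⟨j, rfl⟩, ?_⟩
    funext k ⟨j, hj⟩
    subst hj
    rfl

/-- The coset-weight generating function of the code of vectors constant on the fibers of a
surjection all of whose fibers have size `w`. -/
theorem cosetGF_range_funLeft {ι κ : Type} [Fintype ι] [DecidableEq ι] [Fintype κ] [DecidableEq κ]
    (f : ι → κ) (hf : Function.Surjective f) (w : ℕ)
    (hw : ∀ k, Fintype.card {j // f j = k} = w) (lam : ℝ) :
    cosetGF (LinearMap.range (LinearMap.funLeft (ZMod 2) (ZMod 2) f)) lam
      = ((1 / 2) * ∑ t ∈ Finset.range (w + 1), (w.choose t : ℝ) * lam ^ (min t (w - t)))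
          ^ Fintype.card κ := by
  have hinj := LinearMap.funLeft_injective_of_surjective (ZMod 2) (ZMod 2) f hf
  have hcard : Nat.card (LinearMap.range (LinearMap.funLeft (ZMod 2) (ZMod 2) f))
      = 2 ^ Fintype.card κ := by
    rw [← Nat.card_congr (LinearEquiv.ofInjective _ hinj).toEquiv]
    simp
  have hsum := sum_comp_mkQ_eq_card_mul (LinearMap.range (LinearMap.funLeft (ZMod 2) (ZMod 2) f))
    fun A => lam ^ cosetWeight _ A
  simp only [cosetWeight_range_funLeft, ← Finset.prod_pow_eq_pow_sum] at hsum
  rw [sum_prod_fiber f fun k y =>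
    lam ^ min (hammingNorm y) (Fintype.card {j // f j = k} - hammingNorm y)] at hsum
  simp only [hw, sum_hammingNorm_zmod_two fun t => lam ^ min t (w - t), Finset.prod_const,
    Finset.card_univ, hcard] at hsum
  rw [mul_pow, hsum, cosetGF, ← mul_assoc]
  simp

/-- suppose `w ∣ n` and `b₁,…,b_{n/w} ∈ F₂ⁿ` have pairwise disjoint supports,
each of size `w`, covering `{1,…,n}`. If `C` is their span, then
`Q_C(λ) = ((1/2) Σ_{t=0}^{w} binom(w,t) λ^{min{t, w−t}})^(n/w)`. -/
theorem cosetGF_disjoint_generators (n w : ℕ) (hw : w ∣ n)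
    (b : Fin (n / w) → (Fin n → ZMod 2))
    (hdisj : ∀ i j, i ≠ j → Disjoint (Function.support (b i)) (Function.support (b j)))
    (hsize : ∀ i, (Function.support (b i)).ncard = w)
    (hcover : (⋃ i, Function.support (b i)) = Set.univ)
    (lam : ℝ) :
    cosetGF (Submodule.span (ZMod 2) (Set.range b)) lam
      = ((1 / 2) * ∑ t ∈ Finset.range (w + 1), (w.choose t : ℝ) * lam ^ (min t (w - t)))
          ^ (n / w) := by
  classical
  have hex (j : Fin n) : ∃ i, b i j ≠ 0 := by
    have : j ∈ ⋃ i, Function.support (b i) := hcover ▸ Set.mem_univ j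
    simpa using this
  choose f hf using hex
  have hiff (i : Fin (n / w)) (j : Fin n) : b i j ≠ 0 ↔ f j = i := by
    refine ⟨fun h => ?_, fun h => h ▸ hf j⟩
    by_contra hne
    exact Set.disjoint_left.mp (hdisj _ _ hne) (hf j) h
  have hcard (k : Fin (n / w)) : Fintype.card {j // f j = k} = w := by
    refine Eq.trans ?_ (hsize k)
    rw [← Nat.card_coe_set_eq, ← Nat.card_eq_fintype_card]
    exact Nat.card_congr (Equiv.subtypeEquivRight fun j => (hiff k j).symm)
  have hsurj : Function.Surjective f := by
    intro k
    have hpos : 0 < w := Nat.pos_of_ne_zero fun h => by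
      have := k.2
      simp [h] at this
    obtain ⟨j⟩ := Fintype.card_pos_iff.mp ((hcard k).symm ▸ hpos)
    exact ⟨j, j.2⟩
  have hb (i : Fin (n / w)) :
      b i = LinearMap.funLeft (ZMod 2) (ZMod 2) f (Pi.basisFun (ZMod 2) _ i) := by
    funext j
    have h01 : ∀ a : ZMod 2, a ≠ 0 → a = 1 := by decide
    by_cases h : f j = i
    · simp [LinearMap.funLeft_apply, h, h01 _ ((hiff i j).mpr h)]
    · simp [LinearMap.funLeft_apply, h, not_not.mp (mt (hiff i j).mp h)]
  have hspan : Submodule.span (ZMod 2) (Set.range b)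
      = LinearMap.range (LinearMap.funLeft (ZMod 2) (ZMod 2) f) := by
    rw [LinearMap.range_eq_map, ← (Pi.basisFun (ZMod 2) (Fin (n / w))).span_eq,
      Submodule.map_span, ← Set.range_comp, funext hb]
    rfl
  rw [hspan, cosetGF_range_funLeft f hsurj w hcard, Fintype.card_fin]
end

section
/- Let v, w, Δ be nonnegative integers with v + Δ ≤ w. Then for every real λ with 0 < λ ≤ 1, Φ_{v,Δ}(λ) ≤ ((1+λ)^w / (1+λ^w))^(v/w). -/
/-- The local factor `Φ_{v,Δ}(λ) = (Σ_{t=0}^{v} binom(v,t) λ^{min{t, Δ+v−t}}) / (1 + λ^Δ)`. -/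
noncomputable def localFactor (v Δ : ℕ) (lam : ℝ) : ℝ :=
  (∑ t ∈ Finset.range (v + 1), (v.choose t : ℝ) * lam ^ (min t (Δ + v - t))) / (1 + lam ^ Δ)

/-- Since `λ^t + λ^(n-t) = λ^{min t (n-t)} (1 + λ^|n-2t|)`, the smaller exponent is controlled. -/
theorem pow_min_mul_one_add_pow_le {t n : ℕ} (htn : t ≤ n) {lam : ℝ}
    (hlam0 : 0 ≤ lam) (hlam1 : lam ≤ 1) :
    lam ^ min t (n - t) * (1 + lam ^ n) ≤ lam ^ t + lam ^ (n - t) := by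
  rw [mul_add, mul_one, ← pow_add]
  rcases le_total t (n - t) with hle | hle
  · rw [min_eq_left hle]
    exact add_le_add le_rfl (pow_le_pow_of_le_one hlam0 hlam1 (by omega))
  · rw [min_eq_right hle, add_comm (lam ^ t)]
    exact add_le_add le_rfl (pow_le_pow_of_le_one hlam0 hlam1 (by omega))

theorem sum_choose_mul_pow_add_pow (v Δ : ℕ) (lam : ℝ) :
    ∑ t ∈ Finset.range (v + 1), (v.choose t : ℝ) * (lam ^ t + lam ^ (Δ + v - t)) =
      (1 + lam) ^ v * (1 + lam ^ Δ) := by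
  have hleft : (1 + lam) ^ v = ∑ t ∈ Finset.range (v + 1), (v.choose t : ℝ) * lam ^ t := by
    rw [add_comm, add_pow]
    exact Finset.sum_congr rfl fun t _ => by ring
  have hright : (1 + lam) ^ v = ∑ t ∈ Finset.range (v + 1), (v.choose t : ℝ) * lam ^ (v - t) := by
    rw [add_pow]
    exact Finset.sum_congr rfl fun t _ => by ring
  rw [mul_add, mul_one]
  nth_rewrite 1 [hleft]
  rw [hright, Finset.sum_mul, ← Finset.sum_add_distrib]
  refine Finset.sum_congr rfl fun t ht => ?_
  rw [Nat.add_sub_assoc (Finset.mem_range_succ_iff.mp ht), pow_add]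
  ring

theorem localFactor_le_div (v Δ : ℕ) {lam : ℝ} (hlam0 : 0 ≤ lam) (hlam1 : lam ≤ 1) :
    localFactor v Δ lam ≤ (1 + lam) ^ v / (1 + lam ^ (Δ + v)) := by
  rw [localFactor, div_le_div_iff₀ (by positivity) (by positivity),
    ← sum_choose_mul_pow_add_pow, Finset.sum_mul]
  refine Finset.sum_le_sum fun t ht => ?_
  rw [mul_assoc]
  gcongr
  have := Finset.mem_range_succ_iff.mp ht
  exact pow_min_mul_one_add_pow_le (by omega) hlam0 hlam1

/-- for nonnegative integers `v, w, Δ` with `v + Δ ≤ w` and `0 < λ ≤ 1`,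
`Φ_{v,Δ}(λ) ≤ ((1+λ)^w / (1+λ^w))^(v/w)`. -/
theorem localFactor_le_general (v w Δ : ℕ) (h : v + Δ ≤ w)
    (lam : ℝ) (hlam0 : 0 < lam) (hlam1 : lam ≤ 1) :
    localFactor v Δ lam ≤ ((1 + lam) ^ w / (1 + lam ^ w)) ^ ((v : ℝ) / (w : ℝ)) := by
  have hvw : v ≤ w := by omega
  have hnum : ((1 + lam) ^ w) ^ ((v : ℝ) / (w : ℝ)) = (1 + lam) ^ v := by
    rcases Nat.eq_zero_or_pos w with rfl | hw
    · simp [Nat.le_zero.mp hvw]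
    · rw [← Real.rpow_natCast, ← Real.rpow_mul (by positivity),
        mul_div_cancel₀ _ (by positivity), Real.rpow_natCast]
  have hden : (1 + lam ^ w) ^ ((v : ℝ) / (w : ℝ)) ≤ 1 + lam ^ (Δ + v) :=
    calc (1 + lam ^ w) ^ ((v : ℝ) / (w : ℝ))
        ≤ (1 + lam ^ w) ^ (1 : ℝ) :=
          Real.rpow_le_rpow_of_exponent_le (le_add_of_nonneg_right (by positivity))
            (div_le_one_of_le₀ (by exact_mod_cast hvw) (by positivity))
      _ = 1 + lam ^ w := Real.rpow_one _
      _ ≤ 1 + lam ^ (Δ + v) :=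
          add_le_add le_rfl (pow_le_pow_of_le_one hlam0.le hlam1 (by omega))
  rw [Real.div_rpow (by positivity) (by positivity), hnum]
  exact (localFactor_le_div v Δ hlam0.le hlam1).trans (by gcongr)
end

section
/- Let v, Δ be nonnegative integers with v + Δ ≤ 3. Then for every real λ with 0 < λ ≤ 1, Φ_{v,Δ}(λ) ≤ (1+3λ)^(v/3). -/
/-- A bound on a quotient by a real power `b ^ (v / 3)` follows from its polynomial cube. -/
lemma div_le_rpow_div_three {N D b : ℝ} {v : ℕ} (hD : 0 < D) (hb : 0 ≤ b)
    (h : N ^ 3 ≤ b ^ v * D ^ 3) : N / D ≤ b ^ ((v : ℝ) / 3) := by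
  have hcube : (b ^ ((v : ℝ) / 3)) ^ 3 = b ^ v := by
    rw [← Real.rpow_natCast, ← Real.rpow_mul hb, ← Real.rpow_natCast b v]
    congr 1
    push_cast
    ring
  rw [div_le_iff₀ hD]
  refine le_of_pow_le_pow_left₀ three_ne_zero (by positivity) ?_
  rwa [mul_pow, hcube]

/-- for nonnegative integers `v, Δ` with `v + Δ ≤ 3` and `0 < λ ≤ 1`,
`Φ_{v,Δ}(λ) ≤ (1+3λ)^(v/3)`. -/
theorem localFactor_le_three (v Δ : ℕ) (h : v + Δ ≤ 3)
    (lam : ℝ) (hlam0 : 0 < lam) (hlam1 : lam ≤ 1) :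
    localFactor v Δ lam ≤ (1 + 3 * lam) ^ ((v : ℝ) / 3) := by
  refine div_le_rpow_div_three (by positivity) (by positivity) ?_
  have hv : v ≤ 3 := by omega
  have hpoly (p : ℝ) {a b : ℝ} (hp : 0 ≤ p) (hab : b - a = p) : a ≤ b := by linarith
  interval_cases v
  · have hpow : 0 ≤ lam ^ Δ := by positivity
    simpa using one_le_pow₀ (n := 3) (le_add_of_nonneg_right hpow)
  · have hΔ : Δ ≤ 2 := by omega
    interval_cases Δ <;> norm_num [Finset.sum_range_succ, Nat.choose]
    · nlinarith
    · exact le_mul_of_one_le_left (by positivity) (by linarith)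
    · exact hpoly (8 * lam ^ 3 + 3 * lam ^ 4 + 9 * lam ^ 5 + lam ^ 6 + 3 * lam ^ 7)
        (by positivity) (by ring)
  · have hΔ : Δ ≤ 1 := by omega
    interval_cases Δ <;> norm_num [Finset.sum_range_succ, Nat.choose]
    · nlinarith [pow_pos hlam0 3, pow_pos hlam0 2, mul_nonneg (sq_nonneg lam) (sub_nonneg.2 hlam1)]
    · exact hpoly ((1 + 3 * lam) ^ 2 * (3 * lam ^ 2 + lam ^ 3)) (by positivity) (by ring)
  · obtain rfl : Δ = 0 := by omega
    norm_num [Finset.sum_range_succ, Nat.choose]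
    exact le_of_eq (by ring)
end

section
/- Let v, Δ be nonnegative integers with v + Δ ≤ 4. Then for every real λ with 0 < λ ≤ 1, Φ_{v,Δ}(λ) ≤ (1+4λ+6λ²)^(v/4). -/
theorem div_le_rpow_div_four {x d p : ℝ} (v : ℕ) (hd : 0 < d) (hp : 0 ≤ p)
    (h : x ^ 4 ≤ p ^ v * d ^ 4) : x / d ≤ p ^ ((v : ℝ) / 4) := by
  refine le_of_pow_le_pow_left₀ four_ne_zero (Real.rpow_nonneg hp _) ?_
  rw [← Real.rpow_mul_natCast hp, Nat.cast_ofNat, div_mul_cancel₀ _ four_ne_zero,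
    Real.rpow_natCast, div_pow, div_le_iff₀ (by positivity)]
  exact h

/-- for nonnegative integers `v, Δ` with `v + Δ ≤ 4` and `0 < λ ≤ 1`,
`Φ_{v,Δ}(λ) ≤ (1+4λ+6λ²)^(v/4)`. -/
theorem localFactor_le_four (v Δ : ℕ) (h : v + Δ ≤ 4)
    (lam : ℝ) (hlam0 : 0 < lam) (hlam1 : lam ≤ 1) :
    localFactor v Δ lam ≤ (1 + 4 * lam + 6 * lam ^ 2) ^ ((v : ℝ) / 4) := by
  refine div_le_rpow_div_four v (by positivity) (by positivity) ?_
  have hv : v ≤ 4 := by omega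
  have hΔ : Δ ≤ 4 := by omega
  interval_cases v <;> interval_cases Δ <;> first
    | omega
    | simp only [Finset.sum_range_succ, Finset.sum_range_zero, Nat.choose]
      rw [← sub_nonneg]
      norm_num [-sub_nonneg]
      try ring_nf
      try positivity
end
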